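/- Let i ≥ 1 be such that #f_i = 1, #f_{i+1} = 2, and either i = 1 or #f_{i−1} = 1; write f_i = {d}, and let J be an invariant-factor count function for d. Then lim_{n→∞} ((1/n)·Σ_{m=1}^n J(m) − μ_i·log log n)/(log log n)^{1/2} = −σ_{i+1}/√(2π). -/

import Mathlib

open MeasureTheory ProbabilityTheory Filter

noncomputable section

/-- A key encoding the lexicographic order on pairs `(φ(q), q)`; this is a valid
encoding on prime powers since every prime power satisfies `q ≤ 2 * φ(q)`. -/
def ppKey (q : ℕ) : ℕ := 2 * Nat.totient q ^ 2 + q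

/-- The `n`-th smallest key of a prime power (0-indexed). -/
def ppNthKey (n : ℕ) : ℕ := Nat.nth (fun k => ∃ q : ℕ, IsPrimePow q ∧ ppKey q = k) n

/-- The total φ-sequence `q̃_i` (1-indexed): the enumeration of all prime powers
ordered by nondecreasing totient, with ties broken by increasing size. -/
def qt (i : ℕ) : ℕ := sInf {q : ℕ | IsPrimePow q ∧ ppKey q = ppNthKey (i - 1)}

/-- `lcm(q̃_1, …, q̃_i)`. -/
def Lseq (i : ℕ) : ℕ := (Finset.Icc 1 i).lcm qt

/-- The universal factor order set `f_i`. -/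
def UFO (i : ℕ) : Set ℕ :=
  if Nat.totient (qt i) < Nat.totient (qt (i + 1)) then {Lseq i}
  else {Lseq i, Nat.lcm (Lseq (i - 1)) (qt (i + 1))}

/-- `φ(q̃_i)` as a real number. -/
def phiQ (i : ℕ) : ℝ := (Nat.totient (qt i) : ℝ)

/-- `μ_i = 1/φ(q̃_i) − 1/φ(q̃_{i+1})`. -/
def muSeq (i : ℕ) : ℝ := 1 / phiQ i - 1 / phiQ (i + 1)

/-- `σ_i = (1/φ(q̃_i) + 1/φ(q̃_{i+1}) − 2/(φ(q̃_i)·φ(q̃_{i+1})))^{1/2}`. -/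
def sigSeq (i : ℕ) : ℝ :=
  Real.sqrt (1 / phiQ i + 1 / phiQ (i + 1) - 2 / (phiQ i * phiQ (i + 1)))

/-- `σ_{i;a,b} = (φ(q̃_i)^{−a} + φ(q̃_{i+1})^{−b} − 2/(φ(q̃_i)·φ(q̃_{i+1})))^{1/2}`. -/
def sigAB (i a b : ℕ) : ℝ :=
  Real.sqrt (1 / phiQ i ^ a + 1 / phiQ (i + 1) ^ b - 2 / (phiQ i * phiQ (i + 1)))

/-- `ν_j = (φ(q̃_j)^{−1}·(1 − φ(q̃_j)^{−1}))^{1/2}`. -/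
def nuSeq (j : ℕ) : ℝ := Real.sqrt (1 / phiQ j * (1 - 1 / phiQ j))

/-- `J` is an invariant-factor count function for `d`: whenever `(ℤ/mℤ)ˣ` is isomorphic to
a direct product of cyclic groups `ℤ/λ_1 × ⋯ × ℤ/λ_K` with `1 < λ_1 ∣ λ_2 ∣ ⋯ ∣ λ_K`,
`J m` is the number of indices `j` with `λ_j = d`. -/
def IsInvCount (d : ℕ) (J : ℕ → ℕ) : Prop :=
  ∀ m : ℕ, 1 ≤ m → ∀ K : ℕ, ∀ lam : Fin K → ℕ,
    (∀ j, 1 < lam j) →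
    (∀ j k : Fin K, j ≤ k → lam j ∣ lam k) →
    Nonempty ((ZMod m)ˣ ≃* Multiplicative (∀ j : Fin K, ZMod (lam j))) →
    J m = (Finset.univ.filter fun j : Fin K => lam j = d).card

/-- The number of `m ∈ {1, …, n}` satisfying `P`. -/
def cnt (P : ℕ → Prop) (n : ℕ) : ℕ := {m : ℕ | 1 ≤ m ∧ m ≤ n ∧ P m}.ncard

/-- The average `(1/n)·∑_{m=1}^n J(m)`. -/
def avg (J : ℕ → ℕ) (n : ℕ) : ℝ := (∑ m ∈ Finset.Icc 1 n, (J m : ℝ)) / n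

/-- `log log n`. -/
def LL (n : ℕ) : ℝ := Real.log (Real.log n)

/-- The standard normal cumulative distribution function. -/
def Phi (x : ℝ) : ℝ := (Real.sqrt (2 * Real.pi))⁻¹ * ∫ t in Set.Iic x, Real.exp (-t ^ 2 / 2)

/-- Owen's T-function. -/
def OwenT (h a : ℝ) : ℝ :=
  (2 * Real.pi)⁻¹ * ∫ t in (0:ℝ)..a, Real.exp (-(1 + t ^ 2) * h ^ 2 / 2) / (1 + t ^ 2)

/-- The skew-normal cumulative distribution function with parameter `α`. -/
def PhiSkew (x α : ℝ) : ℝ := Phi x - 2 * OwenT x α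

/-- The standard Gaussian probability measure `γ^k` on `ℝ^k`. -/
def stdGaussian (k : ℕ) : Measure (Fin k → ℝ) :=
  Measure.pi fun _ => gaussianReal 0 1

/-- `ω(m;q,1)`: the number of distinct primes `p ∣ m` with `p ≡ 1 (mod q)`. -/
def omegaQ (m q : ℕ) : ℕ := (m.primeFactors.filter fun p => p % q = 1 % q).card

/-- The correction term `Ē(m;p^α)`. -/
def Ebar (m p α : ℕ) : ℕ :=
  if p ^ α = 2 ∧ 8 ∣ m then 2
  else if p ^ α = 2 ∧ 4 ∣ m ∧ ¬(8 ∣ m) then 1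
  else if p = 2 ∧ 2 ≤ α ∧ 2 ^ (α + 2) ∣ m then 1
  else if p ≠ 2 ∧ p ^ (α + 1) ∣ m then 1
  else 0

/-- `prm(m;q)` for a prime power `q = p^α`: the unique `k` such that `p^k` is the cardinality
of the subgroup `{x ∈ (ℤ/mℤ)ˣ : x^p = 1 and x = y^{p^{α−1}} for some y}` (obtained here as the
`p`-adic valuation of that cardinality; note `p = q.minFac` and `p^{α−1} = q / p`). -/
def prm (m q : ℕ) : ℕ :=
  (Nat.card {x : (ZMod m)ˣ // x ^ q.minFac = 1 ∧ ∃ y : (ZMod m)ˣ, y ^ (q / q.minFac) = x}).factorization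
    q.minFac

/-- `m` is `y`-typical: for all prime powers `q₁, q₂` with `φ(q₁) ≤ y` and `φ(q₁) < φ(q₂)`
one has `prm(m;q₁) > prm(m;q₂)`. -/
def yTypical (y : ℝ) (m : ℕ) : Prop :=
  ∀ q₁ q₂ : ℕ, IsPrimePow q₁ → IsPrimePow q₂ →
    (Nat.totient q₁ : ℝ) ≤ y → Nat.totient q₁ < Nat.totient q₂ →
    prm m q₂ < prm m q₁

namespace InvFactor

open Complex in
lemma norm_neg_log_one_sub_sub_le {z : ℂ} (hz : ‖z‖ ≤ 1 / 2) : ‖-log (1 - z) - z‖ ≤ ‖z‖ ^ 2 := by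
  have h := Complex.norm_log_one_add_sub_self_le (z := -z) (by rw [norm_neg]; linarith)
  rw [norm_neg] at h
  have e : -log (1 - z) - z = -(log (1 + -z) - -z) := by rw [← sub_eq_add_neg]; ring
  rw [e, norm_neg]
  refine h.trans ?_
  have h2 : (1 - ‖z‖)⁻¹ ≤ 2 := by
    rw [inv_le_comm₀ (by linarith) (by norm_num)]; linarith
  nlinarith [sq_nonneg ‖z‖]

lemma norm_char_mul_cpow_le {q : ℕ} (χ : DirichletCharacter ℂ q) {s : ℝ} {n : ℕ} (hn : 0 < n) :
    ‖χ (n : ZMod q) * (n : ℂ) ^ (-(s : ℂ))‖ ≤ (n : ℝ) ^ (-s) := by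
  rw [norm_mul, Complex.norm_natCast_cpow_of_pos hn]
  simpa using mul_le_mul_of_nonneg_right (χ.norm_le_one (n : ZMod q))
    (Real.rpow_nonneg (Nat.cast_nonneg n) (-s))

/-- The constant bounding the contribution of proper prime powers to `log L`. -/
def primeSqSum : ℝ := ∑' p : Nat.Primes, (p : ℝ) ^ (-2 : ℝ)

lemma summable_primes_rpow {s : ℝ} (hs : 1 < s) : Summable fun p : Nat.Primes => (p : ℝ) ^ (-s) :=
  Nat.Primes.summable_rpow.2 (by linarith)

lemma summable_char_primes {q : ℕ} (χ : DirichletCharacter ℂ q) {s : ℝ} (hs : 1 < s) :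
    Summable fun p : Nat.Primes => χ ((p : ℕ) : ZMod q) * ((p : ℕ) : ℂ) ^ (-(s : ℂ)) :=
  Summable.of_norm_bounded (summable_primes_rpow hs)
    fun p => norm_char_mul_cpow_le χ p.2.pos

/-- The sum of a character over primes approximates the logarithm of the `L`-function. -/
lemma abs_re_tsum_char_sub_log_le {q : ℕ} (χ : DirichletCharacter ℂ q) {s : ℝ} (hs : 1 < s) :
    |(∑' p : Nat.Primes, χ ((p : ℕ) : ZMod q) * ((p : ℕ) : ℂ) ^ (-(s : ℂ))).re
      - Real.log ‖LSeries (fun n => χ (n : ZMod q)) s‖| ≤ primeSqSum := by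
  have hs' : 1 < (s : ℂ).re := by simpa using hs
  rw [← DirichletCharacter.LSeries_eulerProduct_exp_log χ hs', Complex.norm_exp, Real.log_exp,
    abs_sub_comm, ← Complex.sub_re,
    ← (χ.summable_neg_log_one_sub_mul_prime_cpow hs').tsum_sub (summable_char_primes χ hs)]
  refine (Complex.abs_re_le_norm _).trans (tsum_of_norm_bounded
    (summable_primes_rpow (by norm_num : (1 : ℝ) < 2)).hasSum fun p => ?_)
  have hp : (2 : ℝ) ≤ ((p : ℕ) : ℝ) := by exact_mod_cast p.2.two_le
  have h1 := norm_char_mul_cpow_le χ (s := s) p.2.pos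
  have h2 : ((p : ℕ) : ℝ) ^ (-s) ≤ ((p : ℕ) : ℝ) ^ (-1 : ℝ) :=
    Real.rpow_le_rpow_of_exponent_le (by linarith) (by linarith)
  have h3 : ((p : ℕ) : ℝ) ^ (-1 : ℝ) ≤ 1 / 2 := by
    rw [Real.rpow_neg_one, one_div]; exact inv_anti₀ (by norm_num) hp
  refine (norm_neg_log_one_sub_sub_le (h1.trans (h2.trans h3))).trans ?_
  calc _ ≤ (((p : ℕ) : ℝ) ^ (-1 : ℝ)) ^ 2 := by gcongr; exact h1.trans h2
    _ = _ := by rw [← Real.rpow_natCast, ← Real.rpow_mul (by positivity)]; norm_num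

/-- The Dirichlet series of primes congruent to `1` modulo `q`. -/
def primeSeries (q : ℕ) (s : ℝ) : ℝ :=
  ∑' p : Nat.Primes, if ((p : ℕ) : ZMod q) = 1 then (p : ℝ) ^ (-s) else 0

lemma summable_primeSeries (q : ℕ) {s : ℝ} (hs : 1 < s) :
    Summable fun p : Nat.Primes => if ((p : ℕ) : ZMod q) = 1 then (p : ℝ) ^ (-s) else 0 := by
  refine Summable.of_nonneg_of_le (fun p => ?_) (fun p => ?_) (summable_primes_rpow hs)
  · split_ifs
    · positivity
    · rfl
  · split_ifs
    · rfl
    · positivity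

lemma sum_char_natCast (q : ℕ) [NeZero q] (n : ℕ) :
    ∑ χ : DirichletCharacter ℂ q, χ (n : ZMod q) =
      if (n : ZMod q) = 1 then (q.totient : ℂ) else 0 := by
  have h := DirichletCharacter.sum_char_inv_mul_char_eq ℂ (isUnit_one (M := ZMod q)) (n : ZMod q)
  simp_rw [ZMod.inv_one, map_one, one_mul] at h
  rw [h]
  simp only [eq_comm]

lemma totient_mul_primeSeries (q : ℕ) [NeZero q] {s : ℝ} (hs : 1 < s) :
    (q.totient : ℝ) * primeSeries q s = ∑ χ : DirichletCharacter ℂ q,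
      (∑' p : Nat.Primes, χ ((p : ℕ) : ZMod q) * ((p : ℕ) : ℂ) ^ (-(s : ℂ))).re := by
  rw [← Complex.re_sum, ← Summable.tsum_finsetSum fun χ _ => summable_char_primes χ hs]
  rw [primeSeries, ← tsum_mul_left, ← Complex.ofReal_re (∑' _, _), Complex.ofReal_tsum]
  congr 1
  refine tsum_congr fun p => ?_
  rw [← Finset.sum_mul]
  rw [sum_char_natCast]
  by_cases hp : ((p : ℕ) : ZMod q) = 1
  · rw [if_pos hp, if_pos hp, Complex.ofReal_mul, Complex.ofReal_cpow (Nat.cast_nonneg _)]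
    simp
  · rw [if_neg hp, if_neg hp]
    simp

lemma exists_abs_log_norm_le {F : ℂ → ℂ} (hF : Differentiable ℂ F)
    (h0 : ∀ s : ℝ, 1 ≤ s → F s ≠ 0) :
    ∃ C : ℝ, ∀ s : ℝ, 1 < s → s ≤ 2 → |Real.log ‖F s‖| ≤ C := by
  have hc : ContinuousOn (fun s : ℝ => Real.log ‖F s‖) (Set.Icc 1 2) := by
    refine ContinuousOn.log ?_ fun s hs => norm_ne_zero_iff.2 (h0 s hs.1)
    exact (hF.continuous.comp Complex.continuous_ofReal).norm.continuousOn
  obtain ⟨C, hC⟩ := isCompact_Icc.exists_bound_of_continuousOn hc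
  exact ⟨C, fun s h1 h2 => hC s ⟨h1.le, h2⟩⟩

lemma trivChar₁_ne_zero (q : ℕ) [NeZero q] (s : ℝ) (hs : 1 ≤ s) :
    DirichletCharacter.LFunctionTrivChar₁ q s ≠ 0 := by
  rcases hs.eq_or_lt with rfl | h
  · simpa using DirichletCharacter.LFunctionTrivChar₁_apply_one_ne_zero q
  · have h1 : (s : ℂ) ≠ 1 := by exact_mod_cast h.ne'
    rw [DirichletCharacter.LFunctionTrivChar₁, Function.update_of_ne h1]
    refine mul_ne_zero (sub_ne_zero.2 h1) ?_
    exact DirichletCharacter.LFunction_ne_zero_of_one_le_re 1 (.inr h1) (by simpa using hs)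

/-- For a fixed modulus, the logarithm of an `L`-function on `(1, 2]` is bounded, apart from the
pole of the trivial character. -/
lemma exists_abs_log_LSeries_sub_le (q : ℕ) [NeZero q] (χ : DirichletCharacter ℂ q) :
    ∃ C : ℝ, ∀ s : ℝ, 1 < s → s ≤ 2 →
      |Real.log ‖LSeries (fun n => χ (n : ZMod q)) s‖
        - (if χ = 1 then Real.log (1 / (s - 1)) else 0)| ≤ C := by
  by_cases hχ : χ = 1
  · obtain ⟨C, hC⟩ := exists_abs_log_norm_le
      (DirichletCharacter.differentiable_LFunctionTrivChar₁ (n := q)) (trivChar₁_ne_zero q)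
    refine ⟨C, fun s h1 h2 => ?_⟩
    have hs : (s : ℂ) ≠ 1 := by exact_mod_cast h1.ne'
    have h := hC s h1 h2
    rw [DirichletCharacter.LFunctionTrivChar₁, Function.update_of_ne hs] at h
    have hL : DirichletCharacter.LFunction (1 : DirichletCharacter ℂ q) s ≠ 0 :=
      DirichletCharacter.LFunction_ne_zero_of_one_le_re 1 (.inr hs) (by simpa using h1.le)
    have hn : ‖(s : ℂ) - 1‖ = s - 1 := by
      rw [← Complex.ofReal_one, ← Complex.ofReal_sub, Complex.norm_real, Real.norm_of_nonneg]
      linarith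
    rw [DirichletCharacter.LFunctionTrivChar, norm_mul, hn,
      Real.log_mul (by linarith) (norm_ne_zero_iff.2 hL)] at h
    rw [if_pos hχ, hχ, ← DirichletCharacter.LFunction_eq_LSeries _ (by simpa using h1),
      one_div, Real.log_inv, sub_neg_eq_add, add_comm]
    exact h
  · obtain ⟨C, hC⟩ := exists_abs_log_norm_le (DirichletCharacter.differentiable_LFunction hχ)
      (fun s hs => DirichletCharacter.LFunction_ne_zero_of_one_le_re χ (.inl hχ) (by simpa using hs))
    refine ⟨C, fun s h1 h2 => ?_⟩
    rw [if_neg hχ, sub_zero, ← DirichletCharacter.LFunction_eq_LSeries _ (by simpa using h1)]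
    exact hC s h1 h2

/-- Dirichlet's theorem in analytic form, for a fixed modulus. -/
lemma exists_abs_primeSeries_sub_le (q : ℕ) [NeZero q] :
    ∃ C : ℝ, ∀ s : ℝ, 1 < s → s ≤ 2 →
      |primeSeries q s - Real.log (1 / (s - 1)) / q.totient| ≤ C := by
  choose C hC using exists_abs_log_LSeries_sub_le q
  have hq : (0 : ℝ) < q.totient := by exact_mod_cast Nat.totient_pos.2 (NeZero.pos q)
  refine ⟨(∑ χ : DirichletCharacter ℂ q, (primeSqSum + C χ)) / q.totient, fun s h1 h2 => ?_⟩
  have e : primeSeries q s - Real.log (1 / (s - 1)) / q.totient =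
      ((q.totient : ℝ) * primeSeries q s - Real.log (1 / (s - 1))) / q.totient := by
    field_simp
  have e2 : Real.log (1 / (s - 1)) =
      ∑ χ : DirichletCharacter ℂ q, if χ = 1 then Real.log (1 / (s - 1)) else 0 := by simp
  rw [e, abs_div, abs_of_pos hq, totient_mul_primeSeries q h1]
  nth_rewrite 1 [e2]
  rw [← Finset.sum_sub_distrib]
  gcongr
  refine (Finset.abs_sum_le_sum_abs _ _).trans (Finset.sum_le_sum fun χ _ => ?_)
  refine (abs_sub_le _ _ _).trans (add_le_add (abs_re_tsum_char_sub_log_le χ h1) (hC χ s h1 h2))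

lemma sum_range_mul_eq (q K : ℕ) (f : ℕ → ℂ) :
    ∑ n ∈ Finset.range (q * (K + 1)), f n = ∑ n ∈ Finset.range q, f n +
      ∑ j ∈ Finset.range K, ∑ b ∈ Finset.range q, f (q * (j + 1) + b) := by
  induction K with
  | zero => simp
  | succ K ih =>
    rw [show q * (K + 1 + 1) = q * (K + 1) + q by ring, Finset.sum_range_add, ih,
      Finset.sum_range_succ, add_assoc]

lemma sum_range_char {q : ℕ} [NeZero q] {χ : DirichletCharacter ℂ q} (hχ : χ ≠ 1) :
    ∑ b ∈ Finset.range q, χ (b : ZMod q) = 0 := by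
  rw [← MulChar.sum_eq_zero_of_ne_one hχ]
  refine Finset.sum_bij' (fun b _ => (b : ZMod q)) (fun a _ => a.val) ?_ ?_ ?_ ?_ ?_
  · simp
  · intro a _; simpa using ZMod.val_lt a
  · intro b hb; exact ZMod.val_cast_of_lt (Finset.mem_range.1 hb)
  · intro a _; simp
  · simp

lemma norm_char_block_le {q : ℕ} [NeZero q] {χ : DirichletCharacter ℂ q} (hχ : χ ≠ 1) {s : ℝ}
    (hs : 1 < s) (j : ℕ) :
    ‖∑ b ∈ Finset.range q, χ ((q * (j + 1) + b : ℕ) : ZMod q) *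
      ((q * (j + 1) + b : ℕ) : ℂ) ^ (-(s : ℂ))‖ ≤
      q * (((q * (j + 1) : ℕ) : ℝ) ^ (-s) - ((q * (j + 1 + 1) : ℕ) : ℝ) ^ (-s)) := by
  have hq := NeZero.pos q
  have key : ∀ b, χ ((q * (j + 1) + b : ℕ) : ZMod q) = χ (b : ZMod q) := by
    intro b; congr 1; push_cast; simp
  have cp : ∀ n : ℕ, (n : ℂ) ^ (-(s : ℂ)) = ((n : ℝ) ^ (-s) : ℝ) := by
    intro n; rw [Complex.ofReal_cpow (by positivity)]; simp
  have e : ∑ b ∈ Finset.range q, χ ((q * (j + 1) + b : ℕ) : ZMod q) *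
      ((q * (j + 1) + b : ℕ) : ℂ) ^ (-(s : ℂ)) =
      ∑ b ∈ Finset.range q, χ (b : ZMod q) *
        ((((q * (j + 1) + b : ℕ) : ℝ) ^ (-s) - ((q * (j + 1) : ℕ) : ℝ) ^ (-s) : ℝ) : ℂ) := by
    have : ∑ b ∈ Finset.range q, χ (b : ZMod q) *
        ((((q * (j + 1) : ℕ) : ℝ) ^ (-s) : ℝ) : ℂ) = 0 := by
      rw [← Finset.sum_mul, sum_range_char hχ, zero_mul]
    rw [← sub_zero (∑ b ∈ Finset.range q, _), ← this, ← Finset.sum_sub_distrib]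
    refine Finset.sum_congr rfl fun b _ => ?_
    rw [key, cp, Complex.ofReal_sub]; ring
  rw [e]
  refine (norm_sum_le _ _).trans ?_
  have : ∀ b ∈ Finset.range q, ‖χ (b : ZMod q) *
        ((((q * (j + 1) + b : ℕ) : ℝ) ^ (-s) - ((q * (j + 1) : ℕ) : ℝ) ^ (-s) : ℝ) : ℂ)‖ ≤
      ((q * (j + 1) : ℕ) : ℝ) ^ (-s) - ((q * (j + 1 + 1) : ℕ) : ℝ) ^ (-s) := by
    intro b hb
    have hb' := Finset.mem_range.1 hb
    have hpos : 0 < q * (j + 1) := by positivity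
    have hz : (0 : ℝ) < ((q * (j + 1) : ℕ) : ℝ) := by exact_mod_cast hpos
    have m1 : ((q * (j + 1) + b : ℕ) : ℝ) ^ (-s) ≤ ((q * (j + 1) : ℕ) : ℝ) ^ (-s) :=
      Real.rpow_le_rpow_of_nonpos hz (by exact_mod_cast Nat.le_add_right _ _) (by linarith)
    have m2 : ((q * (j + 1 + 1) : ℕ) : ℝ) ^ (-s) ≤ ((q * (j + 1) + b : ℕ) : ℝ) ^ (-s) :=
      Real.rpow_le_rpow_of_nonpos (by exact_mod_cast Nat.add_pos_left hpos b)
        (by exact_mod_cast (by nlinarith : q * (j + 1) + b ≤ q * (j + 1 + 1))) (by linarith)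
    rw [norm_mul, Complex.norm_real, Real.norm_eq_abs, abs_of_nonpos (by linarith)]
    have := χ.norm_le_one (b : ZMod q)
    have h0 := norm_nonneg (χ (b : ZMod q))
    nlinarith
  refine (Finset.sum_le_sum this).trans (le_of_eq ?_)
  rw [Finset.sum_const, Finset.card_range, nsmul_eq_mul]

/-- A uniform bound for nontrivial Dirichlet `L`-series on the real axis. -/
lemma norm_LSeries_le {q : ℕ} [NeZero q] {χ : DirichletCharacter ℂ q} (hχ : χ ≠ 1) {s : ℝ}
    (hs : 1 < s) : ‖LSeries (fun n => χ (n : ZMod q)) s‖ ≤ 2 + Real.log q := by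
  have hs' : 1 < (s : ℂ).re := by simpa using hs
  have hq := NeZero.pos q
  rw [← tsum_dirichletSummand χ hs']
  have ht := (summable_dirichletSummand χ hs').of_norm.hasSum.tendsto_sum_nat
  have ht2 := ht.comp (tendsto_atTop_mono (fun K : ℕ => (by nlinarith : K ≤ q * (K + 1))) tendsto_id)
  refine le_of_tendsto ht2.norm (Eventually.of_forall fun K => ?_)
  simp only [Function.comp]
  rw [sum_range_mul_eq]
  have hd : ∀ n : ℕ, dirichletSummandHom χ (Complex.ne_zero_of_one_lt_re hs') n =
    χ (n : ZMod q) * (n : ℂ) ^ (-(s : ℂ)) := fun n => rfl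
  have b1 : ‖∑ n ∈ Finset.range q, dirichletSummandHom χ (Complex.ne_zero_of_one_lt_re hs') n‖ ≤
      1 + Real.log q := by
    refine (norm_sum_le _ _).trans (le_trans ?_ (harmonic_le_one_add_log q))
    rw [harmonic]
    push_cast
    obtain ⟨r, rfl⟩ := Nat.exists_eq_succ_of_ne_zero hq.ne'
    rw [Finset.sum_range_succ', map_zero, norm_zero, add_zero, Finset.sum_range_succ]
    refine le_add_of_le_of_nonneg (Finset.sum_le_sum fun n _ => ?_) (by positivity)
    rw [hd]
    refine (norm_char_mul_cpow_le χ (Nat.succ_pos n)).trans ?_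
    rw [← Real.rpow_neg_one]
    push_cast
    exact Real.rpow_le_rpow_of_exponent_le (by linarith [(Nat.cast_nonneg n : (0 : ℝ) ≤ n)])
      (by linarith)
  have b2 : ‖∑ j ∈ Finset.range K, ∑ b ∈ Finset.range q,
      dirichletSummandHom χ (Complex.ne_zero_of_one_lt_re hs') (q * (j + 1) + b)‖ ≤ 1 := by
    simp only [hd]
    refine (norm_sum_le _ _).trans ((Finset.sum_le_sum fun j _ =>
      norm_char_block_le hχ hs j).trans ?_)
    rw [← Finset.mul_sum, Finset.sum_range_sub' (fun j => ((q * (j + 1) : ℕ) : ℝ) ^ (-s))]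
    have h1 : (0 : ℝ) ≤ ((q * (K + 1) : ℕ) : ℝ) ^ (-s) := by positivity
    have hq1 : (1 : ℝ) ≤ q := by exact_mod_cast hq
    have h2 : (q : ℝ) ^ (-s) ≤ (q : ℝ) ^ (-1 : ℝ) :=
      Real.rpow_le_rpow_of_exponent_le hq1 (by linarith)
    rw [Real.rpow_neg_one] at h2
    simp only [zero_add, mul_one]
    calc _ ≤ (q : ℝ) * (q : ℝ)⁻¹ := by gcongr; linarith
      _ = 1 := mul_inv_cancel₀ (by positivity)
  linarith [norm_add_le (∑ n ∈ Finset.range q,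
    dirichletSummandHom χ (Complex.ne_zero_of_one_lt_re hs') n) (∑ j ∈ Finset.range K,
      ∑ b ∈ Finset.range q, dirichletSummandHom χ (Complex.ne_zero_of_one_lt_re hs')
        (q * (j + 1) + b))]

/-- An upper bound for primes in arithmetic progressions, uniform in the modulus. -/
lemma exists_primeSeries_le :
    ∃ C : ℝ, ∀ q : ℕ, 2 ≤ q → ∀ s : ℝ, 1 < s → s ≤ 2 →
      primeSeries q s ≤ Real.log (1 / (s - 1)) / q.totient + Real.log (2 + Real.log q) + C := by
  obtain ⟨C1, hC1⟩ := exists_abs_primeSeries_sub_le 1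
  have hC1' : 0 ≤ C1 := (abs_nonneg _).trans (hC1 2 (by norm_num) le_rfl)
  have hsq : 0 ≤ primeSqSum := tsum_nonneg fun p => by positivity
  refine ⟨C1 + primeSqSum, fun q hq s h1 h2 => ?_⟩
  have : NeZero q := ⟨by omega⟩
  have hφ : (1 : ℝ) ≤ q.totient := by exact_mod_cast Nat.totient_pos.2 (NeZero.pos q)
  have hlq : 0 ≤ Real.log q := Real.log_natCast_nonneg q
  have hll : 0 ≤ Real.log (2 + Real.log q) := Real.log_nonneg (by linarith)
  have hbound : ∀ χ : DirichletCharacter ℂ q,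
      (∑' p : Nat.Primes, χ ((p : ℕ) : ZMod q) * ((p : ℕ) : ℂ) ^ (-(s : ℂ))).re ≤
        (if χ = 1 then Real.log (1 / (s - 1)) else 0) +
          (Real.log (2 + Real.log q) + (C1 + primeSqSum)) := by
    intro χ
    by_cases hχ : χ = 1
    · have h3 : (∑' p : Nat.Primes, χ ((p : ℕ) : ZMod q) * ((p : ℕ) : ℂ) ^ (-(s : ℂ))).re ≤
          primeSeries 1 s := by
        refine (Complex.re_le_norm _).trans
          (tsum_of_norm_bounded (summable_primeSeries 1 h1).hasSum fun p => ?_)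
        rw [if_pos (Subsingleton.elim _ _)]
        exact norm_char_mul_cpow_le χ p.2.pos
      have h4 := (abs_le.1 (hC1 s h1 h2)).2
      rw [Nat.totient_one, Nat.cast_one, div_one] at h4
      rw [if_pos hχ]
      linarith
    · have h3 := (abs_le.1 (abs_re_tsum_char_sub_log_le χ h1)).2
      have h4 := norm_LSeries_le hχ h1
      have h5 : Real.log ‖LSeries (fun n => χ (n : ZMod q)) s‖ ≤ Real.log (2 + Real.log q) := by
        refine Real.log_le_log (norm_pos_iff.2 ?_) h4
        rw [← DirichletCharacter.LFunction_eq_LSeries _ (by simpa using h1)]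
        exact DirichletCharacter.LFunction_ne_zero_of_one_le_re χ (.inl hχ) (by simpa using h1.le)
      rw [if_neg hχ]
      linarith
  have hsum := Finset.sum_le_sum fun χ (_ : χ ∈ (Finset.univ : Finset (DirichletCharacter ℂ q))) =>
    hbound χ
  have hcard : (Finset.univ : Finset (DirichletCharacter ℂ q)).card = q.totient := by
    rw [← DirichletCharacter.card_eq_totient_of_hasEnoughRootsOfUnity ℂ q,
      Nat.card_eq_fintype_card, Finset.card_univ]
  rw [← totient_mul_primeSeries q h1, Finset.sum_add_distrib, Finset.sum_const, hcard,
    nsmul_eq_mul, Finset.sum_ite_eq' Finset.univ, if_pos (Finset.mem_univ _)] at hsum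
  have hpos : (0 : ℝ) < q.totient := by linarith
  have : primeSeries q s ≤ (Real.log (1 / (s - 1)) +
      q.totient * (Real.log (2 + Real.log q) + (C1 + primeSqSum))) / q.totient := by
    rw [le_div_iff₀ hpos]; linarith
  refine this.trans (le_of_eq ?_)
  field_simp
  ring

open ArithmeticFunction.vonMangoldt in
lemma exists_tsum_residueClass_le :
    ∃ C : ℝ, ∀ s : ℝ, 1 < s → s ≤ 2 →
      ∑' n, residueClass (1 : ZMod 1) n / (n : ℝ) ^ s ≤ C / (s - 1) := by
  have ha : IsUnit (1 : ZMod 1) := isUnit_one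
  have H {x : ℝ} (hx : 1 < x) :
      ∑' n, residueClass (1 : ZMod 1) n / (n : ℝ) ^ x =
        (LFunctionResidueClassAux (1 : ZMod 1) x).re + 1 / (x - 1) := by
    refine Complex.ofReal_injective ?_
    simp only [Complex.ofReal_tsum, Complex.ofReal_div, Complex.ofReal_cpow (Nat.cast_nonneg _),
      Complex.ofReal_natCast, Complex.ofReal_add, Complex.ofReal_sub, Complex.ofReal_one]
    simp_rw [← LFunctionResidueClassAux_real ha hx,
      eqOn_LFunctionResidueClassAux ha <| Set.mem_ofPred.mpr (Complex.ofReal_re x ▸ hx)]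
    rw [Nat.totient_one, Nat.cast_one, inv_one, sub_add_cancel]
    simp_rw [LSeries, LSeries.term]
    refine tsum_congr fun n ↦ ?_
    split_ifs with hn
    · simp only [hn, residueClass_apply_zero, Complex.ofReal_zero, zero_div]
    · rfl
  have hc : ContinuousOn (fun x : ℝ ↦ (LFunctionResidueClassAux (1 : ZMod 1) x).re)
      (Set.Icc 1 2) :=
    Complex.continuous_re.continuousOn.comp (t := Set.univ)
      (continuousOn_LFunctionResidueClassAux (1 : ZMod 1))
      (fun _ _ ↦ trivial) |>.comp Complex.continuous_ofReal.continuousOn fun x hx ↦ by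
        simpa only [Set.mem_ofPred_eq, Complex.ofReal_re] using hx.1
  obtain ⟨C, hC⟩ := isCompact_Icc.exists_bound_of_continuousOn hc
  have hC0 : 0 ≤ C := (norm_nonneg _).trans (hC 1 ⟨le_rfl, by norm_num⟩)
  refine ⟨C + 1, fun s h1 h2 => ?_⟩
  rw [H h1, add_div]
  refine add_le_add_left ((le_abs_self _).trans ((hC s ⟨h1.le, h2⟩).trans ?_)) _
  rw [le_div_iff₀ (by linarith)]
  nlinarith

open ArithmeticFunction.vonMangoldt in
lemma exists_tsum_log_prime_le :
    ∃ C : ℝ, 0 ≤ C ∧ ∀ s : ℝ, 1 < s → s ≤ 2 →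
      (Summable fun p : Nat.Primes => Real.log p * (p : ℝ) ^ (-s)) ∧
      ∑' p : Nat.Primes, Real.log p * (p : ℝ) ^ (-s) ≤ C / (s - 1) := by
  obtain ⟨C, hC⟩ := exists_tsum_residueClass_le
  have hn : ∀ (s : ℝ) (n : ℕ), 0 ≤ residueClass (1 : ZMod 1) n / (n : ℝ) ^ s := fun s n =>
    div_nonneg (residueClass_nonneg _ n) (by positivity)
  refine ⟨C, ?_, fun s h1 h2 => ?_⟩
  · have := (tsum_nonneg (hn 2)).trans (hC 2 (by norm_num) le_rfl)
    norm_num at this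
    exact this
  · have hs : Summable fun n => residueClass (1 : ZMod 1) n / (n : ℝ) ^ s :=
      LSeries.summable_real_of_abscissaOfAbsConv_lt <|
        (abscissaOfAbsConv_residueClass_le_one (1 : ZMod 1)).trans_lt <| mod_cast h1
    have e : ∀ p : Nat.Primes, Real.log p * (p : ℝ) ^ (-s) =
        residueClass (1 : ZMod 1) p / ((p : ℕ) : ℝ) ^ s := by
      intro p
      have : residueClass (1 : ZMod 1) p = Real.log p := by
        have hm : (p : ℕ) ∈ {n : ℕ | (n : ZMod 1) = 1} := Subsingleton.elim _ _
        rw [residueClass, Set.indicator_of_mem hm, ArithmeticFunction.vonMangoldt_apply_prime p.2]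
      rw [this, Real.rpow_neg (by positivity), div_eq_mul_inv]
    simp only [e]
    refine ⟨hs.comp_injective Subtype.val_injective, le_trans ?_ (hC s h1 h2)⟩
    exact hs.tsum_subtype_le (fun n => residueClass (1 : ZMod 1) n / (n : ℝ) ^ s)
      {p : ℕ | p.Prime} (hn s)

/-- The primes `p ≤ N` with `p ≡ 1` modulo `q`. -/
def primesOne (q N : ℕ) : Finset ℕ :=
  (Finset.Icc 1 N).filter fun p => p.Prime ∧ (p : ZMod q) = 1

lemma mem_primesOne {q N p : ℕ} : p ∈ primesOne q N ↔ p ≤ N ∧ p.Prime ∧ (p : ZMod q) = 1 := by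
  simp only [primesOne, Finset.mem_filter, Finset.mem_Icc]
  exact ⟨fun h => ⟨h.1.2, h.2⟩, fun h => ⟨⟨h.2.1.pos, h.1⟩, h.2⟩⟩

/-- The sum of reciprocals of the primes `p ≤ N` with `p ≡ 1` modulo `q`. -/
def recipSum (q N : ℕ) : ℝ := ∑ p ∈ primesOne q N, (1 / p : ℝ)

lemma recipSum_nonneg (q N : ℕ) : 0 ≤ recipSum q N := Finset.sum_nonneg fun _ _ => by positivity

lemma hasSum_recipSum (q N : ℕ) :
    HasSum (fun p : Nat.Primes => if (p : ℕ) ≤ N ∧ ((p : ℕ) : ZMod q) = 1 then (1 / p : ℝ) else 0)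
      (recipSum q N) := by
  have h : HasSum (fun n : ℕ => if n ∈ primesOne q N then (1 / n : ℝ) else 0) (recipSum q N) := by
    have := hasSum_sum_of_ne_finset_zero (s := primesOne q N)
      (f := fun n : ℕ => if n ∈ primesOne q N then (1 / n : ℝ) else 0) (fun n hn => if_neg hn)
      (L := SummationFilter.unconditional ℕ)
    convert! this using 1
    exact Finset.sum_congr rfl fun p hp => (if_pos hp).symm
  have h2 := (hasSum_subtype_iff_of_support_subset (s := {p : ℕ | p.Prime}) (by
    intro n hn
    by_contra hc
    exact hn (if_neg fun hm => hc (mem_primesOne.1 hm).2.1))).2 h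
  have e : ∀ p : Nat.Primes, (if (p : ℕ) ≤ N ∧ ((p : ℕ) : ZMod q) = 1 then (1 / p : ℝ) else 0) =
      if (p : ℕ) ∈ primesOne q N then (1 / p : ℝ) else 0 := fun p =>
    if_congr (by rw [mem_primesOne]; exact ⟨fun h => ⟨h.1, p.2, h.2⟩, fun h => ⟨h.1, h.2.2⟩⟩)
      rfl rfl
  simp only [e]
  exact h2

lemma one_lt_log_natCast {N : ℕ} (hN : 3 ≤ N) : 1 < Real.log N := by
  rw [Real.lt_log_iff_exp_lt (by positivity)]
  have : (3 : ℝ) ≤ N := by exact_mod_cast hN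
  linarith [Real.exp_one_lt_d9]

/-- Passing from the Dirichlet series of primes to the truncated sum of reciprocals. -/
lemma exists_abs_recipSum_sub_primeSeries_le :
    ∃ C : ℝ, ∀ q N : ℕ, 3 ≤ N →
      |recipSum q N - primeSeries q (1 + 1 / Real.log N)| ≤ C := by
  obtain ⟨C, hC0, hC⟩ := exists_tsum_log_prime_le
  refine ⟨Real.exp 1 * C, fun q N hN => ?_⟩
  have hlog := one_lt_log_natCast hN
  set δ := 1 / Real.log N with hδ
  have hδ0 : 0 < δ := by positivity
  have hδ1 : δ ≤ 1 := by rw [hδ, div_le_one (by linarith)]; exact hlog.le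
  obtain ⟨hs, hle⟩ := hC (1 + δ) (by linarith) (by linarith)
  have hsum := (hasSum_recipSum q N).sub (summable_primeSeries q (s := 1 + δ) (by linarith)).hasSum
  have hle2 : Real.exp 1 * δ * ∑' p : Nat.Primes, Real.log p * (p : ℝ) ^ (-(1 + δ)) ≤
      Real.exp 1 * C := by
    rw [mul_assoc]
    refine mul_le_mul_of_nonneg_left ?_ (Real.exp_pos 1).le
    rw [add_sub_cancel_left, le_div_iff₀ hδ0] at hle
    linarith
  refine le_trans ?_ hle2
  rw [primeSeries, ← hsum.tsum_eq, ← Real.norm_eq_abs]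
  refine tsum_of_norm_bounded (hs.hasSum.mul_left _) fun p => ?_
  have hp1 : (1 : ℝ) ≤ ((p : ℕ) : ℝ) := by exact_mod_cast p.2.one_le
  have hp0 : (0 : ℝ) < ((p : ℕ) : ℝ) := by linarith
  have hlp : 0 ≤ Real.log ((p : ℕ) : ℝ) := Real.log_nonneg hp1
  have hps : 0 < ((p : ℕ) : ℝ) ^ (-(1 + δ)) := by positivity
  have hR : 0 ≤ Real.exp 1 * δ * (Real.log ((p : ℕ) : ℝ) * ((p : ℕ) : ℝ) ^ (-(1 + δ))) := by
    positivity
  by_cases hq : ((p : ℕ) : ZMod q) = 1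
  · by_cases hN' : (p : ℕ) ≤ N
    · rw [if_pos ⟨hN', hq⟩, if_pos hq, Real.norm_eq_abs]
      set x := δ * Real.log ((p : ℕ) : ℝ) with hx
      have hx0 : 0 ≤ x := by positivity
      have hx1 : x ≤ 1 := by
        rw [hx, hδ, one_div, inv_mul_le_iff₀ (by linarith), mul_one]
        exact Real.log_le_log hp0 (by exact_mod_cast hN')
      have e : (1 / ((p : ℕ) : ℝ)) = ((p : ℕ) : ℝ) ^ (-(1 + δ)) * Real.exp x := by
        rw [hx, mul_comm δ, ← Real.rpow_def_of_pos hp0, ← Real.rpow_add hp0, one_div,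
          ← Real.rpow_neg_one]
        congr 1; ring
      have h1 : 1 ≤ Real.exp x := Real.one_le_exp hx0
      have h2 : Real.exp x - 1 ≤ x * Real.exp x := by
        have := Real.add_one_le_exp (-x)
        have h3 : Real.exp x * Real.exp (-x) = 1 := by rw [← Real.exp_add]; simp
        nlinarith [Real.exp_pos x]
      have h4 : Real.exp x ≤ Real.exp 1 := Real.exp_le_exp.2 hx1
      have h5 : Real.exp x - 1 ≤ x * Real.exp 1 := h2.trans (mul_le_mul_of_nonneg_left h4 hx0)
      rw [e, abs_of_nonneg (by nlinarith)]
      calc _ = ((p : ℕ) : ℝ) ^ (-(1 + δ)) * (Real.exp x - 1) := by ring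
        _ ≤ ((p : ℕ) : ℝ) ^ (-(1 + δ)) * (x * Real.exp 1) := mul_le_mul_of_nonneg_left h5 hps.le
        _ = _ := by rw [hx]; ring
    · rw [if_neg (fun h => hN' h.1), if_pos hq, zero_sub, norm_neg, Real.norm_of_nonneg hps.le]
      have h1 : 1 ≤ δ * Real.log ((p : ℕ) : ℝ) := by
        rw [hδ, one_div, le_inv_mul_iff₀ (by linarith), mul_one]
        exact Real.log_le_log (by positivity) (by exact_mod_cast (not_le.1 hN').le)
      have h2 : 1 ≤ Real.exp 1 := Real.one_le_exp zero_le_one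
      have h3 : 1 ≤ Real.exp 1 * (δ * Real.log ((p : ℕ) : ℝ)) := by nlinarith
      calc _ ≤ Real.exp 1 * (δ * Real.log ((p : ℕ) : ℝ)) * ((p : ℕ) : ℝ) ^ (-(1 + δ)) :=
            le_mul_of_one_le_left hps.le h3
        _ = _ := by ring
  · rw [if_neg (fun h => hq h.2), if_neg hq, sub_zero, norm_zero]
    exact hR

/-- Mertens' theorem in arithmetic progressions. -/
lemma exists_abs_recipSum_sub_le (q : ℕ) (hq : 0 < q) :
    ∃ C : ℝ, ∀ N : ℕ, 3 ≤ N → |recipSum q N - LL N / q.totient| ≤ C := by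
  have : NeZero q := ⟨hq.ne'⟩
  obtain ⟨C1, h1⟩ := exists_abs_recipSum_sub_primeSeries_le
  obtain ⟨C2, h2⟩ := exists_abs_primeSeries_sub_le q
  refine ⟨C1 + C2, fun N hN => ?_⟩
  have hl := one_lt_log_natCast hN
  have h3 := h2 (1 + 1 / Real.log N) (by simp; linarith) (by
    have : 1 / Real.log N ≤ 1 := by rw [div_le_one (by linarith)]; exact hl.le
    linarith)
  rw [add_sub_cancel_left, one_div_one_div] at h3
  exact (abs_sub_le _ _ _).trans (add_le_add (h1 q N hN) h3)

/-- An upper bound for sums over primes in progressions, uniform in the modulus. -/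
lemma exists_recipSum_le :
    ∃ C : ℝ, ∀ q N : ℕ, 2 ≤ q → 3 ≤ N →
      recipSum q N ≤ LL N / q.totient + Real.log (2 + Real.log q) + C := by
  obtain ⟨C1, h1⟩ := exists_abs_recipSum_sub_primeSeries_le
  obtain ⟨C2, h2⟩ := exists_primeSeries_le
  refine ⟨C1 + C2, fun q N hq hN => ?_⟩
  have hl := one_lt_log_natCast hN
  have h3 := h2 q hq (1 + 1 / Real.log N) (by simp; linarith) (by
    have : 1 / Real.log N ≤ 1 := by rw [div_le_one (by linarith)]; exact hl.le
    linarith)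
  rw [add_sub_cancel_left, one_div_one_div] at h3
  have := (abs_le.1 (h1 q N hN)).2
  rw [LL]
  linarith

/-- The average of `f` over `{1, …, n}`. -/
def av (n : ℕ) (f : ℕ → ℝ) : ℝ := (∑ m ∈ Finset.Icc 1 n, f m) / n

/-- The indicator of `p ∣ m`. -/
def dvdInd (p m : ℕ) : ℝ := if p ∣ m then 1 else 0

/-- The additive function `m ↦ ∑_{p ∈ P, p ∣ m} h p`. -/
def addFun (P : Finset ℕ) (h : ℕ → ℝ) (m : ℕ) : ℝ := ∑ p ∈ P, h p * dvdInd p m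

section av
variable {n : ℕ} {f g : ℕ → ℝ}

lemma av_mono (h : ∀ m, 1 ≤ m → m ≤ n → f m ≤ g m) : av n f ≤ av n g := by
  unfold av
  gcongr with m hm
  exact h m (Finset.mem_Icc.1 hm).1 (Finset.mem_Icc.1 hm).2

lemma av_congr (h : ∀ m, 1 ≤ m → m ≤ n → f m = g m) : av n f = av n g :=
  le_antisymm (av_mono fun m h1 h2 => (h m h1 h2).le) (av_mono fun m h1 h2 => (h m h1 h2).ge)

lemma av_add : av n (fun m => f m + g m) = av n f + av n g := by
  simp only [av, Finset.sum_add_distrib, add_div]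

lemma av_sub : av n (fun m => f m - g m) = av n f - av n g := by
  simp only [av, Finset.sum_sub_distrib, sub_div]

lemma av_const_mul (c : ℝ) : av n (fun m => c * f m) = c * av n f := by
  simp only [av, ← Finset.mul_sum, mul_div_assoc]

lemma av_sum {ι : Type*} (s : Finset ι) (F : ι → ℕ → ℝ) :
    av n (fun m => ∑ i ∈ s, F i m) = ∑ i ∈ s, av n (F i) := by
  simp only [av, ← Finset.sum_div]
  rw [Finset.sum_comm]

lemma av_const (hn : 1 ≤ n) (c : ℝ) : av n (fun _ => c) = c := by
  have : (n : ℝ) ≠ 0 := by positivity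
  simp [av]; field_simp

lemma av_nonneg (h : ∀ m, 0 ≤ f m) : 0 ≤ av n f :=
  div_nonneg (Finset.sum_nonneg fun m _ => h m) (Nat.cast_nonneg n)

lemma abs_av_sub_le : |av n f - av n g| ≤ av n (fun m => |f m - g m|) := by
  rw [← av_sub, av, av, abs_div, Nat.abs_cast]
  gcongr
  exact Finset.abs_sum_le_sum_abs _ _

end av

lemma sum_dvd {R : Type*} [CommSemiring R] (n d : ℕ) :
    ∑ m ∈ Finset.Icc 1 n, (if d ∣ m then (1 : R) else 0) = ((n / d : ℕ) : R) := by
  rw [Finset.sum_boole, ← Nat.Ioc_filter_dvd_card_eq_div]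
  rfl

lemma av_dvdInd (n d : ℕ) : av n (dvdInd d) = ((n / d : ℕ) : ℝ) / n := by
  rw [av, ← sum_dvd]; rfl

lemma div_div_le (n d : ℕ) (hn : 1 ≤ n) : ((n / d : ℕ) : ℝ) / n ≤ 1 / d := by
  have h0 : (0 : ℝ) < n := by positivity
  rw [div_le_iff₀ h0, one_div, inv_mul_eq_div]
  exact Nat.cast_div_le

lemma le_div_div (n d : ℕ) (hn : 1 ≤ n) (hd : 1 ≤ d) :
    1 / (d : ℝ) - 1 / n ≤ ((n / d : ℕ) : ℝ) / n := by
  have h0 : (0 : ℝ) < n := by positivity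
  have h1 : (0 : ℝ) < d := by positivity
  rw [le_div_iff₀ h0, sub_mul, one_div_mul_cancel h0.ne', one_div, inv_mul_eq_div]
  linarith [Nat.sub_one_lt_floor ((n : ℝ) / d), Nat.floor_div_eq_div (K := ℝ) n d ▸ Nat.lt_floor_add_one ((n : ℝ) / d)]

lemma av_dvdInd_le {n d : ℕ} (hn : 1 ≤ n) : av n (dvdInd d) ≤ 1 / d := by
  rw [av_dvdInd]; exact div_div_le n d hn

lemma le_av_dvdInd {n d : ℕ} (hn : 1 ≤ n) (hd : 1 ≤ d) : 1 / (d : ℝ) - 1 / n ≤ av n (dvdInd d) := by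
  rw [av_dvdInd]; exact le_div_div n d hn hd

lemma dvdInd_mul_self (p m : ℕ) : dvdInd p m * dvdInd p m = dvdInd p m := by
  unfold dvdInd; split_ifs <;> simp

lemma dvdInd_mul {p q : ℕ} (hp : p.Prime) (hq : q.Prime) (h : p ≠ q) (m : ℕ) :
    dvdInd p m * dvdInd q m = dvdInd (p * q) m := by
  have : p * q ∣ m ↔ p ∣ m ∧ q ∣ m :=
    ⟨fun h => ⟨dvd_of_mul_right_dvd h, dvd_of_mul_left_dvd h⟩,
      fun h' => ((Nat.coprime_primes hp hq).2 h).mul_dvd_of_dvd_of_dvd h'.1 h'.2⟩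
  unfold dvdInd
  split_ifs <;> simp_all

lemma av_addFun (n : ℕ) (P : Finset ℕ) (h : ℕ → ℝ) :
    av n (addFun P h) = ∑ p ∈ P, h p * av n (dvdInd p) := by
  have : addFun P h = fun m => ∑ p ∈ P, h p * dvdInd p m := rfl
  rw [this, av_sum]
  simp only [av_const_mul]

lemma abs_av_addFun_sub_le {n : ℕ} (hn : 1 ≤ n) {P : Finset ℕ} (hP : ∀ p ∈ P, p.Prime)
    {h : ℕ → ℝ} (hh : ∀ p, |h p| ≤ 1) :
    |av n (addFun P h) - ∑ p ∈ P, h p / p| ≤ P.card / n := by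
  rw [av_addFun, ← Finset.sum_sub_distrib]
  refine (Finset.abs_sum_le_sum_abs _ _).trans ?_
  rw [div_eq_mul_one_div, ← nsmul_eq_mul]
  refine Finset.sum_le_card_nsmul _ _ _ fun p hp => ?_
  have h1 := av_dvdInd_le (n := n) (d := p) hn
  have h2 := le_av_dvdInd (n := n) hn (hP p hp).one_le
  rw [div_eq_mul_one_div (h p), ← mul_sub, abs_mul]
  have h3 : |av n (dvdInd p) - 1 / p| ≤ 1 / n := by
    have : (0 : ℝ) ≤ 1 / n := by positivity
    rw [abs_le]; constructor <;> linarith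
  calc |h p| * |av n (dvdInd p) - 1 / p| ≤ 1 * (1 / n) := by
        gcongr
        exact hh p
    _ = 1 / n := one_mul _

/-- A truncated Turán–Kubilius inequality. -/
lemma av_sq_addFun_sub_le {n : ℕ} (hn : 1 ≤ n) {P : Finset ℕ} (hP : ∀ p ∈ P, p.Prime)
    {h : ℕ → ℝ} (hh : ∀ p, |h p| ≤ 1) (hc : P.card ^ 2 ≤ n) :
    av n (fun m => (addFun P h m - ∑ p ∈ P, h p / p) ^ 2) ≤ ∑ p ∈ P, (1 / p : ℝ) + 3 := by
  set M := ∑ p ∈ P, h p / p with hM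
  have hn0 : (0 : ℝ) < n := by positivity
  have hc' : (P.card : ℝ) ^ 2 / n ≤ 1 := by
    rw [div_le_one hn0]; exact_mod_cast hc
  have hMc : |M| ≤ P.card := by
    rw [hM]
    refine (Finset.abs_sum_le_sum_abs _ _).trans ?_
    have : ∀ p ∈ P, |h p / p| ≤ (1 : ℝ) := fun p hp => by
      rw [abs_div, Nat.abs_cast]
      have : (1 : ℝ) ≤ p := by exact_mod_cast (hP p hp).one_le
      exact div_le_one_of_le₀ ((hh p).trans this) (by positivity)
    simpa using Finset.sum_le_card_nsmul _ _ _ this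
  have h1 := abs_av_addFun_sub_le hn hP hh
  rw [← hM] at h1
  have h2 : av n (fun m => addFun P h m ^ 2) ≤ M ^ 2 + P.card ^ 2 / n + ∑ p ∈ P, (1 / p : ℝ) := by
    have e1 : (fun m => addFun P h m ^ 2) =
        fun m => ∑ p ∈ P, ∑ q ∈ P, h p * h q * (dvdInd p m * dvdInd q m) := by
      funext m
      rw [sq, addFun, Finset.sum_mul_sum]
      exact Finset.sum_congr rfl fun p _ => Finset.sum_congr rfl fun q _ => by ring
    have e2 : M ^ 2 + P.card ^ 2 / n + ∑ p ∈ P, (1 / p : ℝ) =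
        ∑ p ∈ P, ∑ q ∈ P, (h p / p * (h q / q) + 1 / n + if p = q then (1 / p : ℝ) else 0) := by
      simp only [Finset.sum_add_distrib, ← Finset.sum_mul_sum, ← hM]
      have : ∑ p ∈ P, ∑ q ∈ P, (if p = q then (1 / p : ℝ) else 0) = ∑ p ∈ P, (1 / p : ℝ) :=
        Finset.sum_congr rfl fun p hp => by simp [hp]
      rw [this]
      simp only [Finset.sum_const, nsmul_eq_mul]
      ring
    rw [e1, e2, av_sum]
    refine Finset.sum_le_sum fun p hp => ?_
    rw [av_sum]
    refine Finset.sum_le_sum fun q hq => ?_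
    rw [av_const_mul]
    by_cases hpq : p = q
    · subst hpq
      simp only [dvdInd_mul_self, if_true]
      have a1 := av_dvdInd_le (n := n) (d := p) hn
      have a2 : h p * h p ≤ 1 := by
        have := hh p
        rw [abs_le] at this
        nlinarith
      have a3 : 0 ≤ av n (dvdInd p) := av_nonneg fun m => by unfold dvdInd; split_ifs <;> simp
      have a4 : 0 ≤ h p / p * (h p / p) := mul_self_nonneg _
      have a5 : (0 : ℝ) ≤ 1 / n := by positivity
      nlinarith [mul_le_mul_of_nonneg_right a2 a3]
    · simp only [dvdInd_mul (hP p hp) (hP q hq) hpq, if_neg hpq, add_zero]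
      have b1 := av_dvdInd_le (n := n) (d := p * q) hn
      have b2 := le_av_dvdInd (n := n) (d := p * q) hn
        (Nat.mul_pos (hP p hp).pos (hP q hq).pos)
      have b3 : |av n (dvdInd (p * q)) - 1 / (p * q : ℕ)| ≤ 1 / n := by
        have : (0 : ℝ) ≤ 1 / n := by positivity
        rw [abs_le]; constructor <;> linarith
      have b4 : |h p * h q * (av n (dvdInd (p * q)) - 1 / (p * q : ℕ))| ≤ 1 / n := by
        rw [abs_mul, abs_mul]
        calc |h p| * |h q| * |av n (dvdInd (p * q)) - 1 / (p * q : ℕ)| ≤ 1 * 1 * (1 / n) := by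
              gcongr
              exacts [hh p, hh q]
          _ = 1 / n := by ring
      have b5 : h p * h q * (1 / (p * q : ℕ)) = h p / p * (h q / q) := by
        push_cast; field_simp
      have := (abs_le.1 b4).2
      rw [mul_sub, b5] at this
      linarith
  have h3 : av n (fun m => (addFun P h m - M) ^ 2) =
      av n (fun m => addFun P h m ^ 2) - 2 * M * av n (addFun P h) + M ^ 2 := by
    rw [← av_const_mul, ← av_sub]
    conv_rhs => rw [← av_const hn (M ^ 2)]
    rw [← av_add]
    exact av_congr fun m _ _ => by ring
  have h4 : |M * (av n (addFun P h) - M)| ≤ 1 := by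
    rw [abs_mul]
    calc |M| * |av n (addFun P h) - M| ≤ P.card * (P.card / n) := by gcongr
      _ = P.card ^ 2 / n := by ring
      _ ≤ 1 := hc'
  rw [h3]
  nlinarith [(abs_le.1 h4).1]

lemma av_neg_part_le {n : ℕ} {f : ℕ → ℝ} {M V : ℝ} (hM : 0 < M)
    (hV : av n (fun m => (f m - M) ^ 2) ≤ V) : av n (fun m => max (-f m) 0) ≤ V / M := by
  have h1 : av n (fun m => max (-f m) 0) ≤ av n (fun m => M⁻¹ * (f m - M) ^ 2) := by
    refine av_mono fun m _ _ => ?_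
    rw [inv_mul_eq_div, le_div_iff₀ hM]
    rcases le_total (-f m) 0 with h | h
    · rw [max_eq_right h]; nlinarith [sq_nonneg (f m - M)]
    · rw [max_eq_left h]; nlinarith [sq_nonneg (f m), sq_nonneg M]
  rw [av_const_mul] at h1
  rw [div_eq_inv_mul]
  exact h1.trans (by gcongr)

lemma sum_prod_one_add {R : Type*} [CommRing R] (n : ℕ) {P : Finset ℕ} (hP : ∀ p ∈ P, p.Prime)
    (g : ℕ → R) :
    ∑ m ∈ Finset.Icc 1 n, ∏ p ∈ P, (1 + if p ∣ m then g p else 0) =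
      ∑ A ∈ P.powerset, (∏ p ∈ A, g p) * ((n / ∏ p ∈ A, p : ℕ) : R) := by
  simp only [Finset.prod_one_add]
  rw [Finset.sum_comm]
  refine Finset.sum_congr rfl fun A hA => ?_
  have hA' : ∀ p ∈ A, p.Prime := fun p hp => hP p (Finset.mem_powerset.1 hA hp)
  rw [← sum_dvd, Finset.mul_sum]
  refine Finset.sum_congr rfl fun m _ => ?_
  have : (∏ p ∈ A, p) ∣ m ↔ ∀ p ∈ A, p ∣ m :=
    ⟨fun h p hp => (Finset.dvd_prod_of_mem _ hp).trans h,
      fun h => Finset.prod_primes_dvd m (fun p hp => (hA' p hp).prime) h⟩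
  split_ifs with hd
  · rw [mul_one]
    exact Finset.prod_congr rfl fun p hp => if_pos (this.1 hd p hp)
  · rw [mul_zero]
    obtain ⟨p, hp, hpm⟩ : ∃ p ∈ A, ¬ p ∣ m := by simpa [this] using hd
    exact Finset.prod_eq_zero hp (if_neg hpm)

lemma prod_one_add_div_le (P : Finset ℕ) {g : ℝ} (hg : 0 ≤ g) :
    ∏ p ∈ P, (1 + g / p) ≤ Real.exp (g * ∑ p ∈ P, (1 / p : ℝ)) := by
  rw [Finset.mul_sum, Real.exp_sum]
  refine Finset.prod_le_prod (fun p _ => by positivity) fun p _ => ?_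
  rw [mul_one_div, add_comm]
  exact Real.add_one_le_exp _

lemma av_prod_one_add_le {n : ℕ} (hn : 1 ≤ n) {P : Finset ℕ} (hP : ∀ p ∈ P, p.Prime) {g : ℝ}
    (hg : 0 ≤ g) :
    av n (fun m => ∏ p ∈ P, (1 + if p ∣ m then g else 0)) ≤
      Real.exp (g * ∑ p ∈ P, (1 / p : ℝ)) := by
  refine le_trans ?_ (prod_one_add_div_le P hg)
  rw [av, sum_prod_one_add n hP, Finset.prod_one_add, Finset.sum_div]
  refine Finset.sum_le_sum fun A _ => ?_
  rw [mul_div_assoc, Finset.prod_div_distrib, div_eq_mul_one_div (∏ p ∈ A, g)]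
  have := div_div_le n (∏ p ∈ A, p) hn
  push_cast at this
  gcongr

lemma norm_avg_prod_sub_le {n y k : ℕ} (hn : 1 ≤ n) (hy : 1 ≤ y) {P : Finset ℕ}
    (hP : ∀ p ∈ P, p.Prime) (hPy : ∀ p ∈ P, p ≤ y) {g : ℕ → ℂ} {r : ℝ} (hr : 0 ≤ r)
    (hg : ∀ p, ‖g p‖ ≤ r) :
    ‖(∑ m ∈ Finset.Icc 1 n, ∏ p ∈ P, (1 + if p ∣ m then g p else 0)) / n -
        ∏ p ∈ P, (1 + g p / p)‖ ≤
      ((y : ℝ) ^ k / n + Real.exp (-k)) *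
        Real.exp (Real.exp 1 * r * ∑ p ∈ P, (1 / p : ℝ)) := by
  set c : ℝ := (y : ℝ) ^ k / n + Real.exp (-k) with hc
  have hc0 : 0 ≤ c := by positivity
  have hn0 : (0 : ℝ) < n := by positivity
  refine le_trans ?_ (mul_le_mul_of_nonneg_left
    (prod_one_add_div_le P (g := Real.exp 1 * r) (by positivity)) hc0)
  rw [sum_prod_one_add n hP, Finset.prod_one_add, Finset.prod_one_add, Finset.sum_div,
    ← Finset.sum_sub_distrib, Finset.mul_sum]
  refine (norm_sum_le _ _).trans (Finset.sum_le_sum fun A hA => ?_)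
  have hAP := Finset.mem_powerset.1 hA
  set D : ℕ := ∏ p ∈ A, p with hD
  have hD1 : 1 ≤ D := Finset.prod_pos fun p hp => (hP p (hAP hp)).pos
  have hD0 : (0 : ℝ) < D := by exact_mod_cast hD1
  have e1 : (∏ p ∈ A, g p) * ((n / D : ℕ) : ℂ) / n - ∏ p ∈ A, g p / p =
      (∏ p ∈ A, g p) * (((((n / D : ℕ) : ℝ) / n - 1 / D : ℝ)) : ℂ) := by
    rw [Finset.prod_div_distrib, hD]
    push_cast
    ring
  have e2 : |((n / D : ℕ) : ℝ) / n - 1 / D| ≤ c * Real.exp 1 ^ A.card / D := by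
    have a1 := div_div_le n D hn
    have a2 := le_div_div n D hn hD1
    have a3 : (0 : ℝ) ≤ ((n / D : ℕ) : ℝ) / n := by positivity
    rw [abs_sub_comm, abs_of_nonneg (by linarith)]
    rcases le_or_gt A.card k with hk | hk
    · have hDy : (D : ℝ) ≤ (y : ℝ) ^ k := by
        have : D ≤ y ^ A.card := by
          rw [hD]
          exact Finset.prod_le_pow_card _ _ _ fun p hp => hPy p (hAP hp)
        exact_mod_cast this.trans (Nat.pow_le_pow_right hy hk)
      calc 1 / (D : ℝ) - ((n / D : ℕ) : ℝ) / n ≤ 1 / n := by linarith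
        _ = D / n * 1 / D := by field_simp
        _ ≤ c * Real.exp 1 ^ A.card / D := by
            gcongr
            · rw [hc]
              have : (D : ℝ) / n ≤ (y : ℝ) ^ k / n := by gcongr
              linarith [Real.exp_pos (-k)]
            · exact one_le_pow₀ (by linarith [Real.add_one_le_exp (1 : ℝ)])
    · calc 1 / (D : ℝ) - ((n / D : ℕ) : ℝ) / n ≤ 1 / D := by linarith
        _ ≤ c * Real.exp 1 ^ A.card / D := by
            gcongr
            have b1 : Real.exp (-k) * Real.exp 1 ^ A.card = Real.exp (A.card - k) := by
              rw [← Real.exp_nat_mul, ← Real.exp_add]; ring_nf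
            have b2 : 1 ≤ Real.exp ((A.card : ℝ) - k) :=
              Real.one_le_exp (sub_nonneg.2 (by exact_mod_cast hk.le))
            rw [← b1] at b2
            refine b2.trans ?_
            gcongr
            rw [hc]
            have : 0 ≤ (y : ℝ) ^ k / n := by positivity
            linarith
  have e3 : ‖∏ p ∈ A, g p‖ ≤ r ^ A.card := by
    rw [norm_prod]
    exact (Finset.prod_le_prod (fun _ _ => norm_nonneg _) fun p _ => hg p).trans_eq
      (Finset.prod_const r)
  rw [e1, norm_mul, Complex.norm_real, Real.norm_eq_abs, Finset.prod_div_distrib]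
  calc _ ≤ r ^ A.card * (c * Real.exp 1 ^ A.card / D) := by gcongr
    _ = _ := by
      rw [Finset.prod_const, hD]
      push_cast
      ring

end InvFactor

namespace InvFactor
open Asymptotics Topology

/-- The truncation level `exp (log n / log log n)` for prime divisors. -/
def yTr (n : ℕ) : ℕ := ⌊Real.exp (Real.log n / LL n)⌋₊

/-- The scale `√(log log n)`. -/
def sqLL (n : ℕ) : ℝ := Real.sqrt (LL n)

lemma tendsto_log_natCast : Tendsto (fun n : ℕ => Real.log n) atTop atTop :=
  Real.tendsto_log_atTop.comp tendsto_natCast_atTop_atTop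

lemma tendsto_LL : Tendsto LL atTop atTop := Real.tendsto_log_atTop.comp tendsto_log_natCast

lemma tendsto_sqLL : Tendsto sqLL atTop atTop := Real.tendsto_sqrt_atTop.comp tendsto_LL

lemma isLittleO_const_sqLL (c : ℝ) : (fun _ : ℕ => c) =o[atTop] sqLL :=
  isLittleO_const_left.2 (Or.inr (tendsto_norm_atTop_atTop.comp tendsto_sqLL))

lemma isLittleO_log_LL : (fun n => Real.log (LL n)) =o[atTop] sqLL := by
  have := (isLittleO_log_rpow_atTop (r := 1 / 2) (by norm_num)).comp_tendsto tendsto_LL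
  refine this.congr (fun _ => rfl) fun n => ?_
  simp only [Function.comp, sqLL, Real.sqrt_eq_rpow]

lemma isLittleO_of_le {f g : ℕ → ℝ} (hg : g =o[atTop] sqLL) (h : ∀ᶠ n in atTop, |f n| ≤ g n) :
    f =o[atTop] sqLL := by
  refine IsBigO.trans_isLittleO (IsBigO.of_bound 1 ?_) hg
  filter_upwards [h] with n hn
  rw [one_mul]
  exact hn.trans (le_abs_self _)

lemma tendsto_log_div_LL : Tendsto (fun n : ℕ => Real.log n / LL n) atTop atTop := by
  have h1 : Tendsto (fun x : ℝ => x / Real.log x) atTop atTop := by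
    have := Real.isLittleO_log_id_atTop.tendsto_div_nhds_zero
    have h2 : Tendsto (fun x : ℝ => Real.log x / x) atTop (𝓝[>] 0) := by
      refine tendsto_nhdsWithin_iff.2 ⟨this, ?_⟩
      filter_upwards [eventually_gt_atTop 1] with x hx
      exact div_pos (Real.log_pos hx) (by linarith)
    refine h2.inv_tendsto_nhdsGT_zero.congr fun x => ?_
    simp
  exact h1.comp tendsto_log_natCast

lemma tendsto_yTr : Tendsto yTr atTop atTop :=
  tendsto_nat_floor_atTop.comp (Real.tendsto_exp_atTop.comp tendsto_log_div_LL)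

lemma yTr_le_exp (n : ℕ) : (yTr n : ℝ) ≤ Real.exp (Real.log n / LL n) :=
  Nat.floor_le (Real.exp_pos _).le

lemma eventually_yTr_sq_le : ∀ᶠ n in atTop, yTr n ^ 2 ≤ n := by
  filter_upwards [tendsto_LL.eventually_ge_atTop 2, eventually_ge_atTop 1] with n h1 h2
  have h3 : (0 : ℝ) < n := by positivity
  have h4 : 0 ≤ Real.log n := Real.log_natCast_nonneg n
  have : (yTr n : ℝ) ^ 2 ≤ n := by
    calc (yTr n : ℝ) ^ 2 ≤ Real.exp (Real.log n / LL n) ^ 2 := by gcongr; exact yTr_le_exp n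
      _ = Real.exp (2 * (Real.log n / LL n)) := by rw [← Real.exp_nat_mul]; norm_num
      _ ≤ Real.exp (Real.log n) := by
          rw [Real.exp_le_exp, mul_div_assoc', div_le_iff₀ (by linarith)]
          nlinarith
      _ = n := Real.exp_log h3
  exact_mod_cast this

lemma eventually_yTr_pow_le :
    ∀ᶠ n : ℕ in atTop, (yTr n : ℝ) ^ ⌊LL n / 2⌋₊ / n ≤ Real.exp (-(Real.log n / 2)) := by
  filter_upwards [tendsto_LL.eventually_ge_atTop 2, eventually_ge_atTop 1] with n h1 h2
  have h3 : (0 : ℝ) < n := by positivity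
  have h4 : 0 ≤ Real.log n := Real.log_natCast_nonneg n
  have h5 : (⌊LL n / 2⌋₊ : ℝ) ≤ LL n / 2 := Nat.floor_le (by linarith)
  rw [div_le_iff₀ h3]
  calc (yTr n : ℝ) ^ ⌊LL n / 2⌋₊ ≤ Real.exp (Real.log n / LL n) ^ ⌊LL n / 2⌋₊ := by
        gcongr; exact yTr_le_exp n
    _ = Real.exp (⌊LL n / 2⌋₊ * (Real.log n / LL n)) := by rw [← Real.exp_nat_mul]
    _ ≤ Real.exp (LL n / 2 * (Real.log n / LL n)) := by
        rw [Real.exp_le_exp]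
        have : 0 ≤ Real.log n / LL n := div_nonneg h4 (by linarith)
        gcongr
    _ = Real.exp (-(Real.log n / 2) + Real.log n) := by
        congr 1
        have : LL n ≠ 0 := by linarith
        field_simp
        ring
    _ = Real.exp (-(Real.log n / 2)) * n := by rw [Real.exp_add, Real.exp_log h3]

lemma eventually_LL_yTr :
    ∀ᶠ n in atTop, LL n - Real.log (LL n) - Real.log 2 ≤ LL (yTr n) ∧ LL (yTr n) ≤ LL n := by
  filter_upwards [tendsto_LL.eventually_ge_atTop 2, eventually_yTr_sq_le,
    tendsto_log_div_LL.eventually_ge_atTop 4, tendsto_yTr.eventually_ge_atTop 3,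
    eventually_ge_atTop 3] with n h1 h2 h3 h4 h5
  have h6 := one_lt_log_natCast h5
  have h7 := one_lt_log_natCast h4
  constructor
  · have h8 : Real.log n / LL n / 2 ≤ Real.log (yTr n) := by
      rw [Real.le_log_iff_exp_le (by positivity)]
      have a1 : Real.exp (Real.log n / LL n) < yTr n + 1 := Nat.lt_floor_add_one _
      have a2 : Real.exp (Real.log n / LL n) =
          Real.exp (Real.log n / LL n / 2) * Real.exp (Real.log n / LL n / 2) := by
        rw [← Real.exp_add]; ring_nf
      have a3 := Real.add_one_le_exp (Real.log n / LL n / 2)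
      nlinarith
    have h9 := Real.log_le_log (by positivity) h8
    rw [Real.log_div (by positivity) (by norm_num), Real.log_div (by positivity)
      (by linarith)] at h9
    exact h9
  · have : yTr n ≤ n := (Nat.le_self_pow two_ne_zero _).trans h2
    exact Real.log_le_log (by linarith) (Real.log_le_log (by positivity) (by exact_mod_cast this))

lemma isLittleO_LL_sub : (fun n => LL n - LL (yTr n)) =o[atTop] sqLL := by
  refine isLittleO_of_le (isLittleO_log_LL.add (isLittleO_const_sqLL (Real.log 2))) ?_
  filter_upwards [eventually_LL_yTr] with n hn
  rw [abs_of_nonneg (by linarith)]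
  linarith

lemma sqLL_isLittleO_LL : sqLL =o[atTop] LL := by
  rw [isLittleO_iff]
  intro c hc
  filter_upwards [tendsto_sqLL.eventually_ge_atTop c⁻¹, tendsto_LL.eventually_ge_atTop 0] with n h1 h2
  have h3 : LL n = sqLL n * sqLL n := (Real.mul_self_sqrt h2).symm
  have h4 : 0 ≤ sqLL n := Real.sqrt_nonneg _
  rw [h3, norm_mul, Real.norm_of_nonneg h4]
  have : 1 ≤ c * sqLL n := by
    rw [← mul_inv_cancel₀ hc.ne']; gcongr
  nlinarith

lemma exists_recipSum_yTr (q : ℕ) (hq : 0 < q) :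
    (fun n => recipSum q (yTr n) - LL n / q.totient) =o[atTop] sqLL := by
  obtain ⟨C, hC⟩ := exists_abs_recipSum_sub_le q hq
  have h0 : (0 : ℝ) < q.totient := by exact_mod_cast Nat.totient_pos.2 hq
  refine isLittleO_of_le ((isLittleO_const_sqLL C).add
    (isLittleO_LL_sub.norm_left.const_mul_left (1 / (q.totient : ℝ)))) ?_
  filter_upwards [tendsto_yTr.eventually_ge_atTop 3] with n hn
  have : recipSum q (yTr n) - LL n / q.totient = (recipSum q (yTr n) - LL (yTr n) / q.totient) -
      1 / q.totient * (LL n - LL (yTr n)) := by ring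
  rw [this]
  refine (abs_sub _ _).trans (add_le_add (hC _ hn) ?_)
  rw [abs_mul, abs_of_nonneg (by positivity : (0 : ℝ) ≤ 1 / q.totient), Real.norm_eq_abs]

lemma isLittleO_recipSum (q : ℕ) (hq : 0 < q) :
    (fun n => recipSum q n - LL n / q.totient) =o[atTop] sqLL := by
  obtain ⟨C, hC⟩ := exists_abs_recipSum_sub_le q hq
  refine isLittleO_of_le (isLittleO_const_sqLL C) ?_
  filter_upwards [eventually_ge_atTop 3] with n hn using hC n hn

/-- The indicator of `p ≡ 1 (mod q)`. -/
def ind (q p : ℕ) : ℝ := if (p : ZMod q) = 1 then 1 else 0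

/-- The strongly additive function `m ↦ ∑_{p ∣ m} h p`. -/
def fullAdd (h : ℕ → ℝ) (m : ℕ) : ℝ := ∑ p ∈ m.primeFactors, h p

/-- The number of prime divisors `p ≡ 1 (mod q)` of `m`. -/
def om (q m : ℕ) : ℝ := fullAdd (ind q) m

lemma ind_nonneg (q p : ℕ) : 0 ≤ ind q p := by unfold ind; split_ifs <;> simp
lemma ind_le_one (q p : ℕ) : ind q p ≤ 1 := by unfold ind; split_ifs <;> simp

lemma abs_ind_le_one (q p : ℕ) : |ind q p| ≤ 1 := by
  rw [abs_of_nonneg (ind_nonneg q p)]; exact ind_le_one q p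

lemma dvdInd_nonneg (p m : ℕ) : 0 ≤ dvdInd p m := by unfold dvdInd; split_ifs <;> simp

lemma prime_of_mem_primesOne {q N p : ℕ} (h : p ∈ primesOne q N) : p.Prime := (mem_primesOne.1 h).2.1

lemma mem_primesOne_one {N p : ℕ} : p ∈ primesOne 1 N ↔ p ≤ N ∧ p.Prime := by
  rw [mem_primesOne]
  simp [Subsingleton.elim (p : ZMod 1) 1]

lemma primesOne_subset {M N : ℕ} (h : M ≤ N) : primesOne 1 M ⊆ primesOne 1 N := fun p hp => by
  rw [mem_primesOne_one] at *
  exact ⟨hp.1.trans h, hp.2⟩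

lemma card_primesOne_le (q N : ℕ) : (primesOne q N).card ≤ N := by
  refine (Finset.card_filter_le (Finset.Icc 1 N) _).trans ?_
  simp

lemma fullAdd_eq_addFun (h : ℕ → ℝ) {m n : ℕ} (hm : 1 ≤ m) (hmn : m ≤ n) :
    fullAdd h m = addFun (primesOne 1 n) h m := by
  unfold fullAdd addFun dvdInd
  simp only [mul_ite, mul_one, mul_zero]
  rw [← Finset.sum_filter]
  refine Finset.sum_congr ?_ fun _ _ => rfl
  ext p
  rw [Finset.mem_filter, mem_primesOne_one, Nat.mem_primeFactors]
  exact ⟨fun h => ⟨⟨(Nat.le_of_dvd hm h.2.1).trans hmn, h.1⟩, h.2.1⟩,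
    fun h => ⟨h.1.2, h.2, by omega⟩⟩

lemma primesOne_eq_filter (q N : ℕ) :
    primesOne q N = (primesOne 1 N).filter fun p : ℕ => (p : ZMod q) = 1 := by
  ext p
  rw [Finset.mem_filter, mem_primesOne, mem_primesOne_one]
  tauto

lemma sum_ind_div (q N : ℕ) : ∑ p ∈ primesOne 1 N, ind q p / p = recipSum q N := by
  rw [recipSum, primesOne_eq_filter q, Finset.sum_filter]
  refine Finset.sum_congr rfl fun p _ => ?_
  unfold ind; split_ifs <;> simp

lemma om_eq_addFun (q : ℕ) {m n : ℕ} (hm : 1 ≤ m) (hmn : m ≤ n) :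
    om q m = ∑ p ∈ primesOne q n, dvdInd p m := by
  rw [om, fullAdd_eq_addFun _ hm hmn, addFun, primesOne_eq_filter q, Finset.sum_filter]
  refine Finset.sum_congr rfl fun p _ => ?_
  unfold ind; split_ifs <;> simp

lemma isLittleO_av_om_sub (q : ℕ) (hq : 0 < q) :
    (fun n => av n (om q) - LL n / q.totient) =o[atTop] sqLL := by
  have h1 : (fun n => av n (om q) - recipSum q n) =o[atTop] sqLL := by
    refine isLittleO_of_le (isLittleO_const_sqLL 1) ?_
    filter_upwards [eventually_ge_atTop 1] with n hn
    have := abs_av_addFun_sub_le hn (P := primesOne 1 n) (fun p => prime_of_mem_primesOne)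
      (abs_ind_le_one q)
    rw [sum_ind_div, ← av_congr (f := om q) (fun m h1 h2 => fullAdd_eq_addFun _ h1 h2)] at this
    refine this.trans (div_le_one_of_le₀ ?_ (by positivity))
    exact_mod_cast card_primesOne_le 1 n
  exact (h1.add (isLittleO_recipSum q hq)).congr_left fun n => by ring

lemma av_abs_fullAdd_sub_le {h : ℕ → ℝ} (hh : ∀ p, |h p| ≤ 1) {n y : ℕ} (hn : 1 ≤ n) (hy : y ≤ n) :
    av n (fun m => |fullAdd h m - addFun (primesOne 1 y) h m|) ≤ recipSum 1 n - recipSum 1 y := by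
  have hs := primesOne_subset hy
  have e1 : recipSum 1 n - recipSum 1 y = ∑ p ∈ primesOne 1 n \ primesOne 1 y, (1 / p : ℝ) := by
    rw [recipSum, recipSum, ← Finset.sum_sdiff hs]; ring
  have h1 : av n (fun m => |fullAdd h m - addFun (primesOne 1 y) h m|) ≤
      av n (fun m => ∑ p ∈ primesOne 1 n \ primesOne 1 y, dvdInd p m) := by
    refine av_mono fun m h1 h2 => ?_
    rw [fullAdd_eq_addFun h h1 h2, addFun, addFun, ← Finset.sum_sdiff hs, add_sub_cancel_right]
    refine (Finset.abs_sum_le_sum_abs _ _).trans (Finset.sum_le_sum fun p _ => ?_)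
    rw [abs_mul, abs_of_nonneg (dvdInd_nonneg p m)]
    exact mul_le_of_le_one_left (dvdInd_nonneg p m) (hh p)
  rw [e1]
  refine h1.trans ?_
  rw [av_sum]
  exact Finset.sum_le_sum fun p _ => av_dvdInd_le hn

lemma isLittleO_av_abs_fullAdd_sub {h : ℕ → ℝ} (hh : ∀ p, |h p| ≤ 1) :
    (fun n => av n (fun m => |fullAdd h m - addFun (primesOne 1 (yTr n)) h m|)) =o[atTop] sqLL := by
  refine isLittleO_of_le
    ((isLittleO_recipSum 1 one_pos).sub (exists_recipSum_yTr 1 one_pos)) ?_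
  filter_upwards [eventually_ge_atTop 1, eventually_yTr_sq_le] with n h1 h2
  rw [abs_of_nonneg (av_nonneg fun _ => abs_nonneg _)]
  have := av_abs_fullAdd_sub_le hh h1 ((Nat.le_self_pow two_ne_zero _).trans h2)
  linarith

lemma eventually_recipSum_one_le : ∀ᶠ n in atTop, recipSum 1 (yTr n) + 3 ≤ 2 * LL n := by
  have := (exists_recipSum_yTr 1 one_pos).trans sqLL_isLittleO_LL
  filter_upwards [this.bound (c := 1 / 2) (by norm_num), tendsto_LL.eventually_ge_atTop 6] with n h1 h2
  rw [Real.norm_eq_abs, Real.norm_eq_abs, abs_of_nonneg (by linarith : 0 ≤ LL n)] at h1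
  have := (abs_le.1 h1).2
  simp at this
  linarith

lemma eventually_av_sq_le {h : ℕ → ℝ} (hh : ∀ p, |h p| ≤ 1) : ∀ᶠ n in atTop,
    av n (fun m => (addFun (primesOne 1 (yTr n)) h m - ∑ p ∈ primesOne 1 (yTr n), h p / p) ^ 2) ≤
      2 * LL n := by
  filter_upwards [eventually_ge_atTop 1, eventually_yTr_sq_le, eventually_recipSum_one_le]
    with n h1 h2 h3
  refine (av_sq_addFun_sub_le h1 (fun p => prime_of_mem_primesOne) hh ?_).trans h3
  exact (Nat.pow_le_pow_left (card_primesOne_le _ _) 2).trans h2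

/-- If the mean of an additive function minus a threshold grows like `log log n`,
then the negative part of the difference is bounded on average. -/
lemma isLittleO_av_neg_part {h : ℕ → ℝ} (hh : ∀ p, |h p| ≤ 1) {T : ℕ → ℝ} {c : ℝ} (hc : 0 < c)
    (hT : ∀ᶠ n in atTop, c * LL n ≤ ∑ p ∈ primesOne 1 (yTr n), h p / p - T n) :
    (fun n => av n (fun m => max (T n - fullAdd h m) 0)) =o[atTop] sqLL := by
  refine isLittleO_of_le ((isLittleO_av_abs_fullAdd_sub hh).add (isLittleO_const_sqLL (2 / c))) ?_
  filter_upwards [hT, eventually_av_sq_le hh, tendsto_LL.eventually_ge_atTop 1] with n h1 h2 h3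
  rw [abs_of_nonneg (av_nonneg fun _ => le_max_right _ _)]
  set M := ∑ p ∈ primesOne 1 (yTr n), h p / p
  set f := addFun (primesOne 1 (yTr n)) h
  have h4 : 0 < c * LL n := by nlinarith
  have h5 : av n (fun m => max (-(f m - T n)) 0) ≤ 2 * LL n / (M - T n) := by
    refine av_neg_part_le (f := fun m => f m - T n) (h4.trans_le h1) ?_
    simpa only [sub_sub_sub_cancel_right] using h2
  have h6 : 2 * LL n / (M - T n) ≤ 2 / c := by
    rw [div_le_div_iff₀ (h4.trans_le h1) hc]
    nlinarith
  refine le_trans ?_ (add_le_add le_rfl (h5.trans h6))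
  rw [← av_add]
  refine av_mono fun m _ _ => ?_
  have a1 := neg_abs_le (fullAdd h m - f m)
  have a2 := abs_nonneg (fullAdd h m - f m)
  refine max_le ?_ (add_nonneg a2 (le_max_right _ _))
  linarith [le_max_left (-(f m - T n)) 0]

lemma fullAdd_sub (g h : ℕ → ℝ) (m : ℕ) :
    fullAdd (fun p => g p - h p) m = fullAdd g m - fullAdd h m := by
  simp only [fullAdd, Finset.sum_sub_distrib]

lemma abs_ind_sub_le_one (q r p : ℕ) : |ind q p - ind r p| ≤ 1 := by
  have h1 := ind_nonneg q p
  have h2 := ind_le_one q p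
  have h3 := ind_nonneg r p
  have h4 := ind_le_one r p
  rw [abs_le]; constructor <;> linarith

lemma sum_ind_sub_div (q r N : ℕ) :
    ∑ p ∈ primesOne 1 N, (ind q p - ind r p) / p = recipSum q N - recipSum r N := by
  simp only [sub_div, Finset.sum_sub_distrib, sum_ind_div]

lemma isLittleO_av_om_sub_pos {q r : ℕ} (hq : 0 < q) (hr : 0 < r) (h : q.totient < r.totient) :
    (fun n => av n (fun m => max (om r m - om q m) 0)) =o[atTop] sqLL := by
  have hq0 : (0 : ℝ) < q.totient := by exact_mod_cast Nat.totient_pos.2 hq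
  have hqr : (q.totient : ℝ) < r.totient := by exact_mod_cast h
  set c := 1 / (q.totient : ℝ) - 1 / r.totient with hc
  have hc0 : 0 < c := sub_pos.2 (one_div_lt_one_div_of_lt hq0 hqr)
  have := isLittleO_av_neg_part (h := fun p => ind q p - ind r p) (abs_ind_sub_le_one q r)
    (T := fun _ => 0) (c := c / 2) (by positivity) ?_
  · refine this.congr_left fun n => ?_
    simp only [fullAdd_sub, om]
    exact av_congr fun m _ _ => by ring_nf
  · have h1 := ((exists_recipSum_yTr q hq).sub (exists_recipSum_yTr r hr)).trans sqLL_isLittleO_LL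
    filter_upwards [h1.bound (c := c / 2) (by positivity), tendsto_LL.eventually_ge_atTop 0] with n h1 h2
    rw [sum_ind_sub_div, Real.norm_eq_abs, Real.norm_of_nonneg h2] at *
    have h3 := (abs_le.1 h1).1
    have h4 : LL n / q.totient - LL n / r.totient = c * LL n := by rw [hc]; ring
    linarith

lemma isLittleO_av_threshold {q : ℕ} (hq : 0 < q) :
    (fun n => av n (fun m => max (LL n / (2 * q.totient) - om q m) 0)) =o[atTop] sqLL := by
  have hq0 : (0 : ℝ) < q.totient := by exact_mod_cast Nat.totient_pos.2 hq
  refine isLittleO_av_neg_part (c := 1 / (4 * q.totient)) (abs_ind_le_one q) (by positivity) ?_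
  have h1 := (exists_recipSum_yTr q hq).trans sqLL_isLittleO_LL
  filter_upwards [h1.bound (c := 1 / (4 * q.totient)) (by positivity),
    tendsto_LL.eventually_ge_atTop 0] with n h1 h2
  rw [sum_ind_div]
  rw [Real.norm_eq_abs, Real.norm_of_nonneg h2] at h1
  have h3 := (abs_le.1 h1).1
  have h4 : LL n / q.totient - LL n / (2 * q.totient) = 2 * (1 / (4 * q.totient) * LL n) := by
    field_simp; norm_num
  linarith

end InvFactor

namespace InvFactor
open Asymptotics Topology

lemma le_two_mul_totient {q : ℕ} (hq : IsPrimePow q) : q ≤ 2 * q.totient := by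
  obtain ⟨p, k, hp, hk, rfl⟩ := (isPrimePow_nat_iff q).1 hq
  rw [Nat.totient_prime_pow hp hk]
  obtain ⟨j, rfl⟩ := Nat.exists_eq_succ_of_ne_zero hk.ne'
  have := hp.two_le
  rw [Nat.succ_sub_one, pow_succ, mul_left_comm]
  exact Nat.mul_le_mul_left _ (by omega)

lemma dvd_sub_one_of_mem_primesOne {q N p : ℕ} (h : p ∈ primesOne q N) : q ∣ p - 1 := by
  obtain ⟨-, hp, h1⟩ := mem_primesOne.1 h
  rw [← Nat.modEq_iff_dvd' hp.one_le, ← ZMod.natCast_eq_natCast_iff, h1, Nat.cast_one]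

lemma recipSum_le_div {q n : ℕ} (hq : 1 ≤ q) : recipSum q n ≤ (1 + Real.log n) / q := by
  have hq0 : (0 : ℝ) < q := by positivity
  have hpos : ∀ p ∈ primesOne q n, 1 ≤ (p - 1) / q ∧ q * ((p - 1) / q) = p - 1 := fun p hp => by
    have h1 := dvd_sub_one_of_mem_primesOne hp
    have h2 := (prime_of_mem_primesOne hp).two_le
    refine ⟨(Nat.one_le_div_iff hq).2 (Nat.le_of_dvd (by omega) h1), Nat.mul_div_cancel' h1⟩
  have hinj : Set.InjOn (fun p => (p - 1) / q) (primesOne q n : Set ℕ) := fun p hp r hr h => by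
    have h1 := (hpos p hp).2
    have h2 := (hpos r hr).2
    have h3 := (prime_of_mem_primesOne hp).two_le
    have h4 := (prime_of_mem_primesOne hr).two_le
    simp only at h
    rw [h, h2] at h1
    omega
  calc recipSum q n ≤ ∑ p ∈ primesOne q n, (q : ℝ)⁻¹ * (((p - 1) / q : ℕ) : ℝ)⁻¹ := by
        refine Finset.sum_le_sum fun p hp => ?_
        obtain ⟨h1, h2⟩ := hpos p hp
        rw [← mul_inv, one_div]
        have : (q : ℝ) * (((p - 1) / q : ℕ) : ℝ) ≤ p := by
          exact_mod_cast h2.trans_le (Nat.sub_le _ _)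
        have : (0 : ℝ) < (((p - 1) / q : ℕ) : ℝ) := by exact_mod_cast h1
        gcongr
    _ = (q : ℝ)⁻¹ * ∑ k ∈ (primesOne q n).image (fun p => (p - 1) / q), (k : ℝ)⁻¹ := by
        rw [Finset.sum_image hinj, Finset.mul_sum]
    _ ≤ (q : ℝ)⁻¹ * ∑ k ∈ Finset.Icc 1 n, (k : ℝ)⁻¹ := by
        gcongr
        refine Finset.image_subset_iff.2 fun p hp => Finset.mem_Icc.2 ⟨(hpos p hp).1, ?_⟩
        exact (Nat.div_le_self _ _).trans ((Nat.sub_le _ _).trans (mem_primesOne.1 hp).1)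
    _ ≤ (q : ℝ)⁻¹ * (1 + Real.log n) := by
        have := harmonic_le_one_add_log n
        rw [harmonic_eq_sum_Icc] at this
        push_cast at this
        gcongr
    _ = (1 + Real.log n) / q := by ring

lemma av_max_om_sub_le_exp {q n : ℕ} (hn : 1 ≤ n) {t T : ℝ} (ht : 0 < t) :
    av n (fun m => max (om q m - T) 0) ≤
      Real.exp ((Real.exp t - 1) * recipSum q n - t * T) / t := by
  have h1 : av n (fun m => max (om q m - T) 0) ≤ av n (fun m => Real.exp (-(t * T)) / t *
      ∏ p ∈ primesOne q n, (1 + if p ∣ m then (Real.exp t - 1) else 0)) := by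
    refine av_mono fun m hm hmn => ?_
    have e1 : ∏ p ∈ primesOne q n, (1 + if p ∣ m then (Real.exp t - 1) else 0) =
        Real.exp (t * om q m) := by
      rw [om_eq_addFun q hm hmn, Finset.mul_sum, Real.exp_sum]
      refine Finset.prod_congr rfl fun p _ => ?_
      unfold dvdInd; split_ifs <;> simp
    rw [e1, div_mul_eq_mul_div, ← Real.exp_add, le_div_iff₀ ht]
    have h2 := Real.add_one_le_exp (-(t * T) + t * om q m)
    have h3 := Real.exp_pos (-(t * T) + t * om q m)
    rcases le_total (om q m - T) 0 with h | h
    · rw [max_eq_right h, zero_mul]; exact h3.le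
    · rw [max_eq_left h]; nlinarith
  refine h1.trans ?_
  rw [av_const_mul]
  have h2 := av_prod_one_add_le hn (P := primesOne q n) (fun p => prime_of_mem_primesOne)
    (g := Real.exp t - 1) (by linarith [Real.add_one_le_exp t])
  calc _ ≤ Real.exp (-(t * T)) / t * Real.exp ((Real.exp t - 1) * recipSum q n) := by
        gcongr
        exact h2
    _ = _ := by rw [div_mul_eq_mul_div, ← Real.exp_add]; ring_nf

lemma av_max_om_sub_le_sq {q n : ℕ} (hn : 1 ≤ n) {T : ℝ} (hT : 1 ≤ T) :
    av n (fun m => max (om q m - T) 0) ≤ recipSum q n ^ 2 := by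
  have h1 : av n (fun m => max (om q m - T) 0) ≤ av n (fun m =>
      ∑ p ∈ primesOne q n, ∑ r ∈ primesOne q n, if p = r then 0 else dvdInd (p * r) m) := by
    refine av_mono fun m hm hmn => ?_
    have e1 : ∑ p ∈ primesOne q n, ∑ r ∈ primesOne q n, (if p = r then 0 else dvdInd (p * r) m) =
        om q m * om q m - om q m := by
      rw [om_eq_addFun q hm hmn, Finset.sum_mul_sum, ← Finset.sum_sub_distrib]
      refine Finset.sum_congr rfl fun p hp => ?_
      have : ∑ r ∈ primesOne q n, (if p = r then dvdInd p m else 0) = dvdInd p m := by simp [hp]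
      conv_rhs => arg 2; rw [← this]
      rw [← Finset.sum_sub_distrib]
      refine Finset.sum_congr rfl fun r hr => ?_
      split_ifs with hpr
      · subst hpr; rw [dvdInd_mul_self, sub_self]
      · rw [dvdInd_mul (prime_of_mem_primesOne hp) (prime_of_mem_primesOne hr) hpr, sub_zero]
    have e2 : ∃ k : ℕ, om q m = k := by
      refine ⟨((primesOne q n).filter (· ∣ m)).card, ?_⟩
      rw [om_eq_addFun q hm hmn, ← Finset.sum_boole]
      rfl
    obtain ⟨k, hk⟩ := e2
    rw [e1, hk]
    have h2 : (k : ℝ) ≤ k * k := by exact_mod_cast Nat.le_mul_self k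
    refine max_le ?_ (by linarith)
    rcases Nat.eq_zero_or_pos k with rfl | h0
    · norm_num; linarith
    · have : (1 : ℝ) ≤ k := by exact_mod_cast h0
      nlinarith
  refine h1.trans ?_
  rw [av_sum, recipSum, sq, Finset.sum_mul_sum]
  refine Finset.sum_le_sum fun p hp => ?_
  rw [av_sum]
  refine Finset.sum_le_sum fun r hr => ?_
  split_ifs with hpr
  · rw [av_const hn]; positivity
  · refine (av_dvdInd_le hn).trans_eq ?_
    push_cast
    rw [one_div_mul_one_div]

lemma om_eq_zero {q m : ℕ} (hm : 1 ≤ m) (hq : m < q) : om q m = 0 := by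
  rw [om_eq_addFun q hm le_rfl]
  refine Finset.sum_eq_zero fun p hp => ?_
  have h1 := dvd_sub_one_of_mem_primesOne hp
  have h2 := Nat.le_of_dvd (by have := (prime_of_mem_primesOne hp).two_le; omega) h1
  have := (mem_primesOne.1 hp).1
  omega

lemma om_nonneg (q m : ℕ) : 0 ≤ om q m := by
  rw [om, fullAdd]
  exact Finset.sum_nonneg fun _ _ => ind_nonneg _ _

/-- The prime powers in `(Q, n]`. -/
def ppRange (Q n : ℕ) : Finset ℕ := open Classical in (Finset.Icc 1 n).filter fun q => IsPrimePow q ∧ Q < q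

lemma mem_ppRange {Q n q : ℕ} : q ∈ ppRange Q n ↔ q ≤ n ∧ IsPrimePow q ∧ Q < q := by
  rw [ppRange, Finset.mem_filter, Finset.mem_Icc]
  exact ⟨fun h => ⟨h.1.2, h.2⟩, fun h => ⟨⟨by omega, h.1⟩, h.2⟩⟩

lemma exists_eventually_recipSum_le {A : ℝ} (hA : 0 < A) : ∃ Q : ℕ, ∀ᶠ n : ℕ in atTop, ∀ q,
    IsPrimePow q → Q < q → (q : ℝ) ≤ Real.log n ^ 2 → A * recipSum q n ≤ LL n := by
  obtain ⟨C, hC⟩ := exists_recipSum_le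
  obtain ⟨Q, hQ⟩ := exists_nat_ge (4 * A)
  refine ⟨Q, ?_⟩
  have h1 : (fun n => Real.log (2 + 2 * LL n) + C) =o[atTop] LL := by
    refine IsLittleO.add ?_ ((isLittleO_const_sqLL C).trans sqLL_isLittleO_LL)
    have h2 : Tendsto (fun n => 2 + 2 * LL n) atTop atTop :=
      tendsto_atTop_add_const_left _ _ (tendsto_LL.const_mul_atTop two_pos)
    refine (Real.isLittleO_log_id_atTop.comp_tendsto h2).trans_isBigO ?_
    refine IsBigO.of_bound 4 ?_
    filter_upwards [tendsto_LL.eventually_ge_atTop 1] with n hn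
    simp only [Function.comp, id]
    rw [Real.norm_of_nonneg (by linarith), Real.norm_of_nonneg (by linarith)]
    linarith
  filter_upwards [h1.bound (c := 1 / (2 * A)) (by positivity), eventually_ge_atTop 3,
    tendsto_LL.eventually_ge_atTop 0] with n h2 h3 h4 q hq hQq hqn
  have hq2 : 2 ≤ q := hq.two_le
  have h5 := hC q n hq2 h3
  have h6 := one_lt_log_natCast h3
  have h7 : Real.log q ≤ 2 * LL n := by
    have := Real.log_le_log (by positivity) hqn
    rwa [Real.log_pow, Nat.cast_ofNat] at this
  have h8 : Real.log (2 + Real.log q) ≤ Real.log (2 + 2 * LL n) := by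
    have := Real.log_natCast_nonneg q
    exact Real.log_le_log (by linarith) (by linarith)
  rw [Real.norm_of_nonneg h4] at h2
  have h9 := (le_abs_self _).trans h2
  have h10 : 2 * A ≤ q.totient := by
    have a1 : (q : ℝ) ≤ 2 * q.totient := by exact_mod_cast le_two_mul_totient hq
    have a2 : (Q : ℝ) < q := by exact_mod_cast hQq
    linarith
  have h11 : LL n / q.totient ≤ LL n / (2 * A) := by gcongr
  have h12 : A * (LL n / (2 * A) + 1 / (2 * A) * LL n) = LL n := by field_simp; norm_num
  rw [← h12]
  gcongr
  linarith

lemma exists_isLittleO_large {κ : ℝ} (hκ : 0 < κ) : ∃ Q : ℕ,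
    (fun n => av n (fun m => ∑ q ∈ ppRange Q n, max (om q m - LL n / κ) 0)) =o[atTop] sqLL := by
  set t := 3 * κ with ht
  have ht0 : 0 < t := by positivity
  obtain ⟨Q, hQ⟩ := exists_eventually_recipSum_le (Real.exp_pos t)
  refine ⟨Q, isLittleO_of_le (isLittleO_const_sqLL (1 / t + 8)) ?_⟩
  filter_upwards [hQ, eventually_ge_atTop 3, tendsto_LL.eventually_ge_atTop κ] with n h1 h2 h3
  have hn : 1 ≤ n := by omega
  have hlog := one_lt_log_natCast h2
  have hlog0 : 0 < Real.log n := by linarith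
  rw [abs_of_nonneg (av_nonneg fun m => Finset.sum_nonneg fun _ _ => le_max_right _ _), av_sum]
  set X := ⌊Real.log n ^ 2⌋₊ with hX
  have hexp : Real.exp (-(2 * LL n)) = (Real.log n ^ 2)⁻¹ := by
    rw [Real.exp_neg, mul_comm, Real.exp_mul, LL, Real.exp_log hlog0]
    norm_num
  have hsmall : ∀ q ∈ (ppRange Q n).filter (· ≤ X), av n (fun m => max (om q m - LL n / κ) 0) ≤
      (Real.log n ^ 2)⁻¹ / t := fun q hq => by
    obtain ⟨hq1, hq2⟩ := Finset.mem_filter.1 hq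
    obtain ⟨-, hq3, hq4⟩ := mem_ppRange.1 hq1
    refine (av_max_om_sub_le_exp hn ht0).trans ?_
    rw [← hexp]
    gcongr
    have a1 := h1 q hq3 hq4 ((Nat.le_floor_iff (by positivity)).1 hq2)
    have a2 := recipSum_nonneg q n
    have a3 : t * (LL n / κ) = 3 * LL n := by rw [ht]; field_simp
    rw [a3]
    linarith
  have hlarge : ∀ q ∈ (ppRange Q n).filter (¬ · ≤ X), av n (fun m => max (om q m - LL n / κ) 0) ≤
      (1 + Real.log n) ^ 2 * ((q : ℝ) ^ 2)⁻¹ := fun q hq => by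
    obtain ⟨hq1, hq2⟩ := Finset.mem_filter.1 hq
    refine (av_max_om_sub_le_sq hn ((one_le_div hκ).2 h3)).trans ?_
    rw [← div_eq_mul_inv, ← div_pow]
    exact pow_le_pow_left₀ (recipSum_nonneg q n) (recipSum_le_div (by omega)) 2
  rw [← Finset.sum_filter_add_sum_filter_not (ppRange Q n) (· ≤ X)]
  refine add_le_add ?_ ?_
  · refine (Finset.sum_le_card_nsmul _ _ _ hsmall).trans ?_
    have hc : (((ppRange Q n).filter (· ≤ X)).card : ℝ) ≤ Real.log n ^ 2 := by
      have : ((ppRange Q n).filter (· ≤ X)) ⊆ Finset.Icc 1 X := fun q hq => by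
        obtain ⟨hq1, hq2⟩ := Finset.mem_filter.1 hq
        exact Finset.mem_Icc.2 ⟨by have := (mem_ppRange.1 hq1).2.2; omega, hq2⟩
      have := Finset.card_le_card this
      rw [Nat.card_Icc, Nat.add_sub_cancel] at this
      exact (Nat.le_floor_iff (by positivity)).1 this
    rw [nsmul_eq_mul]
    calc _ ≤ Real.log n ^ 2 * ((Real.log n ^ 2)⁻¹ / t) := by gcongr
      _ = 1 / t := by field_simp
  · refine (Finset.sum_le_sum hlarge).trans ?_
    rw [← Finset.mul_sum]
    have hsub : (ppRange Q n).filter (¬ · ≤ X) ⊆ Finset.Ioo X (n + 1) := fun q hq => by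
      obtain ⟨hq1, hq2⟩ := Finset.mem_filter.1 hq
      exact Finset.mem_Ioo.2 ⟨by omega, by have := (mem_ppRange.1 hq1).1; omega⟩
    have a1 := (Finset.sum_le_sum_of_subset_of_nonneg hsub
      (f := fun q : ℕ => ((q : ℝ) ^ 2)⁻¹) fun _ _ _ => by positivity).trans
      (sum_Ioo_inv_sq_le X (n + 1))
    have a2 : Real.log n ^ 2 < X + 1 := Nat.lt_floor_add_one _
    calc _ ≤ (1 + Real.log n) ^ 2 * (2 / (X + 1)) := by gcongr
      _ ≤ (2 * Real.log n) ^ 2 * (2 / Real.log n ^ 2) := by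
          gcongr
          linarith
      _ = 8 := by field_simp; norm_num

/-- A majorant, small on average, for all the differences `ω_q - ω_b` with `φ(q) > φ(b)`. -/
lemma exists_majorant {b : ℕ} (hb : 0 < b) : ∃ E : ℕ → ℕ → ℝ, (∀ n m, 0 ≤ E n m) ∧
    (∀ n m q, 1 ≤ m → m ≤ n → IsPrimePow q → b.totient < q.totient → om q m - om b m ≤ E n m) ∧
    (fun n => av n (E n)) =o[atTop] sqLL := by
  have hb0 : (0 : ℝ) < b.totient := by exact_mod_cast Nat.totient_pos.2 hb
  obtain ⟨Q, hQ⟩ := exists_isLittleO_large (κ := 2 * b.totient) (by positivity)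
  set F := (Finset.range (Q + 1)).filter fun q => b.totient < q.totient with hF
  refine ⟨fun n m => ∑ q ∈ F, max (om q m - om b m) 0 + max (LL n / (2 * b.totient) - om b m) 0 +
    ∑ q ∈ ppRange Q n, max (om q m - LL n / (2 * b.totient)) 0, fun n m => ?_,
    fun n m q hm hmn hq hbq => ?_, ?_⟩
  · have h1 : 0 ≤ ∑ q ∈ F, max (om q m - om b m) 0 := Finset.sum_nonneg fun _ _ => le_max_right _ _
    have h2 : 0 ≤ ∑ q ∈ ppRange Q n, max (om q m - LL n / (2 * b.totient)) 0 :=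
      Finset.sum_nonneg fun _ _ => le_max_right _ _
    have := le_max_right (LL n / (2 * b.totient) - om b m) 0
    positivity
  · have h1 : 0 ≤ ∑ q ∈ F, max (om q m - om b m) 0 := Finset.sum_nonneg fun _ _ => le_max_right _ _
    have h2 : 0 ≤ ∑ q ∈ ppRange Q n, max (om q m - LL n / (2 * b.totient)) 0 :=
      Finset.sum_nonneg fun _ _ => le_max_right _ _
    have h3 := le_max_right (LL n / (2 * b.totient) - om b m) 0
    have h4 := le_max_left (LL n / (2 * b.totient) - om b m) 0
    rcases le_or_gt q Q with hqQ | hqQ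
    · have : q ∈ F := Finset.mem_filter.2 ⟨Finset.mem_range.2 (by omega), hbq⟩
      have := Finset.single_le_sum (f := fun q => max (om q m - om b m) 0)
        (fun _ _ => le_max_right _ _) this
      have h5 := (le_max_left _ _).trans this
      linarith
    · rcases le_or_gt q n with hqn | hqn
      · have := Finset.single_le_sum (f := fun q => max (om q m - LL n / (2 * b.totient)) 0)
          (fun _ _ => le_max_right _ _) (mem_ppRange.2 ⟨hqn, hq, hqQ⟩)
        have h5 := (le_max_left _ _).trans this
        linarith
      · rw [om_eq_zero hm (hmn.trans_lt hqn)]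
        have := om_nonneg b m
        linarith
  · simp only [av_add]
    refine IsLittleO.add (IsLittleO.add ?_ (isLittleO_av_threshold hb)) hQ
    simp only [av_sum]
    refine IsLittleO.fun_sum (A := fun q n => av n fun m => max (om q m - om b m) 0) fun q hq => ?_
    have h1 := (Finset.mem_filter.1 hq).2
    exact isLittleO_av_om_sub_pos hb (Nat.totient_pos.1 (by omega)) h1

end InvFactor

namespace InvFactor
open Asymptotics Topology
open scoped NNReal

/-- The constant `c` in `∫ (1 - cos (t x)) / t² dt = c |x|`. -/
def cosConst : ℝ := ∫ u : ℝ, (1 - Real.cos u) / u ^ 2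

lemma one_sub_cos_div_nonneg (x t : ℝ) : 0 ≤ (1 - Real.cos (t * x)) / t ^ 2 :=
  div_nonneg (by linarith [Real.cos_le_one (t * x)]) (sq_nonneg t)

lemma one_sub_cos_div_le (x t : ℝ) :
    (1 - Real.cos (t * x)) / t ^ 2 ≤ (4 + x ^ 2) * (1 + t ^ 2)⁻¹ := by
  rcases eq_or_ne t 0 with rfl | ht
  · simp; positivity
  have h0 : 0 < t ^ 2 := by positivity
  have h1 := Real.neg_one_le_cos (t * x)
  have h2 := Real.one_sub_sq_div_two_le_cos (x := t * x)
  have h3 := Real.cos_le_one (t * x)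
  rw [← div_eq_mul_inv, div_le_div_iff₀ h0 (by positivity)]
  rcases le_total (t ^ 2) 1 with h | h
  · nlinarith
  · nlinarith [sq_nonneg x]

lemma measurable_one_sub_cos_div (x : ℝ) : Measurable fun t : ℝ => (1 - Real.cos (t * x)) / t ^ 2 := by
  fun_prop

lemma integrable_one_sub_cos_div (x : ℝ) : Integrable fun t : ℝ => (1 - Real.cos (t * x)) / t ^ 2 := by
  refine (integrable_inv_one_add_sq.const_mul (4 + x ^ 2)).mono'
    (measurable_one_sub_cos_div x).aestronglyMeasurable (ae_of_all _ fun t => ?_)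
  rw [Real.norm_of_nonneg (one_sub_cos_div_nonneg x t)]
  exact one_sub_cos_div_le x t

lemma integral_one_sub_cos_div (x : ℝ) :
    ∫ t : ℝ, (1 - Real.cos (t * x)) / t ^ 2 = cosConst * |x| := by
  rcases eq_or_ne x 0 with rfl | hx
  · simp
  have h1 : ∀ t : ℝ, (1 - Real.cos (t * x)) / t ^ 2 =
      x ^ 2 * ((fun u : ℝ => (1 - Real.cos u) / u ^ 2) (t * x)) := fun t => by
    simp only [mul_pow]
    rcases eq_or_ne t 0 with rfl | ht
    · simp
    · field_simp
  rw [integral_congr_ae (ae_of_all _ h1), integral_const_mul, Measure.integral_comp_mul_right (fun u : ℝ => (1 - Real.cos u) / u ^ 2), ← cosConst, smul_eq_mul, abs_inv,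
    ← sq_abs]
  have : |x| ≠ 0 := abs_ne_zero.2 hx
  field_simp

lemma cosConst_pos : 0 < cosConst := by
  have h0 := integrable_one_sub_cos_div 1
  have h1 := one_sub_cos_div_nonneg 1
  simp only [mul_one] at h0 h1
  rw [cosConst, integral_pos_iff_support_of_nonneg h1 h0]
  refine lt_of_lt_of_le ?_ (measure_mono (s := Set.Ioo (1 : ℝ) 2) fun u hu => ?_)
  · rw [Real.volume_Ioo]; norm_num
  · have h2 : Real.cos u < 1 := by
      rw [← Real.cos_zero]
      exact Real.cos_lt_cos_of_nonneg_of_le_pi le_rfl (by linarith [hu.2, Real.pi_gt_three])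
        (by linarith [hu.1])
    have h3 : 0 < u := by linarith [hu.1]
    exact (div_pos (by linarith) (by positivity)).ne'

lemma integral_cos_gaussianReal (v : ℝ≥0) (t : ℝ) :
    ∫ x, Real.cos (t * x) ∂gaussianReal 0 v = Real.exp (-(v * t ^ 2 / 2)) := by
  have h1 := charFun_gaussianReal (μ := 0) (v := v) t
  rw [charFun_apply_real] at h1
  have h2 : ∀ x : ℝ, Real.cos (t * x) = (Complex.exp (t * x * Complex.I)).re := fun x => by
    rw [← Complex.ofReal_mul, Complex.exp_ofReal_mul_I_re]
  simp only [h2]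
  have h3 : Integrable (fun x : ℝ => Complex.exp (t * x * Complex.I)) (gaussianReal 0 v) := by
    refine (integrable_const (1 : ℝ)).mono' (by fun_prop) (ae_of_all _ fun x => ?_)
    rw [← Complex.ofReal_mul, Complex.norm_exp_ofReal_mul_I]
  have h4 := integral_re h3
  simp only [RCLike.re_eq_complex_re] at h4
  rw [h4, h1, ← Complex.ofReal_re (Real.exp _)]
  congr 1
  push_cast
  congr 1
  ring

lemma integral_abs_gaussianReal {v : ℝ≥0} (hv : v ≠ 0) :
    ∫ x, |x| ∂gaussianReal 0 v = 2 * v / Real.sqrt (2 * Real.pi * v) := by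
  have hv0 : (0 : ℝ) < v := by positivity
  rw [integral_gaussianReal_eq_integral_smul hv]
  have h1 : ∀ x : ℝ, gaussianPDFReal 0 v x • |x| =
      (fun y : ℝ => (Real.sqrt (2 * Real.pi * v))⁻¹ *
        (y ^ (1 : ℝ) * Real.exp (-(1 / (2 * v)) * y ^ (2 : ℝ)))) |x| := fun x => by
    simp only [gaussianPDFReal, sub_zero, smul_eq_mul, Real.rpow_one, Real.rpow_two, sq_abs]
    rw [mul_assoc, mul_comm |x|]
    ring_nf
  rw [integral_congr_ae (ae_of_all _ h1), integral_comp_abs (f := fun y : ℝ =>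
    (Real.sqrt (2 * Real.pi * v))⁻¹ * (y ^ (1 : ℝ) * Real.exp (-(1 / (2 * v)) * y ^ (2 : ℝ)))),
    integral_const_mul,
    integral_rpow_mul_exp_neg_mul_rpow (by norm_num) (by norm_num) (by positivity)]
  norm_num [Real.rpow_neg_one]
  field_simp

lemma integral_one_sub_exp_div {v : ℝ≥0} (hv : v ≠ 0) :
    ∫ t : ℝ, (1 - Real.exp (-(v * t ^ 2 / 2))) / t ^ 2 =
      cosConst * (2 * v / Real.sqrt (2 * Real.pi * v)) := by
  have hint : Integrable (Function.uncurry fun (x t : ℝ) => (1 - Real.cos (t * x)) / t ^ 2)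
      ((gaussianReal 0 v).prod volume) := by
    refine (integrable_prod_iff ?_).2 ⟨ae_of_all _ fun x => integrable_one_sub_cos_div x, ?_⟩
    · refine Measurable.aestronglyMeasurable ?_
      unfold Function.uncurry
      fun_prop
    · simp only [Function.uncurry, Real.norm_of_nonneg (one_sub_cos_div_nonneg _ _),
        integral_one_sub_cos_div]
      refine Integrable.const_mul ?_ _
      have := (memLp_id_gaussianReal (μ := 0) (v := v) 1).integrable (by norm_num)
      exact this.abs
  have h1 := integral_integral_swap hint
  simp only [integral_one_sub_cos_div, integral_const_mul, integral_abs_gaussianReal hv] at h1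
  rw [h1]
  congr 1
  funext t
  rw [integral_div, integral_sub (integrable_const _), integral_cos_gaussianReal]
  · simp
  · refine (integrable_const (1 : ℝ)).mono' (by fun_prop) (ae_of_all _ fun x => ?_)
    exact Real.abs_cos_le_one _

/-- Convergence of first absolute moments from convergence of characteristic functions
to that of a centred Gaussian, under bounded second moments. -/
lemma tendsto_av_abs {X : ℕ → ℕ → ℝ} {v : ℝ≥0} (hv : v ≠ 0) {V : ℝ}
    (hV : ∀ᶠ n in atTop, av n (fun m => X n m ^ 2) ≤ V)
    (hX : ∀ t : ℝ, Tendsto (fun n => av n (fun m => Real.cos (t * X n m))) atTop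
      (𝓝 (Real.exp (-(v * t ^ 2 / 2))))) :
    Tendsto (fun n => av n (fun m => |X n m|)) atTop (𝓝 (2 * v / Real.sqrt (2 * Real.pi * v))) := by
  have h1 : ∀ n, cosConst * av n (fun m => |X n m|) =
      ∫ t : ℝ, av n (fun m => (1 - Real.cos (t * X n m)) / t ^ 2) := fun n => by
    unfold av
    rw [integral_div, integral_finsetSum _ fun m _ => integrable_one_sub_cos_div _]
    simp only [integral_one_sub_cos_div, ← Finset.mul_sum, mul_div_assoc]
  have h2 : Tendsto (fun n => ∫ t : ℝ, av n (fun m => (1 - Real.cos (t * X n m)) / t ^ 2)) atTop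
      (𝓝 (∫ t : ℝ, (1 - Real.exp (-(v * t ^ 2 / 2))) / t ^ 2)) := by
    refine tendsto_integral_filter_of_dominated_convergence
      (fun t => (4 + V) * (1 + t ^ 2)⁻¹) ?_ ?_ (integrable_inv_one_add_sq.const_mul _) ?_
    · refine Eventually.of_forall fun n => Measurable.aestronglyMeasurable ?_
      unfold av
      exact (Finset.measurable_sum _ fun m _ => measurable_one_sub_cos_div _).div_const _
    · filter_upwards [hV, eventually_ge_atTop 1] with n h3 hn
      refine ae_of_all _ fun t => ?_
      rw [Real.norm_of_nonneg (av_nonneg fun m => one_sub_cos_div_nonneg _ _)]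
      refine (av_mono fun m _ _ => one_sub_cos_div_le _ _).trans ?_
      simp only [mul_comm _ (1 + t ^ 2)⁻¹]
      rw [av_const_mul, av_add, av_const hn]
      gcongr
    · refine ae_of_all _ fun t => ?_
      have h3 : ∀ᶠ n in atTop, (1 - av n (fun m => Real.cos (t * X n m))) / t ^ 2 =
          av n (fun m => (1 - Real.cos (t * X n m)) / t ^ 2) := by
        filter_upwards [eventually_ge_atTop 1] with n hn
        simp only [div_eq_inv_mul _ (t ^ 2)]
        rw [av_const_mul, av_sub, av_const hn]
      exact (((hX t).const_sub 1).div_const _).congr' h3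
  rw [integral_one_sub_exp_div hv] at h2
  have h3 := h2.const_mul cosConst⁻¹
  simp only [← h1, inv_mul_cancel_left₀ cosConst_pos.ne'] at h3
  exact h3

end InvFactor

namespace InvFactor
open Asymptotics Topology
open scoped NNReal

lemma norm_prod_sub_prod_le {ι : Type*} (s : Finset ι) {a b : ι → ℂ} (ha : ∀ i ∈ s, ‖a i‖ ≤ 1)
    (hb : ∀ i ∈ s, ‖b i‖ ≤ 1) : ‖∏ i ∈ s, a i - ∏ i ∈ s, b i‖ ≤ ∑ i ∈ s, ‖a i - b i‖ := by
  induction s using Finset.cons_induction with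
  | empty => simp
  | cons i s hi ih =>
    rw [Finset.prod_cons, Finset.prod_cons, Finset.sum_cons]
    have h1 : a i * ∏ j ∈ s, a j - b i * ∏ j ∈ s, b j =
        (a i - b i) * ∏ j ∈ s, a j + b i * (∏ j ∈ s, a j - ∏ j ∈ s, b j) := by ring
    have h2 : ‖∏ j ∈ s, a j‖ ≤ 1 := by
      rw [norm_prod]
      exact Finset.prod_le_one (fun _ _ => norm_nonneg _) fun j hj => ha j (Finset.mem_cons_of_mem hj)
    have h3 := ih (fun j hj => ha j (Finset.mem_cons_of_mem hj))
      (fun j hj => hb j (Finset.mem_cons_of_mem hj))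
    rw [h1]
    refine (norm_add_le _ _).trans ?_
    rw [norm_mul, norm_mul]
    exact add_le_add (mul_le_of_le_one_right (norm_nonneg _) h2)
      ((mul_le_of_le_one_left (norm_nonneg _) (hb i (Finset.mem_cons_self _ _))).trans h3)

lemma norm_exp_mul_I_sub_one_le (x : ℝ) : ‖Complex.exp (x * Complex.I) - 1‖ ≤ |x| := by
  have := Real.norm_exp_I_mul_ofReal_sub_one_le (x := x)
  rwa [mul_comm] at this

/-- The quadratic approximation of the logarithm of the characteristic function. -/
def cumulant (x : ℝ) : ℂ := x * Complex.I - x ^ 2 / 2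

lemma norm_exp_sub_cumulant_le {x : ℝ} (hx : |x| ≤ 1) :
    ‖Complex.exp (x * Complex.I) - 1 - cumulant x‖ ≤ |x| ^ 3 := by
  have h0 : ‖(x : ℂ) * Complex.I‖ = |x| := by simp
  have h1 := Complex.exp_bound (x := x * Complex.I) (by rwa [h0]) (n := 3) (by norm_num)
  rw [h0] at h1
  have h2 : ∑ m ∈ Finset.range 3, ((x : ℂ) * Complex.I) ^ m / (m.factorial : ℂ) = 1 + cumulant x := by
    simp [Finset.sum_range_succ, cumulant, mul_pow]
    ring
  rw [h2, ← sub_sub] at h1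
  refine h1.trans (mul_le_of_le_one_right (by positivity) ?_)
  norm_num [Nat.factorial]

lemma norm_cumulant_le {x : ℝ} (hx : |x| ≤ 1) : ‖cumulant x‖ ≤ 3 / 2 * |x| := by
  refine (norm_sub_le _ _).trans ?_
  have h1 : ‖(x : ℂ) * Complex.I‖ = |x| := by simp
  have h2 : ‖(x : ℂ) ^ 2 / 2‖ = |x| ^ 2 / 2 := by simp
  rw [h1, h2]
  nlinarith [abs_nonneg x]

lemma norm_factor_sub_exp_le {x : ℝ} (hx : |x| ≤ 1) {p : ℕ} (hp : 2 ≤ p) :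
    ‖(1 + (Complex.exp (x * Complex.I) - 1) / p) - Complex.exp (cumulant x / p)‖ ≤
      |x| ^ 3 * (1 / p) + 3 * |x| ^ 2 * ((p : ℝ) ^ 2)⁻¹ := by
  have hp0 : (0 : ℝ) < p := by positivity
  have hp2 : (2 : ℝ) ≤ p := by exact_mod_cast hp
  have h1 : ‖cumulant x / p‖ ≤ 3 / 2 * |x| / p := by
    rw [norm_div, Complex.norm_natCast]
    gcongr
    exact norm_cumulant_le hx
  have h2 : ‖cumulant x / p‖ ≤ 1 := by
    refine h1.trans ?_
    rw [div_le_one hp0]; linarith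
  have h3 := Complex.norm_exp_sub_one_sub_id_le h2
  have h4 : ‖(Complex.exp (x * Complex.I) - 1 - cumulant x) / p‖ ≤ |x| ^ 3 * (1 / p) := by
    rw [norm_div, Complex.norm_natCast, mul_one_div]
    gcongr
    exact norm_exp_sub_cumulant_le hx
  have h5 : (1 + (Complex.exp (x * Complex.I) - 1) / p) - Complex.exp (cumulant x / p) =
      (Complex.exp (x * Complex.I) - 1 - cumulant x) / p -
        (Complex.exp (cumulant x / p) - 1 - cumulant x / p) := by ring
  rw [h5]
  refine (norm_sub_le _ _).trans (add_le_add h4 (h3.trans ?_))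
  calc ‖cumulant x / p‖ ^ 2 ≤ (3 / 2 * |x| / p) ^ 2 := by gcongr
    _ = 9 / 4 * |x| ^ 2 * ((p : ℝ) ^ 2)⁻¹ := by ring
    _ ≤ _ := by gcongr; norm_num

lemma norm_prod_factor_sub_exp_le {P : Finset ℕ} (hP : ∀ p ∈ P, p.Prime) {h : ℕ → ℝ}
    (hh : ∀ p, |h p| ≤ 1) {τ : ℝ} (hτ : |τ| ≤ 1) :
    ‖∏ p ∈ P, (1 + (Complex.exp ((τ * h p : ℝ) * Complex.I) - 1) / p) -
        Complex.exp (((τ * ∑ p ∈ P, h p / p : ℝ) : ℂ) * Complex.I -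
          ((τ ^ 2 * (∑ p ∈ P, h p ^ 2 / p) / 2 : ℝ) : ℂ))‖ ≤
      |τ| ^ 3 * ∑ p ∈ P, (1 / p : ℝ) + 6 * |τ| ^ 2 := by
  have hx : ∀ p, |τ * h p| ≤ |τ| := fun p => by
    rw [abs_mul]; exact mul_le_of_le_one_right (abs_nonneg _) (hh p)
  have e1 : Complex.exp (((τ * ∑ p ∈ P, h p / p : ℝ) : ℂ) * Complex.I -
      ((τ ^ 2 * (∑ p ∈ P, h p ^ 2 / p) / 2 : ℝ) : ℂ)) =
      ∏ p ∈ P, Complex.exp (cumulant (τ * h p) / p) := by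
    rw [← Complex.exp_sum]
    congr 1
    unfold cumulant
    push_cast
    rw [Finset.mul_sum, Finset.sum_mul, Finset.mul_sum, Finset.sum_div, ← Finset.sum_sub_distrib]
    exact Finset.sum_congr rfl fun p _ => by ring
  rw [e1]
  have ha : ∀ p ∈ P, ‖1 + (Complex.exp ((τ * h p : ℝ) * Complex.I) - 1) / p‖ ≤ 1 := fun p hp => by
    have hp1 : (1 : ℝ) ≤ p := by exact_mod_cast (hP p hp).one_le
    have hp0 : (p : ℂ) ≠ 0 := by exact_mod_cast (hP p hp).ne_zero
    have : 1 + (Complex.exp ((τ * h p : ℝ) * Complex.I) - 1) / p =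
        ((1 - 1 / p : ℝ) : ℂ) + Complex.exp ((τ * h p : ℝ) * Complex.I) / p := by
      push_cast; field_simp; ring
    rw [this]
    refine (norm_add_le _ _).trans ?_
    rw [norm_div, Complex.norm_exp_ofReal_mul_I, Complex.norm_natCast, Complex.norm_real,
      Real.norm_of_nonneg]
    · linarith
    · rw [sub_nonneg, div_le_one (by linarith)]; exact hp1
  have hb : ∀ p ∈ P, ‖Complex.exp (cumulant (τ * h p) / p)‖ ≤ 1 := fun p _ => by
    rw [Complex.norm_exp, Real.exp_le_one_iff]
    have : cumulant (τ * h p) / p = ((-((τ * h p) ^ 2 / 2 / p) : ℝ) : ℂ) +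
        ((τ * h p / p : ℝ) : ℂ) * Complex.I := by
      unfold cumulant; push_cast; ring
    rw [this, Complex.add_re, Complex.re_ofReal_mul, Complex.I_re, Complex.ofReal_re, mul_zero,
      add_zero, neg_nonpos]
    positivity
  refine (norm_prod_sub_prod_le P ha hb).trans ?_
  have h1 : ∀ p ∈ P, ‖(1 + (Complex.exp ((τ * h p : ℝ) * Complex.I) - 1) / p) -
      Complex.exp (cumulant (τ * h p) / p)‖ ≤ |τ| ^ 3 * (1 / p) + 3 * |τ| ^ 2 * ((p : ℝ) ^ 2)⁻¹ :=
    fun p hp => by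
      refine (norm_factor_sub_exp_le ((hx p).trans hτ) (hP p hp).two_le).trans ?_
      have := hx p
      gcongr
  refine (Finset.sum_le_sum h1).trans ?_
  rw [Finset.sum_add_distrib, ← Finset.mul_sum, ← Finset.mul_sum]
  have h2 : ∑ p ∈ P, ((p : ℝ) ^ 2)⁻¹ ≤ 2 := by
    have hsub : P ⊆ Finset.Ioo 0 (P.sup id + 1) := fun p hp => Finset.mem_Ioo.2
      ⟨(hP p hp).pos, Nat.lt_succ_of_le (Finset.le_sup (f := id) hp)⟩
    have := (Finset.sum_le_sum_of_subset_of_nonneg hsub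
      (f := fun q : ℕ => ((q : ℝ) ^ 2)⁻¹) fun _ _ _ => by positivity).trans
      (sum_Ioo_inv_sq_le 0 _)
    simpa using this
  nlinarith [sq_nonneg |τ|]

lemma exp_addFun (P : Finset ℕ) (h : ℕ → ℝ) (τ : ℝ) (m : ℕ) :
    Complex.exp ((τ * addFun P h m : ℝ) * Complex.I) =
      ∏ p ∈ P, (1 + if p ∣ m then (Complex.exp ((τ * h p : ℝ) * Complex.I) - 1) else 0) := by
  rw [addFun, Finset.mul_sum, Complex.ofReal_sum, Finset.sum_mul, Complex.exp_sum]
  refine Finset.prod_congr rfl fun p _ => ?_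
  unfold dvdInd
  split_ifs <;> simp

lemma abs_av_cos_sub_le {n y k : ℕ} (hn : 1 ≤ n) (hy : 1 ≤ y) {P : Finset ℕ}
    (hP : ∀ p ∈ P, p.Prime) (hPy : ∀ p ∈ P, p ≤ y) {h : ℕ → ℝ} (hh : ∀ p, |h p| ≤ 1) {τ : ℝ}
    (hτ : |τ| ≤ 1) :
    |av n (fun m => Real.cos (τ * addFun P h m)) - Real.cos (τ * ∑ p ∈ P, h p / p) *
        Real.exp (-(τ ^ 2 * (∑ p ∈ P, h p ^ 2 / p) / 2))| ≤
      ((y : ℝ) ^ k / n + Real.exp (-k)) * Real.exp (Real.exp 1 * |τ| * ∑ p ∈ P, (1 / p : ℝ)) +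
        (|τ| ^ 3 * ∑ p ∈ P, (1 / p : ℝ) + 6 * |τ| ^ 2) := by
  have h1 := norm_avg_prod_sub_le (k := k) hn hy hP hPy
    (g := fun p => Complex.exp ((τ * h p : ℝ) * Complex.I) - 1) (abs_nonneg τ) fun p =>
      (norm_exp_mul_I_sub_one_le _).trans (by
        rw [abs_mul]; exact mul_le_of_le_one_right (abs_nonneg _) (hh p))
  have h2 := norm_prod_factor_sub_exp_le hP hh hτ
  simp only [← exp_addFun] at h1
  have h3 := (norm_sub_le_norm_sub_add_norm_sub _ _ _).trans (add_le_add h1 h2)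
  refine le_trans (le_trans (le_of_eq ?_) (Complex.abs_re_le_norm _)) h3
  congr 1
  rw [Complex.sub_re, ← Complex.ofReal_natCast n, Complex.div_ofReal_re, Complex.re_sum,
    Complex.exp_re]
  simp only [Complex.exp_ofReal_mul_I_re, Complex.sub_re, Complex.sub_im, Complex.re_ofReal_mul,
    Complex.im_ofReal_mul, Complex.I_re, Complex.I_im, Complex.ofReal_re, Complex.ofReal_im,
    mul_zero, mul_one, zero_sub, sub_zero]
  rw [av, mul_comm (Real.cos _)]

end InvFactor

namespace InvFactor
open Asymptotics Topology
open scoped NNReal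

lemma sqLL_sq {n : ℕ} (h : 0 ≤ LL n) : sqLL n ^ 2 = LL n := Real.sq_sqrt h

lemma eventually_recipSum_one_le_mul : ∀ᶠ n in atTop, recipSum 1 (yTr n) ≤ 2 * LL n := by
  filter_upwards [eventually_recipSum_one_le] with n hn
  linarith

lemma tendsto_charFun_error (t : ℝ) : Tendsto (fun n : ℕ =>
    ((yTr n : ℝ) ^ ⌊LL n / 2⌋₊ / n + Real.exp (-(⌊LL n / 2⌋₊ : ℝ))) *
        Real.exp (Real.exp 1 * |t / sqLL n| * recipSum 1 (yTr n)) +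
      (|t / sqLL n| ^ 3 * recipSum 1 (yTr n) + 6 * |t / sqLL n| ^ 2)) atTop (𝓝 0) := by
  have hτ : Tendsto (fun n => t / sqLL n) atTop (𝓝 0) := tendsto_sqLL.const_div_atTop t
  have hτa : Tendsto (fun n => |t / sqLL n|) atTop (𝓝 0) := by simpa using hτ.abs
  have h1 : Tendsto (fun n : ℕ => 4 * Real.exp (-(LL n / 5))) atTop (𝓝 0) := by
    have := Real.tendsto_exp_neg_atTop_nhds_zero.comp (tendsto_LL.atTop_div_const (by norm_num : (0:ℝ) < 5))
    simpa using this.const_mul 4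
  have h2 : Tendsto (fun n : ℕ => 2 * |t| ^ 2 * |t / sqLL n|) atTop (𝓝 0) := by
    have := hτa.const_mul (2 * |t| ^ 2)
    rw [mul_zero] at this
    exact this
  have h3 : Tendsto (fun n : ℕ => 6 * |t / sqLL n| ^ 2) atTop (𝓝 0) := by
    simpa using (hτa.pow 2).const_mul 6
  have h4 := h1.add (h2.add h3)
  rw [add_zero, add_zero] at h4
  refine squeeze_zero' (Eventually.of_forall fun n => ?_) ?_ h4
  · have := recipSum_nonneg 1 (yTr n)
    positivity
  filter_upwards [hτa.eventually_lt_const (by norm_num : (0 : ℝ) < 1 / 20), eventually_yTr_pow_le,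
    eventually_recipSum_one_le_mul, tendsto_LL.eventually_ge_atTop 1, eventually_ge_atTop 3]
    with n a1 a2 a3 a4 a5
  have b0 := recipSum_nonneg 1 (yTr n)
  have b1 : LL n ≤ Real.log n := Real.log_le_self (Real.log_natCast_nonneg n)
  have b2 : Real.exp (-(⌊LL n / 2⌋₊ : ℝ)) ≤ 3 * Real.exp (-(LL n / 2)) := by
    have : LL n / 2 < ⌊LL n / 2⌋₊ + 1 := Nat.lt_floor_add_one _
    calc Real.exp (-(⌊LL n / 2⌋₊ : ℝ)) ≤ Real.exp (1 + -(LL n / 2)) := by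
          rw [Real.exp_le_exp]; linarith
      _ = Real.exp 1 * Real.exp (-(LL n / 2)) := Real.exp_add _ _
      _ ≤ _ := by gcongr; linarith [Real.exp_one_lt_d9]
  have b3 : (yTr n : ℝ) ^ ⌊LL n / 2⌋₊ / n ≤ Real.exp (-(LL n / 2)) :=
    a2.trans (Real.exp_le_exp.2 (by linarith))
  have b4 : Real.exp 1 * |t / sqLL n| * recipSum 1 (yTr n) ≤ 3 / 10 * LL n := by
    calc Real.exp 1 * |t / sqLL n| * recipSum 1 (yTr n) ≤ 3 * (1 / 20) * (2 * LL n) := by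
          gcongr
          linarith [Real.exp_one_lt_d9]
      _ = _ := by ring
  refine add_le_add ?_ (add_le_add ?_ le_rfl)
  · calc _ ≤ (Real.exp (-(LL n / 2)) + 3 * Real.exp (-(LL n / 2))) * Real.exp (3 / 10 * LL n) := by
          gcongr
      _ = 4 * (Real.exp (-(LL n / 2)) * Real.exp (3 / 10 * LL n)) := by ring
      _ = 4 * Real.exp (-(LL n / 5)) := by rw [← Real.exp_add]; ring_nf
  · have hs : 0 < sqLL n := Real.sqrt_pos.2 (by linarith)
    calc |t / sqLL n| ^ 3 * recipSum 1 (yTr n) ≤ |t / sqLL n| ^ 3 * (2 * LL n) := by gcongr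
      _ = 2 * |t| ^ 2 * |t / sqLL n| := by
          rw [← sqLL_sq (by linarith : 0 ≤ LL n), abs_div, abs_of_pos hs]
          field_simp

/-- The asymptotic variance of `ω_b - ω_c`, per unit of `log log n`. -/
def varConst (b c : ℕ) : ℝ :=
  1 / (b.totient : ℝ) + 1 / c.totient - 2 / ((b.totient : ℝ) * c.totient)

lemma ind_mul_ind {b c : ℕ} (hbc : b.Coprime c) {p : ℕ} (hp : 1 ≤ p) :
    ind b p * ind c p = ind (b * c) p := by
  have : ((p : ZMod (b * c)) = 1) ↔ (p : ZMod b) = 1 ∧ (p : ZMod c) = 1 := by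
    have key : ∀ q : ℕ, ((p : ZMod q) = 1) ↔ q ∣ p - 1 := fun q => by
      rw [← Nat.modEq_iff_dvd' hp, ← ZMod.natCast_eq_natCast_iff, Nat.cast_one, eq_comm]
    rw [key, key, key]
    exact ⟨fun h => ⟨dvd_of_mul_right_dvd h, dvd_of_mul_left_dvd h⟩,
      fun h => hbc.mul_dvd_of_dvd_of_dvd h.1 h.2⟩
  unfold ind
  split_ifs <;> simp_all

lemma tendsto_variance {b c : ℕ} (hb : 0 < b) (hc : 0 < c) (hbc : b.Coprime c) :
    Tendsto (fun n => (∑ p ∈ primesOne 1 (yTr n), (ind b p - ind c p) ^ 2 / p) / LL n) atTop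
      (𝓝 (varConst b c)) := by
  have e1 : ∀ N, ∑ p ∈ primesOne 1 N, (ind b p - ind c p) ^ 2 / p =
      recipSum b N + recipSum c N - 2 * recipSum (b * c) N := fun N => by
    rw [← sum_ind_div b, ← sum_ind_div c, ← sum_ind_div (b * c), Finset.mul_sum,
      ← Finset.sum_add_distrib, ← Finset.sum_sub_distrib]
    refine Finset.sum_congr rfl fun p hp => ?_
    have hp := (prime_of_mem_primesOne hp).one_le
    have hsq : ∀ q, ind q p ^ 2 = ind q p := fun q => by unfold ind; split_ifs <;> simp
    rw [← ind_mul_ind hbc hp, sub_sq, hsq, hsq]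
    ring
  have key : ∀ q : ℕ, 0 < q →
      Tendsto (fun n => recipSum q (yTr n) / LL n) atTop (𝓝 (1 / q.totient)) := fun q hq => by
    have h1 := ((exists_recipSum_yTr q hq).trans sqLL_isLittleO_LL).tendsto_div_nhds_zero
    have h2 := h1.add_const (1 / (q.totient : ℝ))
    rw [zero_add] at h2
    refine h2.congr' ?_
    filter_upwards [tendsto_LL.eventually_gt_atTop 0] with n hn
    field_simp
    ring
  have h3 := ((key b hb).add (key c hc)).sub ((key (b * c) (Nat.mul_pos hb hc)).const_mul 2)
  have h4 : varConst b c = 1 / (b.totient : ℝ) + 1 / c.totient - 2 * (1 / ((b * c).totient : ℝ)) := by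
    rw [Nat.totient_mul hbc, varConst]
    push_cast
    ring
  rw [h4]
  refine h3.congr fun n => ?_
  rw [e1]
  ring

lemma tendsto_mean {b c : ℕ} (hb : 0 < b) (hc : 0 < c) (hφ : b.totient = c.totient) :
    Tendsto (fun n => (∑ p ∈ primesOne 1 (yTr n), (ind b p - ind c p) / p) / sqLL n) atTop
      (𝓝 0) := by
  have h1 := ((exists_recipSum_yTr b hb).sub (exists_recipSum_yTr c hc)).tendsto_div_nhds_zero
  refine h1.congr fun n => ?_
  rw [sum_ind_sub_div, hφ]
  ring

/-- The first absolute moment of `ω_b - ω_c`, from the central limit theorem. -/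
lemma tendsto_av_abs_om_sub {b c : ℕ} (hb : 0 < b) (hc : 0 < c) (hbc : b.Coprime c)
    (hφ : b.totient = c.totient) (hv : 0 < varConst b c) :
    Tendsto (fun n => av n (fun m => |om b m - om c m|) / sqLL n) atTop
      (𝓝 (2 * varConst b c / Real.sqrt (2 * Real.pi * varConst b c))) := by
  set h : ℕ → ℝ := fun p => ind b p - ind c p with hdef
  have hh : ∀ p, |h p| ≤ 1 := abs_ind_sub_le_one b c
  set v : ℝ≥0 := ⟨varConst b c, hv.le⟩ with hvdef
  have hv0 : v ≠ 0 := fun h => hv.ne' (congrArg NNReal.toReal h)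
  have hvc : (v : ℝ) = varConst b c := rfl
  have hM := tendsto_mean hb hc hφ
  have hW := tendsto_variance hb hc hbc
  have htrunc : Tendsto (fun n => av n (fun m => |addFun (primesOne 1 (yTr n)) h m / sqLL n|)) atTop
      (𝓝 (2 * varConst b c / Real.sqrt (2 * Real.pi * varConst b c))) := by
    rw [← hvc]
    refine tendsto_av_abs hv0 (V := 6) ?_ fun t => ?_
    · have hM1 := (by simpa using hM.pow 2 : Tendsto _ _ (𝓝 (0 : ℝ))).eventually_lt_const one_pos
      filter_upwards [eventually_av_sq_le hh, tendsto_LL.eventually_ge_atTop 1, hM1,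
        eventually_ge_atTop 1] with n a1 a2 a3 hn
      set M := ∑ p ∈ primesOne 1 (yTr n), h p / p
      set f := addFun (primesOne 1 (yTr n)) h
      have hL : 0 < LL n := by linarith
      have a4 : M ^ 2 ≤ LL n := by
        rw [← sqLL_sq hL.le]
        have hs : 0 < sqLL n ^ 2 := by rw [sqLL_sq hL.le]; exact hL
        have : M ^ 2 / sqLL n ^ 2 < 1 := by simpa [div_pow] using a3
        exact ((div_lt_one hs).1 this).le
      have a5 : av n (fun m => (f m / sqLL n) ^ 2) ≤
          av n (fun m => (LL n)⁻¹ * (2 * (f m - M) ^ 2 + 2 * M ^ 2)) := by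
        refine av_mono fun m _ _ => ?_
        rw [div_pow, sqLL_sq hL.le, div_eq_inv_mul]
        gcongr
        nlinarith [sq_nonneg (f m - 2 * M)]
      refine a5.trans ?_
      rw [av_const_mul, av_add, av_const_mul, av_const hn, inv_mul_le_iff₀ hL]
      linarith
    · have hτ : Tendsto (fun n => t / sqLL n) atTop (𝓝 0) := tendsto_sqLL.const_div_atTop t
      have hτ1 : ∀ᶠ n in atTop, |t / sqLL n| ≤ 1 := by
        have : Tendsto (fun n => |t / sqLL n|) atTop (𝓝 0) := by simpa using hτ.abs
        exact (this.eventually_lt_const one_pos).mono fun _ h => h.le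
      have hmain : Tendsto (fun n => Real.cos (t / sqLL n * ∑ p ∈ primesOne 1 (yTr n), h p / p) *
          Real.exp (-((t / sqLL n) ^ 2 * (∑ p ∈ primesOne 1 (yTr n), h p ^ 2 / p) / 2))) atTop
          (𝓝 (Real.exp (-(v * t ^ 2 / 2)))) := by
        have c1 : Tendsto (fun n => t / sqLL n * ∑ p ∈ primesOne 1 (yTr n), h p / p) atTop (𝓝 0) := by
          have := hM.const_mul t
          rw [mul_zero] at this
          exact this.congr fun n => by ring
        have c2 : Tendsto (fun n => -((t / sqLL n) ^ 2 *
            (∑ p ∈ primesOne 1 (yTr n), h p ^ 2 / p) / 2)) atTop (𝓝 (-(v * t ^ 2 / 2))) := by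
          have := (hW.const_mul (t ^ 2 / 2)).neg
          rw [hvc]
          convert this.congr' ?_ using 2
          · ring
          · filter_upwards [tendsto_LL.eventually_ge_atTop 0] with n hn
            rw [div_pow, sqLL_sq hn]
            ring
        have := ((Real.continuous_cos.tendsto 0).comp c1).mul ((Real.continuous_exp.tendsto _).comp c2)
        rw [Real.cos_zero, one_mul] at this
        exact this
      have herr : Tendsto (fun n => av n (fun m => Real.cos (t * (addFun (primesOne 1 (yTr n)) h m /
          sqLL n))) - Real.cos (t / sqLL n * ∑ p ∈ primesOne 1 (yTr n), h p / p) *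
          Real.exp (-((t / sqLL n) ^ 2 * (∑ p ∈ primesOne 1 (yTr n), h p ^ 2 / p) / 2))) atTop
          (𝓝 0) := by
        refine squeeze_zero_norm' ?_ (tendsto_charFun_error t)
        filter_upwards [hτ1, eventually_ge_atTop 1, tendsto_yTr.eventually_ge_atTop 1]
          with n d1 d2 d3
        have := abs_av_cos_sub_le (k := ⌊LL n / 2⌋₊) d2 d3 (P := primesOne 1 (yTr n))
          (fun p => prime_of_mem_primesOne) (fun p hp => (mem_primesOne.1 hp).1) hh d1
        have e (m : ℕ) : t * (addFun (primesOne 1 (yTr n)) h m / sqLL n) =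
            t / sqLL n * addFun (primesOne 1 (yTr n)) h m := by ring
        rw [Real.norm_eq_abs]
        simp only [e]
        exact this
      simpa using herr.add hmain
  have hfull : Tendsto (fun n => av n (fun m => |fullAdd h m -
      addFun (primesOne 1 (yTr n)) h m|) / sqLL n) atTop (𝓝 0) :=
    (isLittleO_av_abs_fullAdd_sub hh).tendsto_div_nhds_zero
  have hdiff : Tendsto (fun n => av n (fun m => |om b m - om c m|) / sqLL n -
      av n (fun m => |addFun (primesOne 1 (yTr n)) h m / sqLL n|)) atTop (𝓝 0) := by
    refine squeeze_zero_norm' ?_ hfull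
    filter_upwards [tendsto_LL.eventually_gt_atTop 0] with n hn
    have hs : 0 < sqLL n := Real.sqrt_pos.2 hn
    have e2 : av n (fun m => |addFun (primesOne 1 (yTr n)) h m / sqLL n|) =
        av n (fun m => |addFun (primesOne 1 (yTr n)) h m|) / sqLL n := by
      rw [div_eq_inv_mul _ (sqLL n), ← av_const_mul]
      refine congrArg _ (funext fun m => ?_)
      rw [abs_div, abs_of_pos hs, div_eq_inv_mul]
    rw [e2, ← sub_div, norm_div, Real.norm_of_nonneg hs.le, Real.norm_eq_abs]
    gcongr
    refine abs_av_sub_le.trans (av_mono fun m _ _ => ?_)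
    rw [om, om, ← fullAdd_sub]
    exact abs_abs_sub_abs_le _ _
  simpa using hdiff.add htrunc

/-- The number of solutions of `x ^ k = 1` in `G`. -/
def tor (G : Type*) [CommGroup G] (k : ℕ) : ℕ := Nat.card (powMonoidHom k : G →* G).ker

section tor
variable {G H : Type*} [CommGroup G] [CommGroup H]

lemma tor_congr (e : G ≃* H) (k : ℕ) : tor G k = tor H k :=
  Nat.card_congr (e.toEquiv.subtypeEquiv fun x => by
    simp only [MonoidHom.mem_ker, powMonoidHom_apply]
    exact (map_pow e x k ▸ (EmbeddingLike.map_eq_one_iff (f := e)).symm))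

lemma tor_pi {ι : Type*} [Fintype ι] (G : ι → Type*) [∀ i, CommGroup (G i)] (k : ℕ) :
    tor (∀ i, G i) k = ∏ i, tor (G i) k := by
  unfold tor
  rw [← Nat.card_pi]
  refine Nat.card_congr ⟨fun x i => ⟨x.1 i, congrFun x.2 i⟩, fun y => ⟨fun i => (y i).1, ?_⟩,
    fun _ => rfl, fun _ => rfl⟩
  exact funext fun i => (y i).2

lemma tor_pos [Finite G] (k : ℕ) : 0 < tor G k := Nat.card_pos

lemma tor_le_tor [Finite G] {k l : ℕ} (h : k ∣ l) : tor G k ≤ tor G l := by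
  obtain ⟨c, rfl⟩ := h
  refine Subgroup.card_le_of_le fun x hx => ?_
  rw [MonoidHom.mem_ker, powMonoidHom_apply] at hx ⊢
  rw [pow_mul, hx, one_pow]

lemma tor_mul_le [Finite G] (k l : ℕ) : tor G (k * l) ≤ tor G k * tor G l := by
  set f := (powMonoidHom l : G →* G).comp (powMonoidHom (k * l) : G →* G).ker.subtype with hf
  have h1 : tor G (k * l) = Nat.card f.ker * Nat.card f.range := by
    rw [← Subgroup.index_ker, Subgroup.card_mul_index]; rfl
  have h2 : Nat.card f.range ≤ tor G k := by
    refine Subgroup.card_le_of_le ?_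
    rintro _ ⟨⟨x, hx⟩, rfl⟩
    rw [MonoidHom.mem_ker, powMonoidHom_apply] at hx ⊢
    rw [hf, MonoidHom.comp_apply, Subgroup.subtype_apply, powMonoidHom_apply, ← pow_mul,
      mul_comm l, hx]
  have h3 : Nat.card f.ker ≤ tor G l := by
    refine Nat.card_le_card_of_injective (fun x => ⟨x.1.1, x.2⟩) fun x y h => ?_
    exact Subtype.ext (Subtype.ext (Subtype.mk.inj h))
  rw [h1, mul_comm]
  exact Nat.mul_le_mul h2 h3

lemma tor_eq_one [Finite G] {k : ℕ} (h : (Nat.card G).Coprime k) : tor G k = 1 := by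
  have : (powMonoidHom k : G →* G).ker = ⊥ := (MonoidHom.ker_eq_bot_iff _).2 (powCoprime h).injective
  rw [tor, this, Subgroup.card_bot]

lemma tor_le_card_mul_index [Finite G] (K : Subgroup G) [IsCyclic K] {k : ℕ} (hk : 0 < k) :
    tor G k ≤ k * K.index := by
  set T := (powMonoidHom k : G →* G).ker
  have h1 : Nat.card (K.subgroupOf T) * (K.subgroupOf T).index = Nat.card T :=
    Subgroup.card_mul_index _
  have h2 : (K.subgroupOf T).index ≤ K.index :=
    Nat.le_of_dvd (Nat.pos_of_ne_zero Subgroup.index_ne_zero_of_finite)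
      (Subgroup.relIndex_dvd_index_of_normal K T)
  have h3 : Nat.card (K.subgroupOf T) ≤ k := by
    have : tor K k ≤ k := by
      rw [tor, IsCyclic.card_powMonoidHom_ker]
      exact Nat.gcd_le_right _ hk
    refine le_trans (Nat.card_le_card_of_injective
      (fun x : K.subgroupOf T => (⟨⟨x.1.1, x.2⟩, Subtype.ext x.1.2⟩ :
        (powMonoidHom k : K →* K).ker)) fun x y h => ?_) this
    exact Subtype.ext (Subtype.ext (congrArg (fun z => z.1.1) h))
  rw [tor, ← h1]
  exact Nat.mul_le_mul h3 h2

end tor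

lemma tor_units_two_pow_le (v : ℕ) : tor (ZMod (2 ^ v))ˣ 2 ≤ 4 := by
  rcases lt_or_ge v 2 with hv | hv
  · refine (Nat.card_le_card_of_injective _ Subtype.val_injective).trans ?_
    rw [Nat.card_eq_fintype_card, ZMod.card_units_eq_totient]
    interval_cases v <;> decide
  · obtain ⟨n, rfl⟩ := Nat.exists_eq_add_of_le' hv
    have h5 : IsUnit (5 : ZMod (2 ^ (n + 2))) := by
      have := (ZMod.isUnit_iff_coprime 5 (2 ^ (n + 2))).2 (Nat.Coprime.pow_right _ (by norm_num))
      exact_mod_cast this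
    have ho : Nat.card (Subgroup.zpowers h5.unit) = 2 ^ n := by
      rw [Nat.card_zpowers, ← orderOf_units, h5.unit_spec, ZMod.orderOf_five]
    have hi : (Subgroup.zpowers h5.unit).index = 2 := by
      have := (Subgroup.zpowers h5.unit).card_mul_index
      rw [ho, Nat.card_eq_fintype_card, ZMod.card_units_eq_totient,
        Nat.totient_prime_pow Nat.prime_two (by omega)] at this
      have e : 2 ^ (n + 2 - 1) * (2 - 1) = 2 ^ n * 2 := by
        rw [show n + 2 - 1 = n + 1 by omega, show 2 - 1 = 1 from rfl, mul_one, pow_succ]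
      exact Nat.eq_of_mul_eq_mul_left (by positivity) (this.trans e)
    have := tor_le_card_mul_index (Subgroup.zpowers h5.unit) two_pos
    rwa [hi] at this

lemma tor_multiplicative_zmod {n : ℕ} (hn : n ≠ 0) (k : ℕ) :
    tor (Multiplicative (ZMod n)) k = n.gcd k := by
  have : NeZero n := ⟨hn⟩
  have : Finite (Multiplicative (ZMod n)) := inferInstanceAs (Finite (ZMod n))
  rw [tor, IsCyclic.card_powMonoidHom_ker]
  congr 1
  exact (Nat.card_congr Multiplicative.toAdd).trans (Nat.card_zmod n)

lemma gcd_prime_pow_succ {p : ℕ} (hp : p.Prime) (n k : ℕ) :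
    n.gcd (p ^ (k + 1)) = p ^ (if p ^ (k + 1) ∣ n then 1 else 0) * n.gcd (p ^ k) := by
  split_ifs with h
  · rw [Nat.gcd_eq_right h, Nat.gcd_eq_right ((pow_dvd_pow p k.le_succ).trans h), pow_succ']
    simp
  · obtain ⟨j, hj, hg⟩ := (Nat.dvd_prime_pow hp).1 (Nat.gcd_dvd_right n (p ^ (k + 1)))
    have hj' : j ≤ k := by
      by_contra! hjk
      exact h (by rw [show k + 1 = j by omega, ← hg]; exact Nat.gcd_dvd_left _ _)
    rw [pow_zero, one_mul]
    refine Nat.dvd_antisymm (Nat.dvd_gcd (Nat.gcd_dvd_left _ _) (hg ▸ pow_dvd_pow p hj'))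
      (Nat.gcd_dvd_gcd_of_dvd_right _ (pow_dvd_pow p k.le_succ))

lemma natCast_eq_one_iff {q r : ℕ} (hr : 1 ≤ r) : (r : ZMod q) = 1 ↔ q ∣ r - 1 := by
  rw [← Nat.modEq_iff_dvd' hr, ← ZMod.natCast_eq_natCast_iff, Nat.cast_one, eq_comm]

lemma tor_units_odd {r v : ℕ} (hr : r.Prime) (hr2 : r ≠ 2) (hv : v ≠ 0) (k : ℕ) :
    tor (ZMod (r ^ v))ˣ k = (r ^ (v - 1) * (r - 1)).gcd k := by
  have : NeZero (r ^ v) := ⟨pow_ne_zero _ hr.ne_zero⟩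
  have := ZMod.isCyclic_units_of_prime_pow r hr hr2 v
  rw [tor, IsCyclic.card_powMonoidHom_ker, Nat.card_eq_fintype_card, ZMod.card_units_eq_totient,
    Nat.totient_prime_pow hr (Nat.pos_of_ne_zero hv)]

lemma le_tor_units_prime_pow {p r v : ℕ} (hp : p.Prime) (hr : r.Prime) (hv : v ≠ 0) (k : ℕ) :
    p ^ (if (r : ZMod (p ^ (k + 1))) = 1 then 1 else 0) * tor (ZMod (r ^ v))ˣ (p ^ k) ≤
      tor (ZMod (r ^ v))ˣ (p ^ (k + 1)) := by
  have : NeZero (r ^ v) := ⟨pow_ne_zero _ hr.ne_zero⟩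
  split_ifs with h
  · rw [natCast_eq_one_iff hr.one_le] at h
    have hr2 : r ≠ 2 := by
      rintro rfl
      have := Nat.le_of_dvd one_pos h
      exact absurd this (not_le.2 (Nat.one_lt_pow (by omega) hp.one_lt))
    rw [tor_units_odd hr hr2 hv, tor_units_odd hr hr2 hv, gcd_prime_pow_succ hp _ k,
      if_pos (h.mul_left _)]
  · rw [pow_zero, one_mul]
    exact tor_le_tor (pow_dvd_pow p k.le_succ)

lemma tor_units_prime_pow_le {p r v : ℕ} (hp : p.Prime) (hr : r.Prime) (hv : v ≠ 0) (k : ℕ) :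
    tor (ZMod (r ^ v))ˣ (p ^ (k + 1)) ≤
      p ^ ((if (r : ZMod (p ^ (k + 1))) = 1 then 1 else 0) + if r = p then 2 else 0) *
        tor (ZMod (r ^ v))ˣ (p ^ k) := by
  have : NeZero (r ^ v) := ⟨pow_ne_zero _ hr.ne_zero⟩
  by_cases hr2 : r = 2
  · subst hr2
    have h1 : tor (ZMod (2 ^ v))ˣ p ≤ p ^ (if 2 = p then 2 else 0) := by
      split_ifs with h
      · subst h
        exact tor_units_two_pow_le v
      · refine (tor_eq_one ?_).le
        rw [Nat.card_eq_fintype_card, ZMod.card_units_eq_totient,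
          Nat.totient_prime_pow hr (Nat.pos_of_ne_zero hv), show 2 - 1 = 1 from rfl, mul_one]
        exact Nat.Coprime.pow_left _ ((Nat.coprime_primes hr hp).2 h)
    rw [pow_succ']
    refine (tor_mul_le _ _).trans (Nat.mul_le_mul_right _ (h1.trans ?_))
    exact Nat.pow_le_pow_right hp.pos (Nat.le_add_left _ _)
  · rw [tor_units_odd hr hr2 hv, tor_units_odd hr hr2 hv, gcd_prime_pow_succ hp _ k]
    refine Nat.mul_le_mul_right _ (Nat.pow_le_pow_right hp.pos ?_)
    by_cases hrp : r = p
    · rw [if_pos hrp]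
      split_ifs <;> omega
    · rw [if_neg hrp]
      have hc : (p ^ (k + 1)).Coprime (r ^ (v - 1)) :=
        Nat.Coprime.pow _ _ ((Nat.coprime_primes hp hr).2 (Ne.symm hrp))
      simp only [natCast_eq_one_iff hr.one_le, hc.dvd_mul_left, add_zero, le_refl]

lemma tor_units {m : ℕ} (hm : m ≠ 0) (k : ℕ) :
    tor (ZMod m)ˣ k = ∏ r ∈ m.primeFactors, tor (ZMod (r ^ m.factorization r))ˣ k := by
  rw [tor_congr ((Units.mapEquiv (ZMod.equivPi m hm).toMulEquiv).trans MulEquiv.piUnits), tor_pi,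
    ← Finset.prod_coe_sort m.primeFactors]

/-- The number of entries of `lam` divisible by `q`. -/
def dvdCount {K : ℕ} (lam : Fin K → ℕ) (q : ℕ) : ℕ := (Finset.univ.filter fun j => q ∣ lam j).card

lemma tor_units_succ {m K : ℕ} {lam : Fin K → ℕ} (hlam : ∀ j, 1 < lam j)
    (e : (ZMod m)ˣ ≃* Multiplicative (∀ j, ZMod (lam j))) {p : ℕ} (hp : p.Prime) (k : ℕ) :
    tor (ZMod m)ˣ (p ^ (k + 1)) = p ^ dvdCount lam (p ^ (k + 1)) * tor (ZMod m)ˣ (p ^ k) := by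
  have h (l : ℕ) : tor (ZMod m)ˣ l = ∏ j, (lam j).gcd l := by
    rw [tor_congr (e.trans (MulEquiv.piMultiplicative _)), tor_pi]
    exact Finset.prod_congr rfl fun j _ => tor_multiplicative_zmod (by have := hlam j; omega) l
  rw [h, h, dvdCount, Finset.card_filter, ← Finset.prod_pow_eq_pow_sum, ← Finset.prod_mul_distrib]
  exact Finset.prod_congr rfl fun j _ => gcd_prime_pow_succ hp _ k

lemma om_eq_card (q m : ℕ) :
    om q m = ((∑ r ∈ m.primeFactors, if (r : ZMod q) = 1 then 1 else 0 : ℕ) : ℝ) := by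
  simp [om, fullAdd, ind]

lemma om_le_dvdCount_le {m K : ℕ} (hm : m ≠ 0) {lam : Fin K → ℕ} (hlam : ∀ j, 1 < lam j)
    (e : (ZMod m)ˣ ≃* Multiplicative (∀ j, ZMod (lam j))) {q : ℕ} (hq : IsPrimePow q) :
    om q m ≤ dvdCount lam q ∧ (dvdCount lam q : ℝ) ≤ om q m + 2 := by
  obtain ⟨p, k, hp, hk, rfl⟩ := (isPrimePow_nat_iff q).1 hq
  obtain ⟨k, rfl⟩ := Nat.exists_eq_succ_of_ne_zero hk.ne'
  have h := tor_units_succ hlam e hp k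
  have : NeZero m := ⟨hm⟩
  have hpos : 0 < tor (ZMod m)ˣ (p ^ k) := tor_pos _
  have hf : ∀ r ∈ m.primeFactors, m.factorization r ≠ 0 := fun r hr =>
    Finsupp.mem_support_iff.1 (Nat.support_factorization m ▸ hr)
  rw [om_eq_card]
  constructor
  · norm_cast
    refine (Nat.pow_le_pow_iff_right hp.one_lt).1 (le_of_mul_le_mul_right (h ▸ ?_) hpos)
    rw [tor_units hm, tor_units hm, ← Finset.prod_pow_eq_pow_sum, ← Finset.prod_mul_distrib]
    exact Finset.prod_le_prod' fun r hr =>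
      le_tor_units_prime_pow hp (Nat.prime_of_mem_primeFactors hr) (hf r hr) k
  · have h2 : ∑ r ∈ m.primeFactors, (if r = p then 2 else 0) ≤ 2 := by
      rw [Finset.sum_ite_eq']
      split_ifs <;> simp
    have h1 : dvdCount lam (p ^ (k + 1)) ≤ ∑ r ∈ m.primeFactors,
        ((if (r : ZMod (p ^ (k + 1))) = 1 then 1 else 0) + if r = p then 2 else 0) := by
      refine (Nat.pow_le_pow_iff_right hp.one_lt).1 (le_of_mul_le_mul_right (h ▸ ?_) hpos)
      rw [tor_units hm, tor_units hm, ← Finset.prod_pow_eq_pow_sum, ← Finset.prod_mul_distrib]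
      exact Finset.prod_le_prod' fun r hr =>
        tor_units_prime_pow_le hp (Nat.prime_of_mem_primeFactors hr) (hf r hr) k
    rw [Finset.sum_add_distrib] at h1
    exact_mod_cast h1.trans (Nat.add_le_add_left h2 _)

/-- Splitting off the first factor of a finite product of rings. -/
def consRingEquiv {K : ℕ} (M : Fin (K + 1) → Type*) [∀ j, CommRing (M j)] :
    (M 0 × ∀ j : Fin K, M j.succ) ≃+* ∀ j, M j :=
  { Fin.consEquiv M with
    map_mul' := fun _ _ => funext fun j => Fin.cases rfl (fun _ => rfl) j
    map_add' := fun _ _ => funext fun j => Fin.cases rfl (fun _ => rfl) j }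

open scoped Function in
lemma exists_antitone_chain (n : ℕ) : ∀ (ι : Type) [Fintype ι], Fintype.card ι = n →
    ∀ p e : ι → ℕ, (∀ i, (p i).Prime) →
    ∃ (K : ℕ) (lam : Fin K → ℕ), (∀ j, 1 < lam j) ∧ (∀ j k, j ≤ k → lam k ∣ lam j) ∧
      (∀ D, (∀ i, p i ^ e i ∣ D) → ∀ j, lam j ∣ D) ∧
      Nonempty ((∀ i, ZMod (p i ^ e i)) ≃+* ∀ j, ZMod (lam j)) := by
  classical
  induction n using Nat.strong_induction_on with
  | _ n ih =>
  intro ι _ hn p e hp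
  by_cases he : ∀ i, e i = 0
  · have h1 : ∀ i, Subsingleton (ZMod (p i ^ e i)) := fun i => by
      rw [he i, pow_zero]
      infer_instance
    exact ⟨0, Fin.elim0, fun j => j.elim0, fun j => j.elim0, fun _ _ j => j.elim0,
      ⟨{ equivOfSubsingletonOfSubsingleton (fun _ => 0) (fun _ => 0) with
        map_mul' := fun _ _ => Subsingleton.elim _ _
        map_add' := fun _ _ => Subsingleton.elim _ _ }⟩⟩
  push Not at he
  obtain ⟨i₀, hi₀⟩ := he
  have hrep : ∀ r : ℕ, ∃ t : ι, ∀ i, p i = r → p t = r ∧ e i ≤ e t := fun r => by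
    by_cases h : ∃ i, p i = r
    · obtain ⟨i, hi⟩ := h
      obtain ⟨t, ht, hmax⟩ := Finset.exists_max_image (Finset.univ.filter fun i => p i = r) e
        ⟨i, by simpa using hi⟩
      simp only [Finset.mem_filter, Finset.mem_univ, true_and] at ht hmax
      exact ⟨t, fun j hj => ⟨ht, hmax j hj⟩⟩
    · exact ⟨i₀, fun i hi => absurd ⟨i, hi⟩ h⟩
  choose t ht using hrep
  set P : ι → Prop := fun i => t (p i) = i with hP
  have hPt (i : ι) : P (t (p i)) := congrArg t (ht (p i) i rfl).1
  have hcop : Pairwise (Nat.Coprime on fun i : {i // P i} => p i ^ e i) := fun i j hij => by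
    refine Nat.Coprime.pow _ _ ((Nat.coprime_primes (hp _) (hp _)).2 fun h => hij ?_)
    exact Subtype.ext (i.2.symm.trans ((congrArg t h).trans j.2))
  set L := ∏ i : {i // P i}, p i ^ e i with hL
  have hdvd (i : ι) : p i ^ e i ∣ L := by
    have h1 := ht (p i) i rfl
    have h2 := Finset.dvd_prod_of_mem (fun j : {i // P i} => p j ^ e j)
      (Finset.mem_univ ⟨t (p i), hPt i⟩)
    refine dvd_trans ?_ h2
    simp only [h1.1]
    exact pow_dvd_pow _ h1.2
  have hLD (D : ℕ) (hD : ∀ i, p i ^ e i ∣ D) : L ∣ D :=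
    Finset.prod_dvd_of_isRelPrime
      (fun i _ j _ hij => Nat.coprime_iff_isRelPrime.1 (hcop hij)) fun i _ => hD i
  have hL0 : 0 < L := Finset.prod_pos fun i _ => pow_pos (hp i).pos _
  have hL1 : 1 < L := lt_of_lt_of_le (Nat.one_lt_pow hi₀ (hp i₀).one_lt)
    (Nat.le_of_dvd hL0 (hdvd i₀))
  have hcard : Fintype.card {i // ¬P i} < n := hn ▸ Fintype.card_subtype_lt
    (not_not.2 (hPt i₀))
  obtain ⟨K, lam, h1, h2, h3, ⟨f⟩⟩ := ih _ hcard {i // ¬P i} rfl (fun i => p i) (fun i => e i)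
    fun i => hp i
  refine ⟨K + 1, Fin.cons L lam, ?_, ?_, ?_, ?_⟩
  · exact Fin.cases hL1 h1
  · intro j k
    refine Fin.cases (fun _ => ?_) (fun j => ?_) j
    · exact Fin.cases dvd_rfl (h3 L fun i => hdvd i) k
    · exact Fin.cases (fun h => absurd h (by simp)) (fun k hjk =>
        h2 j k (Fin.succ_le_succ_iff.1 hjk)) k
  · exact fun D hD => Fin.cases (hLD D hD) (h3 D fun i => hD i)
  · exact ⟨((RingEquiv.piEquivPiSubtypeProd P _).trans
      (RingEquiv.prodCongr (ZMod.prodEquivPi _ hcop).symm f)).trans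
      (consRingEquiv fun j => ZMod ((Fin.cons L lam : Fin (K + 1) → ℕ) j))⟩

/-- Existence of the invariant factor decomposition. -/
lemma exists_invariant_factors (G : Type*) [CommGroup G] [Finite G] :
    ∃ (K : ℕ) (lam : Fin K → ℕ), (∀ j, 1 < lam j) ∧ (∀ j k, j ≤ k → lam j ∣ lam k) ∧
      Nonempty (G ≃* Multiplicative (∀ j, ZMod (lam j))) := by
  obtain ⟨ι, _, p, hp, e, ⟨f⟩⟩ := AddCommGroup.equiv_directSum_zmod_of_finite (Additive G)
  obtain ⟨K, lam, h1, h2, -, ⟨g⟩⟩ := exists_antitone_chain _ ι rfl p e hp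
  refine ⟨K, fun j => lam (Fin.rev j), fun j => h1 _, fun j k h => h2 _ _ (Fin.rev_le_rev.2 h),
    ⟨AddEquiv.toMultiplicativeRight ?_⟩⟩
  exact f.trans ((DirectSum.addEquivProd _).trans (g.toAddEquiv.trans
    (RingEquiv.piCongrLeft' (fun j => ZMod (lam j)) Fin.revPerm).toAddEquiv))

section chain
variable {K : ℕ} {lam : Fin K → ℕ}

lemma card_dvd_not_dvd_le (hch : ∀ j k, j ≤ k → lam j ∣ lam k) (q r : ℕ) :
    (Finset.univ.filter fun j => q ∣ lam j ∧ ¬r ∣ lam j).card ≤ dvdCount lam q - dvdCount lam r := by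
  by_cases h : ∀ j, r ∣ lam j → q ∣ lam j
  · rw [Finset.filter_and_not, Finset.card_sdiff_of_subset
      (Finset.monotone_filter_right _ fun j _ => h j)]
    exact le_rfl
  · push Not at h
    obtain ⟨k, hk, hk'⟩ := h
    rw [Finset.card_eq_zero.2 (Finset.filter_eq_empty_iff.2 fun j _ => ?_)]
    · exact Nat.zero_le _
    · rintro ⟨h1, h2⟩
      rcases le_total j k with h | h
      · exact hk' (h1.trans (hch j k h))
      · exact h2 (hk.trans (hch k j h))

lemma card_eq_le (hch : ∀ j k, j ≤ k → lam j ∣ lam k) {d q r : ℕ} (hq : q ∣ d) (hr : ¬r ∣ d) :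
    (Finset.univ.filter fun j => lam j = d).card ≤ dvdCount lam q - dvdCount lam r := by
  refine (Finset.card_le_card ?_).trans (card_dvd_not_dvd_le hch q r)
  refine Finset.monotone_filter_right _ ?_
  rintro j - rfl
  exact ⟨hq, hr⟩

lemma eq_of_forall_prime_pow {d l : ℕ} (h1 : ∀ q, IsPrimePow q → q ∣ d → q ∣ l)
    (h2 : ∀ q, IsPrimePow q → q ∣ l → q ∣ d) : l = d := by
  have aux {x y : ℕ} (h : ∀ q, IsPrimePow q → q ∣ x → q ∣ y) : x ∣ y := by
    refine Nat.dvd_iff_prime_pow_dvd_dvd _ _ |>.2 fun p k hp hk => ?_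
    rcases Nat.eq_zero_or_pos k with rfl | hk0
    · simp
    · exact h _ (hp.isPrimePow.pow hk0.ne') hk
  exact Nat.dvd_antisymm (aux h2) (aux h1)

lemma dvdCount_le (hch : ∀ j k, j ≤ k → lam j ∣ lam k) {d : ℕ} (hd : d ≠ 0) (a : ℕ) :
    dvdCount lam a ≤ (Finset.univ.filter fun j => lam j = d).card +
        ∑ q ∈ d.divisors.filter IsPrimePow, (dvdCount lam a - dvdCount lam q) ∨
      ∃ r, IsPrimePow r ∧ ¬r ∣ d ∧ dvdCount lam a ≤
        (Finset.univ.filter fun j => lam j = d).card +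
          ∑ q ∈ d.divisors.filter IsPrimePow, (dvdCount lam a - dvdCount lam q) +
        dvdCount lam r := by
  classical
  set W := Finset.univ.filter fun j => ∃ r, IsPrimePow r ∧ ¬r ∣ d ∧ r ∣ lam j with hW
  have hsub : (Finset.univ.filter fun j => a ∣ lam j) ⊆ (Finset.univ.filter fun j => lam j = d) ∪
      (d.divisors.filter IsPrimePow).biUnion
        (fun q => Finset.univ.filter fun j => a ∣ lam j ∧ ¬q ∣ lam j) ∪ W := by
    intro j hj
    simp only [Finset.mem_filter, Finset.mem_univ, true_and] at hj
    by_contra hcon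
    simp only [hW, Finset.mem_union, Finset.mem_filter, Finset.mem_univ, true_and,
      Finset.mem_biUnion, Nat.mem_divisors, not_or, not_exists, not_and, not_not] at hcon
    exact hcon.1.1 (eq_of_forall_prime_pow (fun q hq hqd => hcon.1.2 q ⟨⟨hqd, hd⟩, hq⟩ hj)
      fun q hq hql => by_contra fun h => hcon.2 q hq h hql)
  have hcard : dvdCount lam a ≤ (Finset.univ.filter fun j => lam j = d).card +
      ∑ q ∈ d.divisors.filter IsPrimePow, (dvdCount lam a - dvdCount lam q) + W.card := by
    refine (Finset.card_le_card hsub).trans ((Finset.card_union_le _ _).trans ?_)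
    gcongr
    refine (Finset.card_union_le _ _).trans ?_
    gcongr
    exact Finset.card_biUnion_le.trans (Finset.sum_le_sum fun q _ => card_dvd_not_dvd_le hch a q)
  rcases W.eq_empty_or_nonempty with h | h
  · left
    simpa [h] using hcard
  · right
    have hmem := W.min'_mem h
    simp only [hW, Finset.mem_filter, Finset.mem_univ, true_and] at hmem
    obtain ⟨r, hr, hrd, hrj⟩ := hmem
    refine ⟨r, hr, hrd, hcard.trans (Nat.add_le_add_left (Finset.card_le_card fun j hj => ?_) _)⟩
    simp only [Finset.mem_filter, Finset.mem_univ, true_and]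
    exact hrj.trans (hch _ _ (W.min'_le j hj))

end chain

end InvFactor

namespace InvFactor
open Asymptotics Topology

lemma abs_invCount_sub_le {a b c d m : ℕ} (ha : IsPrimePow a) (hb : IsPrimePow b)
    (hc : IsPrimePow c) (hd : d ≠ 0) (had : a ∣ d) (hbd : ¬b ∣ d) (hcd : ¬c ∣ d)
    (hup : ∀ q, IsPrimePow q → ¬q ∣ d → q = b ∨ q = c ∨ b.totient < q.totient)
    {J : ℕ → ℕ} (hJ : IsInvCount d J) (hm : 1 ≤ m) {E : ℝ} (hE0 : 0 ≤ E)
    (hE : ∀ q, IsPrimePow q → b.totient < q.totient → om q m - om b m ≤ E) :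
    |(J m : ℝ) - (om a m - max (om b m) (om c m))| ≤
      ∑ q ∈ (d.divisors.filter IsPrimePow).erase a, max (om a m - om q m) 0 +
        max (om b m - om a m) 0 + max (om c m - om a m) 0 + E +
        (4 + 2 * (d.divisors.filter IsPrimePow).card) := by
  have hm0 : m ≠ 0 := by omega
  have : NeZero m := ⟨hm0⟩
  obtain ⟨K, lam, h1, h2, ⟨e⟩⟩ := exists_invariant_factors (ZMod m)ˣ
  have hJm := hJ m hm K lam h1 h2 ⟨e⟩
  have hN {q : ℕ} (hq : IsPrimePow q) := om_le_dvdCount_le hm0 h1 e hq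
  set D := d.divisors.filter IsPrimePow with hD
  have haD : a ∈ D := Finset.mem_filter.2 ⟨Nat.mem_divisors.2 ⟨had, hd⟩, ha⟩
  have hcast (q r : ℕ) : ((dvdCount lam q - dvdCount lam r : ℕ) : ℝ) ≤
      max ((dvdCount lam q : ℝ) - dvdCount lam r) 0 := by
    rcases le_total (dvdCount lam r) (dvdCount lam q) with h | h
    · rw [Nat.cast_sub h]
      exact le_max_left _ _
    · rw [Nat.sub_eq_zero_of_le h, Nat.cast_zero]
      exact le_max_right _ _
  have hS0 : 0 ≤ ∑ q ∈ D.erase a, max (om a m - om q m) 0 :=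
    Finset.sum_nonneg fun _ _ => le_max_right _ _
  have hupper {r : ℕ} (hr : IsPrimePow r) (hrd : ¬r ∣ d) :
      (J m : ℝ) ≤ om a m - om r m + 2 + max (om r m - om a m) 0 := by
    have h3 : (J m : ℝ) ≤ (dvdCount lam a - dvdCount lam r : ℕ) := by
      rw [hJm]
      exact_mod_cast card_eq_le h2 had hrd
    refine (h3.trans (hcast _ _)).trans (max_le ?_ ?_)
    · linarith [(hN ha).2, (hN hr).1, le_max_right (om r m - om a m) 0]
    · linarith [le_max_left (om r m - om a m) 0]
  have hlower : om a m ≤ J m + ∑ q ∈ D.erase a, max (om a m - om q m) 0 + 2 * D.card +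
      (max (om b m) (om c m) + E + 2) := by
    have hS : ((∑ q ∈ D, (dvdCount lam a - dvdCount lam q) : ℕ) : ℝ) ≤
        ∑ q ∈ D.erase a, max (om a m - om q m) 0 + 2 * D.card := by
      rw [← Finset.add_sum_erase _ _ haD, Nat.sub_self, zero_add, Nat.cast_sum]
      have h4 : ∀ q ∈ D.erase a, ((dvdCount lam a - dvdCount lam q : ℕ) : ℝ) ≤
          max (om a m - om q m) 0 + 2 := fun q hq => by
        have hq' := (Finset.mem_filter.1 (Finset.mem_of_mem_erase hq)).2
        refine (hcast _ _).trans (max_le ?_ ?_)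
        · linarith [(hN ha).2, (hN hq').1, le_max_left (om a m - om q m) 0]
        · linarith [le_max_right (om a m - om q m) 0]
      refine (Finset.sum_le_sum h4).trans ?_
      rw [Finset.sum_add_distrib, Finset.sum_const, nsmul_eq_mul, mul_comm]
      have : ((D.erase a).card : ℝ) ≤ D.card := by
        exact_mod_cast Finset.card_le_card (Finset.erase_subset _ _)
      linarith
    have hb0 := om_nonneg b m
    have hmb := le_max_left (om b m) (om c m)
    have hmc := le_max_right (om b m) (om c m)
    have hNa := (hN ha).1
    rcases dvdCount_le h2 hd a with h | ⟨r, hr, hrd, h⟩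
    · rw [← hJm] at h
      have h : (dvdCount lam a : ℝ) ≤ J m + (∑ q ∈ D, (dvdCount lam a - dvdCount lam q) : ℕ) := by
        exact_mod_cast h
      linarith
    · rw [← hJm] at h
      have h : (dvdCount lam a : ℝ) ≤ J m + (∑ q ∈ D, (dvdCount lam a - dvdCount lam q) : ℕ) +
          dvdCount lam r := by
        exact_mod_cast h
      have hNr := (hN hr).2
      rcases hup r hr hrd with rfl | rfl | hlt
      · linarith
      · linarith
      · linarith [hE r hr hlt]
  have hpb := le_max_right (om b m - om a m) 0
  have hpc := le_max_right (om c m - om a m) 0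
  have hc0 : (0 : ℝ) ≤ D.card := Nat.cast_nonneg _
  refine abs_le.2 ⟨by linarith, ?_⟩
  rcases max_choice (om b m) (om c m) with h | h <;> rw [h]
  · linarith [hupper hb hbd]
  · linarith [hupper hc hcd]

end InvFactor

namespace InvFactor
open Asymptotics Topology

lemma isLittleO_av_invCount_sub {a b c d : ℕ} (ha : IsPrimePow a) (hb : IsPrimePow b)
    (hc : IsPrimePow c) (hd : d ≠ 0) (had : a ∣ d) (hbd : ¬b ∣ d) (hcd : ¬c ∣ d)
    (hab : a.totient < b.totient) (hbc : b.totient = c.totient)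
    (hlow : ∀ q, IsPrimePow q → q ∣ d → q ≠ a → q.totient < a.totient)
    (hup : ∀ q, IsPrimePow q → ¬q ∣ d → q = b ∨ q = c ∨ b.totient < q.totient)
    {J : ℕ → ℕ} (hJ : IsInvCount d J) :
    (fun n => av n (fun m => (J m : ℝ)) - av n (fun m => om a m - max (om b m) (om c m)))
      =o[atTop] sqLL := by
  obtain ⟨E, hE0, hE, hEo⟩ := exists_majorant hb.pos
  set D := d.divisors.filter IsPrimePow
  set C : ℝ := 4 + 2 * D.card
  have h1 : (fun n => ∑ q ∈ D.erase a, av n (fun m => max (om a m - om q m) 0)) =o[atTop] sqLL := by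
    refine IsLittleO.fun_sum (A := fun q n => av n (fun m => max (om a m - om q m) 0)) fun q hq => ?_
    obtain ⟨hqa, hqD⟩ := Finset.mem_erase.1 hq
    obtain ⟨hqd, hqp⟩ := Finset.mem_filter.1 hqD
    exact isLittleO_av_om_sub_pos hqp.pos ha.pos (hlow q hqp (Nat.dvd_of_mem_divisors hqd) hqa)
  have h2 := isLittleO_av_om_sub_pos ha.pos hb.pos hab
  have h3 := isLittleO_av_om_sub_pos ha.pos hc.pos (hbc ▸ hab)
  refine isLittleO_of_le ((((h1.add h2).add h3).add hEo).add (isLittleO_const_sqLL C)) ?_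
  filter_upwards [eventually_ge_atTop 1] with n hn
  rw [← av_sum, ← av_add, ← av_add, ← av_add, ← av_const hn C, ← av_add]
  refine abs_av_sub_le.trans (av_mono fun m hm hmn => ?_)
  exact abs_invCount_sub_le ha hb hc hd had hbd hcd hup hJ hm (hE0 n m)
    fun q hq hbq => hE n m q hm hmn hq hbq

lemma half_mul_div_sqrt {v : ℝ} (hv : 0 < v) :
    2⁻¹ * (2 * v / Real.sqrt (2 * Real.pi * v)) = Real.sqrt v / Real.sqrt (2 * Real.pi) := by
  have h1 : Real.sqrt (2 * Real.pi * v) = Real.sqrt (2 * Real.pi) * Real.sqrt v :=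
    Real.sqrt_mul (by positivity) v
  have h2 : 0 < Real.sqrt v := Real.sqrt_pos.2 hv
  have h3 : 0 < Real.sqrt (2 * Real.pi) := Real.sqrt_pos.2 (by positivity)
  rw [h1]
  field_simp
  rw [Real.sq_sqrt hv.le]

theorem tendsto_avg_invCount {a b c d : ℕ} (ha : IsPrimePow a) (hb : IsPrimePow b)
    (hc : IsPrimePow c) (hd : d ≠ 0) (had : a ∣ d) (hbd : ¬b ∣ d) (hcd : ¬c ∣ d)
    (hab : a.totient < b.totient) (hbc : b.totient = c.totient) (hco : b.Coprime c)
    (hlow : ∀ q, IsPrimePow q → q ∣ d → q ≠ a → q.totient < a.totient)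
    (hup : ∀ q, IsPrimePow q → ¬q ∣ d → q = b ∨ q = c ∨ b.totient < q.totient)
    {J : ℕ → ℕ} (hJ : IsInvCount d J) :
    Tendsto (fun n => (avg J n - (1 / (a.totient : ℝ) - 1 / b.totient) * LL n) / sqLL n) atTop
      (𝓝 (-Real.sqrt (varConst b c) / Real.sqrt (2 * Real.pi))) := by
  have hv : 0 < varConst b c := by
    have : (2 : ℝ) ≤ b.totient := by
      have := Nat.totient_pos.2 ha.pos
      exact_mod_cast (by omega : 2 ≤ b.totient)
    rw [varConst, ← hbc, show 1 / (b.totient : ℝ) + 1 / b.totient - 2 / (b.totient * b.totient) =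
      2 * (b.totient - 1) / (b.totient * b.totient) by field_simp; ring]
    have : (0 : ℝ) < b.totient - 1 := by linarith
    positivity
  have h1 := (isLittleO_av_invCount_sub ha hb hc hd had hbd hcd hab hbc hlow hup
    hJ).tendsto_div_nhds_zero
  have h2 := (isLittleO_av_om_sub a ha.pos).tendsto_div_nhds_zero
  have h3 := ((isLittleO_av_om_sub b hb.pos).tendsto_div_nhds_zero).const_mul 2⁻¹
  have h4 := ((isLittleO_av_om_sub c hc.pos).tendsto_div_nhds_zero).const_mul 2⁻¹
  have h5 := (tendsto_av_abs_om_sub hb.pos hc.pos hco hbc hv).const_mul 2⁻¹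
  rw [half_mul_div_sqrt hv] at h5
  have h := (((h1.add h2).sub h3).sub h4).sub h5
  simp only [mul_zero, add_zero, sub_zero, zero_sub, ← neg_div] at h
  refine h.congr fun n => ?_
  have e : av n (fun m => om a m - max (om b m) (om c m)) = av n (om a) -
      2⁻¹ * (av n (om b) + av n (om c) + av n (fun m => |om b m - om c m|)) := by
    rw [← av_add, ← av_add, ← av_const_mul, ← av_sub]
    refine congrArg _ (funext fun m => ?_)
    have : max (om b m) (om c m) = 2⁻¹ * (om b m + om c m + |om c m - om b m|) :=
      sup_eq_half_smul_add_add_abs_sub' ℝ _ _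
    rw [this, abs_sub_comm]
  rw [e, ← hbc, show avg J n = av n (fun m => (J m : ℝ)) from rfl]
  ring

section primePow
variable {q r s : ℕ}

lemma totient_lt_of_dvd (hq : IsPrimePow q) (hr : IsPrimePow r) (h : q ∣ r) (hne : q ≠ r) :
    q.totient < r.totient := by
  obtain ⟨p, k, hp, hk, rfl⟩ := (isPrimePow_nat_iff r).1 hr
  obtain ⟨l, hl, rfl⟩ := (Nat.dvd_prime_pow hp).1 h
  have hl0 : 0 < l := Nat.pos_of_ne_zero fun h0 => hq.ne_one (by rw [h0, pow_zero])
  have hlk : l < k := lt_of_le_of_ne hl fun h => hne (by rw [h])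
  rw [Nat.totient_prime_pow hp hl0, Nat.totient_prime_pow hp hk]
  exact Nat.mul_lt_mul_of_pos_right (Nat.pow_lt_pow_right hp.one_lt (by omega))
    (Nat.sub_pos_of_lt hp.one_lt)

lemma coprime_of_totient_eq (hq : IsPrimePow q) (hr : IsPrimePow r)
    (h : q.totient = r.totient) (hne : q ≠ r) : q.Coprime r := by
  obtain ⟨p, k, hp, hk, hpk⟩ := (isPrimePow_nat_iff q).1 hq
  obtain ⟨t, l, ht, hl, htl⟩ := (isPrimePow_nat_iff r).1 hr
  rcases eq_or_ne p t with rfl | hpt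
  · rcases le_total k l with hkl | hkl
    · exact absurd h (totient_lt_of_dvd hq hr (hpk ▸ htl ▸ pow_dvd_pow p hkl) hne).ne
    · exact absurd h (totient_lt_of_dvd hr hq (hpk ▸ htl ▸ pow_dvd_pow p hkl) hne.symm).ne'
  · rw [← hpk, ← htl]
    exact Nat.Coprime.pow _ _ ((Nat.coprime_primes hp ht).2 hpt)

lemma eq_totient_add_one {p t k l : ℕ} (hp : p.Prime) (ht : t.Prime) (hk : 0 < k) (hl : 0 < l)
    (h : (p ^ k).totient = (t ^ l).totient) (hpt : p < t) : t ^ l = (t ^ l).totient + 1 := by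
  have hl1 : l = 1 := by
    by_contra hne
    rw [Nat.totient_prime_pow hp hk, Nat.totient_prime_pow ht hl] at h
    have h1 : t ∣ p ^ (k - 1) * (p - 1) :=
      h ▸ (dvd_pow_self t (by omega : l - 1 ≠ 0)).mul_right _
    rcases ht.dvd_mul.1 h1 with h2 | h2
    · exact absurd (Nat.le_of_dvd hp.pos (ht.dvd_of_dvd_pow h2)) (by omega)
    · have := hp.two_le
      exact absurd (Nat.le_of_dvd (by omega) h2) (by omega)
  rw [hl1, pow_one, Nat.totient_prime ht]
  have := ht.two_le
  omega

lemma eq_totient_add_one_or (hq : IsPrimePow q) (hr : IsPrimePow r)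
    (h : q.totient = r.totient) (hne : q ≠ r) : q = q.totient + 1 ∨ r = r.totient + 1 := by
  have hc := coprime_of_totient_eq hq hr h hne
  obtain ⟨p, k, hp, hk, rfl⟩ := (isPrimePow_nat_iff q).1 hq
  obtain ⟨t, l, ht, hl, rfl⟩ := (isPrimePow_nat_iff r).1 hr
  rcases lt_trichotomy p t with hpt | rfl | hpt
  · exact Or.inr (eq_totient_add_one hp ht hk hl h hpt)
  · have := (hc.of_dvd (dvd_pow_self p hk.ne') (dvd_pow_self p hl.ne'))
    exact absurd ((Nat.coprime_self p).1 this) hp.ne_one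
  · exact Or.inl (eq_totient_add_one ht hp hl hk h.symm hpt)

/-- At most two prime powers share a totient. -/
lemma eq_or_eq_of_totient_eq (hq : IsPrimePow q) (hr : IsPrimePow r) (hs : IsPrimePow s)
    (hqr : q.totient = r.totient) (hrs : r.totient = s.totient) (hne : q ≠ r) :
    s = q ∨ s = r := by
  by_contra! hcon
  have h1 := eq_totient_add_one_or hq hr hqr hne
  have h2 := eq_totient_add_one_or hr hs hrs hcon.2.symm
  have h3 := eq_totient_add_one_or hq hs (hqr.trans hrs) hcon.1.symm
  omega

lemma dvd_or_dvd_of_dvd_lcm {a b : ℕ} (hq : IsPrimePow q) (h : q ∣ a.lcm b) : q ∣ a ∨ q ∣ b := by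
  obtain ⟨p, k, hp, hk, rfl⟩ := (isPrimePow_nat_iff q).1 hq
  rcases eq_or_ne a 0 with rfl | ha
  · exact Or.inl (dvd_zero _)
  rcases eq_or_ne b 0 with rfl | hb
  · exact Or.inr (dvd_zero _)
  rw [hp.pow_dvd_iff_le_factorization (Nat.lcm_ne_zero ha hb), Nat.factorization_lcm ha hb,
    Finsupp.sup_apply, le_sup_iff] at h
  rwa [hp.pow_dvd_iff_le_factorization ha, hp.pow_dvd_iff_le_factorization hb]

lemma exists_dvd_of_dvd_finset_lcm {ι : Type*} {S : Finset ι} {f : ι → ℕ} (hq : IsPrimePow q)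
    (h : q ∣ S.lcm f) : ∃ j ∈ S, q ∣ f j := by
  classical
  induction S using Finset.induction_on with
  | empty => exact absurd (Nat.dvd_one.1 (by simpa using h)) hq.ne_one
  | insert j S _ ih =>
    rw [Finset.lcm_insert] at h
    rcases dvd_or_dvd_of_dvd_lcm hq h with h | h
    · exact ⟨j, Finset.mem_insert_self _ _, h⟩
    · obtain ⟨k, hk, hqk⟩ := ih h
      exact ⟨k, Finset.mem_insert_of_mem hk, hqk⟩

lemma ppKey_lt (hq : IsPrimePow q) (h : q.totient < r.totient) : ppKey q < ppKey r := by
  have := le_two_mul_totient hq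
  unfold ppKey
  nlinarith

lemma ppKey_inj (hq : IsPrimePow q) (hr : IsPrimePow r) (h : ppKey q = ppKey r) : q = r := by
  rcases lt_trichotomy q.totient r.totient with h1 | h1 | h1
  · exact absurd h (ppKey_lt hq h1).ne
  · unfold ppKey at h
    rw [h1] at h
    omega
  · exact absurd h (ppKey_lt hr h1).ne'

end primePow

lemma infinite_ppKeys : {k | ∃ q : ℕ, IsPrimePow q ∧ ppKey q = k}.Infinite := by
  have h : (ppKey '' {p | p.Prime}).Infinite :=
    Nat.infinite_setOfPred_prime.image fun p hp r hr h =>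
      ppKey_inj (Nat.Prime.isPrimePow hp) (Nat.Prime.isPrimePow hr) h
  refine h.mono ?_
  rintro k ⟨p, hp, hk⟩
  exact ⟨p, Nat.Prime.isPrimePow hp, hk⟩

lemma qt_spec (i : ℕ) : IsPrimePow (qt i) ∧ ppKey (qt i) = ppNthKey (i - 1) :=
  Nat.sInf_mem (s := {q : ℕ | IsPrimePow q ∧ ppKey q = ppNthKey (i - 1)})
    (Nat.nth_mem_of_infinite infinite_ppKeys (i - 1))

lemma exists_qt_eq {q : ℕ} (hq : IsPrimePow q) : ∃ j, 1 ≤ j ∧ qt j = q := by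
  have : ppKey q ∈ Set.range (Nat.nth fun k => ∃ q : ℕ, IsPrimePow q ∧ ppKey q = k) := by
    rw [Nat.range_nth_of_infinite infinite_ppKeys]
    exact ⟨q, hq, rfl⟩
  obtain ⟨n, hn⟩ := this
  exact ⟨n + 1, by omega, ppKey_inj (qt_spec _).1 hq ((qt_spec _).2.trans hn)⟩

lemma totient_qt_le {i j : ℕ} (hij : i ≤ j) : (qt i).totient ≤ (qt j).totient := by
  by_contra! h
  have h1 := ppKey_lt (qt_spec j).1 h
  rw [(qt_spec i).2, (qt_spec j).2] at h1
  exact absurd ((Nat.nth_strictMono infinite_ppKeys).monotone (by omega : i - 1 ≤ j - 1))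
    (not_le.2 h1)

lemma qt_ne {i j : ℕ} (hi : 1 ≤ i) (hij : i < j) : qt i ≠ qt j := fun h => by
  have h1 := (qt_spec i).2
  rw [h, (qt_spec j).2] at h1
  exact absurd h1 (Nat.nth_strictMono infinite_ppKeys (by omega : i - 1 < j - 1)).ne'

lemma totient_qt_lt {i : ℕ} (hi : 1 ≤ i) (h : (UFO i).ncard = 1) :
    (qt i).totient < (qt (i + 1)).totient := by
  by_contra hlt
  have heq := le_antisymm (totient_qt_le i.le_succ) (not_lt.1 hlt)
  rw [UFO, if_neg hlt] at h
  by_cases hL : Lseq i = Nat.lcm (Lseq (i - 1)) (qt (i + 1))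
  · have h1 : qt i ∣ Nat.lcm (Lseq (i - 1)) (qt (i + 1)) :=
      hL ▸ Finset.dvd_lcm (Finset.mem_Icc.2 ⟨hi, le_rfl⟩)
    have h2 (j : ℕ) (hj : qt i ∣ qt j) (hne : qt i ≠ qt j) (hle : (qt j).totient ≤ (qt i).totient) :
        False := absurd (totient_lt_of_dvd (qt_spec i).1 (qt_spec j).1 hj hne) (not_lt.2 hle)
    rcases dvd_or_dvd_of_dvd_lcm (qt_spec i).1 h1 with h3 | h3
    · obtain ⟨j, hj, hij⟩ := exists_dvd_of_dvd_finset_lcm (qt_spec i).1 h3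
      rw [Finset.mem_Icc] at hj
      exact h2 j hij (qt_ne hj.1 (by omega)).symm (totient_qt_le (by omega))
    · exact h2 (i + 1) h3 (qt_ne hi i.lt_succ_self) heq.ge
  · rw [Set.ncard_pair hL] at h
    omega

lemma totient_qt_eq {i : ℕ} (h : (UFO i).ncard = 2) :
    (qt i).totient = (qt (i + 1)).totient := by
  refine le_antisymm (totient_qt_le i.le_succ) (not_lt.1 fun hlt => ?_)
  rw [UFO, if_pos hlt, Set.ncard_singleton] at h
  omega

lemma dvd_Lseq_iff {i q : ℕ} (hlt : (qt i).totient < (qt (i + 1)).totient)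
    (hq : IsPrimePow q) : q ∣ Lseq i ↔ q.totient ≤ (qt i).totient := by
  constructor
  · intro h
    obtain ⟨j, hj, hqj⟩ := exists_dvd_of_dvd_finset_lcm hq h
    exact (Nat.le_of_dvd (Nat.totient_pos.2 (qt_spec j).1.pos)
      (Nat.totient_dvd_of_dvd hqj)).trans (totient_qt_le (Finset.mem_Icc.1 hj).2)
  · intro h
    obtain ⟨j, hj, rfl⟩ := exists_qt_eq hq
    refine Finset.dvd_lcm (Finset.mem_Icc.2 ⟨hj, ?_⟩)
    by_contra! hij
    exact absurd (totient_qt_le hij) (not_le.2 (lt_of_le_of_lt h hlt))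

lemma Lseq_ne_zero (i : ℕ) : Lseq i ≠ 0 := by
  rw [Lseq, Ne, Finset.lcm_eq_zero_iff]
  rintro ⟨j, -, hj⟩
  exact (qt_spec j).1.ne_zero hj

end InvFactor

theorem statement5 (i : ℕ) (hi : 1 ≤ i)
    (h2 : (UFO i).ncard = 1) (h3 : (UFO (i + 1)).ncard = 2)
    (h1 : i = 1 ∨ (UFO (i - 1)).ncard = 1)
    (d : ℕ) (hd : UFO i = {d}) (J : ℕ → ℕ) (hJ : IsInvCount d J) :
    Filter.Tendsto (fun n : ℕ => (avg J n - muSeq i * LL n) / Real.sqrt (LL n))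
      Filter.atTop (nhds (-(sigSeq (i + 1)) / Real.sqrt (2 * Real.pi))) := by
  have hab := InvFactor.totient_qt_lt hi h2
  have hbc := InvFactor.totient_qt_eq h3
  rw [UFO, if_pos hab, Set.singleton_eq_singleton_iff] at hd
  subst hd
  have hpp (j : ℕ) : IsPrimePow (qt j) := (InvFactor.qt_spec j).1
  have hdvd {q : ℕ} (hq : IsPrimePow q) := InvFactor.dvd_Lseq_iff hab hq
  have hne : qt (i + 1) ≠ qt (i + 1 + 1) := InvFactor.qt_ne (by omega) (by omega)
  refine InvFactor.tendsto_avg_invCount (a := qt i) (b := qt (i + 1)) (c := qt (i + 1 + 1))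
    (hpp _) (hpp _) (hpp _) (InvFactor.Lseq_ne_zero i) ((hdvd (hpp _)).2 le_rfl)
    (fun h => absurd ((hdvd (hpp _)).1 h) (not_le.2 hab))
    (fun h => absurd ((hdvd (hpp _)).1 h) (not_le.2 (hbc ▸ hab))) hab hbc
    (InvFactor.coprime_of_totient_eq (hpp _) (hpp _) hbc hne) (fun q hq hqd hqa => ?_)
    (fun q hq hqd => ?_) hJ
  · obtain ⟨j, hj, rfl⟩ := InvFactor.exists_qt_eq hq
    have hji : j < i := by
      by_contra! hij
      rcases hij.eq_or_lt with rfl | hij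
      · exact hqa rfl
      · exact absurd ((hdvd hq).1 hqd)
          (not_le.2 (hab.trans_le (InvFactor.totient_qt_le hij)))
    obtain rfl | h1 := h1
    · omega
    · have := InvFactor.totient_qt_lt (by omega) h1
      rw [Nat.sub_add_cancel hi] at this
      exact (InvFactor.totient_qt_le (by omega)).trans_lt this
  · rw [hdvd hq, not_le] at hqd
    obtain ⟨j, hj, rfl⟩ := InvFactor.exists_qt_eq hq
    have hij : i + 1 ≤ j := by
      by_contra! hij
      exact absurd (InvFactor.totient_qt_le (by omega : j ≤ i)) (not_le.2 hqd)
    rcases (InvFactor.totient_qt_le hij).eq_or_lt with h | h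
    · rcases InvFactor.eq_or_eq_of_totient_eq (hpp (i + 1)) (hpp (i + 1 + 1)) hq hbc
        (hbc.symm.trans h) hne with h | h
      · exact Or.inl h
      · exact Or.inr (Or.inl h)
    · exact Or.inr (Or.inr h)

end
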